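/- Let N = p₁^m p₂^n, where m, n ≥ 1 and p₁, p₂ are primes with p₁ ≡ 1 (mod 4) and p₂ ≡ 3 (mod 4). Let p be a prime with ord_{p₁^m}(p) = φ(p₁^m), ord_{p₂^n}(p) = φ(p₂^n), and f := ord_N(p) = φ(N)/2. Let q = p^f, let γ be a primitive element of F_q, let C_i = γ^i⟨γ^N⟩ be the cyclotomic classes of order N, and let D = ⋃_{i=0}^{p₁^{m−1}−1} ⋃_{j=0}^{p₂^{n−1}−1} C_{p₂^n i + p₁^m j}. Let h be the class number of Q(√(−p₁p₂)), and suppose h is even and there exist b, c ∈ {1, −1} with 4p^h = b² + p₁p₂c², b·p^{(f−h)/2} ≡ 2 (mod p₁p₂), p₁ = 2p^{h/2} + b, and p₂ = 2p^{h/2} − b. Then Cay(F_q, D) is a strongly regular graph with p^f vertices and valency k = (p^f − 1)/(p₁p₂), whose two restricted eigenvalues are (2b·p^{(f+h)/2} − 1)/(p₁p₂) and (b·p^{(f−h)/2} − 2b·p^{(f+h)/2} − 1)/(p₁p₂); writing r, s for these eigenvalues, its parameters are λ = r + s + rs + k and μ = k + rs. -/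

import Mathlib

open scoped Classical Pointwise

/-- The cyclotomic class `C_i = γ^i ⟨γ^N⟩ = {γ^{i+Nk} : k ∈ ℤ}` of order `N` of a finite
field, with respect to the primitive element `γ`. -/
def cycClass {F : Type*} [Field F] (γ : Fˣ) (N i : ℕ) : Set F :=
  {x : F | ∃ k : ℤ, x = ((γ ^ ((i : ℤ) + (N : ℤ) * k) : Fˣ) : F)}

/-- The Cayley graph on the additive group `G` with connection set `D`. -/
def cayley {G : Type*} [AddGroup G] (D : Set G) : SimpleGraph G :=
  SimpleGraph.fromRel fun x y => x - y ∈ D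

open scoped Classical Pointwise

/-- A function on a finite field whose Fourier transform vanishes off `0` is constant. -/
lemma const_of_fourier {F : Type*} [Field F] [Fintype F] (ψ : AddChar F ℂ) (hψ : ψ.IsPrimitive)
    (g : F → ℂ) (hg : ∀ a : F, a ≠ 0 → ∑ x, g x * ψ (a * x) = 0) (z : F) :
    (Fintype.card F : ℂ) * g z = ∑ x, g x := by
  have h1 : ∑ a, (∑ x, g x * ψ (a * x)) * ψ (a * (-z)) = ∑ x, g x := by
    rw [Finset.sum_eq_single 0]
    · simp
    · intro a _ ha
      rw [hg a ha, zero_mul]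
    · simp
  rw [← h1]
  simp_rw [Finset.sum_mul]
  rw [Finset.sum_comm]
  have h2 : ∀ x : F, ∑ a, g x * ψ (a * x) * ψ (a * (-z)) =
      g x * (if x - z = 0 then (Fintype.card F : ℂ) else 0) := by
    intro x
    have h3 := AddChar.sum_mulShift (x - z) hψ
    push_cast at h3
    rw [← h3, Finset.mul_sum]
    refine Finset.sum_congr rfl fun a _ => ?_
    rw [mul_assoc, ← AddChar.map_add_eq_mul]
    congr 2
    ring
  simp_rw [h2, sub_eq_zero]
  simp [mul_comm]

lemma cayley_adj {G : Type*} [AddGroup G] (D : Set G) (h0 : (0 : G) ∉ D)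
    (hneg : ∀ x ∈ D, -x ∈ D) (x y : G) : (cayley D).Adj x y ↔ x - y ∈ D := by
  unfold cayley
  rw [SimpleGraph.fromRel_adj]
  constructor
  · rintro ⟨_, h | h⟩
    · exact h
    · simpa using hneg _ h
  · intro h
    refine ⟨?_, Or.inl h⟩
    rintro rfl
    exact h0 (by simpa using h)

theorem srg_of_periods {F : Type*} [Field F] [Fintype F] (ψ : AddChar F ℂ) (hψ : ψ.IsPrimitive)
    (D : Set F) (h0 : (0 : F) ∉ D) (hneg : ∀ x ∈ D, -x ∈ D) (k : ℕ)
    (hk : (Finset.univ.filter (· ∈ D)).card = k) (hk0 : 0 < k) (hk1 : k + 1 < Fintype.card F)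
    (r s : ℤ)
    (hval : ∀ a : F, a ≠ 0 → (∑ x ∈ Finset.univ.filter (· ∈ D), ψ (a * x) = r ∨
      ∑ x ∈ Finset.univ.filter (· ∈ D), ψ (a * x) = s))
    (hr : ∃ a : F, a ≠ 0 ∧ ∑ x ∈ Finset.univ.filter (· ∈ D), ψ (a * x) = r)
    (hs : ∃ a : F, a ≠ 0 ∧ ∑ x ∈ Finset.univ.filter (· ∈ D), ψ (a * x) = s) :
    ∃ lam mu : ℕ, (lam : ℤ) = r + s + r * s + k ∧ (mu : ℤ) = k + r * s ∧
      (cayley D).IsSRGWith (Fintype.card F) k lam mu ∧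
      (∀ μ' : ℝ,
        (∃ x : F → ℝ, x ≠ 0 ∧ (∑ i, x i) = 0 ∧
          ((cayley D).adjMatrix ℝ).mulVec x = μ' • x) ↔ (μ' = (r : ℝ) ∨ μ' = (s : ℝ))) := by
  set S : Finset F := Finset.univ.filter (· ∈ D) with hS
  have hmem : ∀ x, x ∈ S ↔ x ∈ D := by intro x; simp [hS]
  have hnegiff : ∀ x, -x ∈ D ↔ x ∈ D := fun x => ⟨fun h => by simpa using hneg _ h, hneg x⟩
  have hadj := cayley_adj D h0 hneg
  -- counting function
  let cnt : F → ℕ := fun z => (Finset.univ.filter (fun x => x ∈ D ∧ z - x ∈ D)).card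
  have hcntC : ∀ z, (cnt z : ℂ) = ∑ x, (if x ∈ D then (1:ℂ) else 0) * (if z - x ∈ D then 1 else 0) := by
    intro z
    simp only [cnt, Finset.card_filter]
    push_cast
    refine Finset.sum_congr rfl fun x _ => ?_
    by_cases h1 : x ∈ D <;> by_cases h2 : z - x ∈ D <;> simp [h1, h2]
  have heta : ∀ a, ∑ x ∈ S, ψ (a * x) = ∑ x, (if x ∈ D then (1:ℂ) else 0) * ψ (a * x) := by
    intro a
    rw [hS, Finset.sum_filter]
    refine Finset.sum_congr rfl fun x _ => ?_
    split_ifs <;> simp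
  have hconv : ∀ a, ∑ z, (cnt z : ℂ) * ψ (a * z) = (∑ x ∈ S, ψ (a * x)) ^ 2 := by
    intro a
    rw [heta, sq, Finset.sum_mul_sum]
    simp_rw [hcntC, Finset.sum_mul]
    rw [Finset.sum_comm]
    refine Finset.sum_congr rfl fun x _ => ?_
    rw [← Equiv.sum_comp (Equiv.addRight x)]
    refine Finset.sum_congr rfl fun y _ => ?_
    simp only [Equiv.coe_addRight, add_sub_cancel_right, mul_add, AddChar.map_add_eq_mul]
    ring
  let g : F → ℂ := fun z => cnt z - (r + s) * (if z ∈ D then 1 else 0) + r * s * (if z = 0 then 1 else 0)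
  have hg : ∀ a : F, a ≠ 0 → ∑ x, g x * ψ (a * x) = 0 := by
    intro a ha
    have : ∑ x, g x * ψ (a * x) = (∑ x ∈ S, ψ (a * x)) ^ 2 - (r + s) * (∑ x ∈ S, ψ (a * x)) + r * s := by
      rw [← hconv, heta, Finset.mul_sum, ← Finset.sum_sub_distrib]
      have h1 : (r * s : ℂ) = ∑ x, r * s * (if x = 0 then (1:ℂ) else 0) * ψ (a * x) := by
        rw [Finset.sum_eq_single 0] <;> simp +contextual
      conv_rhs => rw [h1]
      rw [← Finset.sum_add_distrib]
      refine Finset.sum_congr rfl fun x _ => ?_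
      simp only [g]
      ring
    rw [this]
    rcases hval a ha with h | h <;> rw [h] <;> ring
  have hconst := const_of_fourier ψ hψ g hg
  have hq : (Fintype.card F : ℂ) ≠ 0 := by simp
  have hg0 : ∀ z, g z = g 0 := fun z => by
    apply mul_left_cancel₀ hq
    rw [hconst, hconst]
  have hcnt0 : cnt 0 = k := by
    rw [← hk]
    simp only [cnt]
    congr 1
    ext x
    simp [hS, hnegiff]
  have hmain : ∀ z, (cnt z : ℤ) = (r + s) * (if z ∈ D then 1 else 0) - r * s * (if z = 0 then 1 else 0) + (k + r * s) := by
    intro z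
    have h1 := hg0 z
    simp only [g, hcnt0, if_neg h0] at h1
    have : (cnt z : ℂ) = (r + s) * (if z ∈ D then 1 else 0) - r * s * (if z = 0 then 1 else 0) + (k + r * s) := by
      simp only [if_true] at h1
      linear_combination h1
    by_cases h1 : z ∈ D <;> by_cases h2 : z = 0 <;> simp [h1, h2] at this ⊢ <;> exact_mod_cast this
  -- existence of lam and mu
  obtain ⟨z1, hz1⟩ : ∃ z, z ∈ S := by
    apply Finset.card_pos.mp; omega
  obtain ⟨z2, hz2⟩ : ∃ z, z ∉ insert 0 S := by
    by_contra hcon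
    push Not at hcon
    have h1 : (insert (0:F) S) = Finset.univ := Finset.eq_univ_iff_forall.mpr hcon
    have h2 := Finset.card_insert_le (0:F) S
    rw [h1, Finset.card_univ] at h2
    omega
  have hz1D : z1 ∈ D := (hmem _).1 hz1
  have hz10 : z1 ≠ 0 := by rintro rfl; exact h0 hz1D
  rw [Finset.mem_insert, not_or, hmem] at hz2
  have hlam : (cnt z1 : ℤ) = r + s + r * s + k := by
    rw [hmain]; simp [hz1D, hz10]; ring
  have hmu : (cnt z2 : ℤ) = k + r * s := by
    rw [hmain]; simp [hz2.1, hz2.2]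
  have hcommon : ∀ v w : F, Fintype.card ((cayley D).commonNeighbors v w) = cnt (v - w) := by
    intro v w
    simp only [cnt]
    rw [← Set.toFinset_card]
    apply Finset.card_bij (fun x _ => v - x)
    · intro x hx
      rw [Set.mem_toFinset, SimpleGraph.mem_commonNeighbors, hadj, hadj] at hx
      simp only [Finset.mem_filter, Finset.mem_univ, true_and]
      refine ⟨hx.1, ?_⟩
      have := hneg _ hx.2
      convert this using 1; ring
    · intro x _ y _ hxy
      simpa using hxy
    · intro y hy
      simp only [Finset.mem_filter, Finset.mem_univ, true_and] at hy
      refine ⟨v - y, ?_, by ring⟩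
      rw [Set.mem_toFinset, SimpleGraph.mem_commonNeighbors, hadj, hadj]
      refine ⟨by simpa using hy.1, ?_⟩
      have := hneg _ hy.2
      convert this using 1; ring
  have hdeg : ∀ v : F, (cayley D).degree v = k := by
    intro v
    rw [← hk, ← SimpleGraph.card_neighborFinset_eq_degree]
    apply Finset.card_bij (fun x _ => v - x)
    · intro x hx
      rw [SimpleGraph.mem_neighborFinset, hadj] at hx
      exact (hmem _).2 hx
    · intro x _ y _ hxy
      simpa using hxy
    · intro y hy
      refine ⟨v - y, ?_, by ring⟩
      rw [SimpleGraph.mem_neighborFinset, hadj]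
      simpa using (hmem _).1 hy
  have hsrg : (cayley D).IsSRGWith (Fintype.card F) k (cnt z1) (cnt z2) := by
    refine ⟨rfl, fun v => ?_, ?_, ?_⟩
    · convert hdeg v
    · intro v w hvw
      have h1 : v - w ∈ D := (hadj _ _).1 hvw
      have h2 : v - w ≠ 0 := by intro h; rw [h] at h1; exact h0 h1
      have h3 := hmain (v - w)
      have h4 := hcommon v w
      simp only [if_pos h1, if_neg h2] at h3
      have : cnt (v - w) = cnt z1 := by zify; rw [h3, hlam]; ring
      rw [← this, ← h4]
    · intro v w hvw hnadj
      have h1 : v - w ∉ D := fun h => hnadj ((hadj _ _).2 h)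
      have h2 : v - w ≠ 0 := sub_ne_zero.mpr hvw
      have h3 := hmain (v - w)
      have h4 := hcommon v w
      simp only [if_neg h1, if_neg h2] at h3
      have : cnt (v - w) = cnt z2 := by zify; rw [h3, hmu]; ring
      rw [← this, ← h4]
  refine ⟨cnt z1, cnt z2, hlam, hmu, hsrg, ?_⟩
  have hmulVec : ∀ (x : F → ℝ) (v : F), ((cayley D).adjMatrix ℝ).mulVec x v = ∑ y ∈ S, x (v + y) := by
    intro x v
    rw [SimpleGraph.adjMatrix_mulVec_apply]
    apply Finset.sum_bij (fun y _ => y - v)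
    · intro y hy
      rw [SimpleGraph.mem_neighborFinset, hadj] at hy
      rw [hmem]
      have := hneg _ hy
      simpa using this
    · intro a _ b _ hab
      simpa using hab
    · intro b hb
      refine ⟨v + b, ?_, by ring⟩
      rw [SimpleGraph.mem_neighborFinset, hadj]
      have := hneg _ ((hmem _).1 hb)
      simpa using this
    · intro a _
      congr 1; ring
  intro μ'
  have hback : ∀ t : ℤ, (∃ a : F, a ≠ 0 ∧ ∑ x ∈ S, ψ (a * x) = t) → ∃ x : F → ℝ, x ≠ 0 ∧ (∑ i, x i) = 0 ∧
          ((cayley D).adjMatrix ℝ).mulVec x = (t : ℝ) • x := by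
    rintro t ⟨a, ha, hat⟩
    refine ⟨fun y => (ψ (a * y)).re, ?_, ?_, ?_⟩
    · intro h
      have := congrFun h 0
      simp at this
    · rw [← Complex.re_sum]
      have := AddChar.sum_mulShift a hψ
      simp only [if_neg ha] at this
      have h2 : ∑ i, ψ (a * i) = 0 := by
        rw [Nat.cast_zero] at this
        rw [← this]
        exact Finset.sum_congr rfl fun x _ => by rw [mul_comm]
      rw [h2]; rfl
    · ext v
      rw [hmulVec]
      simp only [Pi.smul_apply, smul_eq_mul]
      rw [← Complex.re_sum]
      have : ∑ y ∈ S, ψ (a * (v + y)) = (t : ℂ) * ψ (a * v) := by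
        rw [← hat, Finset.sum_mul]
        refine Finset.sum_congr rfl fun x _ => ?_
        rw [mul_add, AddChar.map_add_eq_mul, mul_comm]
      rw [this]
      simp
  constructor
  · rintro ⟨x, hx0, hxsum, hx⟩
    have hv : ∀ v, ∑ y ∈ S, x (v + y) = μ' * x v := by
      intro v
      rw [← hmulVec, hx]; rfl
    have hv2 : ∀ v, ∑ z, (cnt z : ℝ) * x (v + z) = μ' * (μ' * x v) := by
      intro v
      rw [← hv v, Finset.mul_sum]
      simp_rw [← hv]
      have hcntR : ∀ z, (cnt z : ℝ) = ∑ y, (if y ∈ D then (1:ℝ) else 0) * (if z - y ∈ D then 1 else 0) := by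
        intro z
        have := hcntC z
        have h2 : ((∑ y, (if y ∈ D then (1:ℝ) else 0) * (if z - y ∈ D then 1 else 0) : ℝ) : ℂ) = cnt z := by
          rw [this]; push_cast
          refine Finset.sum_congr rfl fun x _ => ?_
          by_cases h1 : x ∈ D <;> by_cases h2 : z - x ∈ D <;> simp [h1, h2]
        exact_mod_cast h2.symm
      simp_rw [hcntR, Finset.sum_mul]
      rw [Finset.sum_comm, hS, Finset.sum_filter]
      refine Finset.sum_congr rfl fun y _ => ?_
      by_cases hy : y ∈ D
      · simp only [if_pos hy, Finset.sum_filter]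
        rw [← Equiv.sum_comp (Equiv.addRight y)]
        refine Finset.sum_congr rfl fun u _ => ?_
        simp only [Equiv.coe_addRight, add_sub_cancel_right]
        rw [show v + (u + y) = v + y + u by ring]
        split_ifs <;> simp
      · simp [hy]
    have hv3 : ∀ v, ∑ z, (cnt z : ℝ) * x (v + z) = (r + s) * (μ' * x v) - r * s * x v := by
      intro v
      have hm : ∀ z, (cnt z : ℝ) = (r + s) * (if z ∈ D then 1 else 0) - r * s * (if z = 0 then 1 else 0) + (k + r * s) := by
        intro z
        have := hmain z
        have h2 : ((cnt z : ℤ) : ℝ) = (((r + s) * (if z ∈ D then 1 else 0) - r * s * (if z = 0 then 1 else 0) + (k + r * s) : ℤ) : ℝ) := by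
          rw [this]
        push_cast at h2
        exact h2
      have hsum : ∑ z, x (v + z) = 0 := by
        rw [← hxsum]
        exact Equiv.sum_comp (Equiv.addLeft v) x
      have e3 : ∑ z, (r * s : ℝ) * (if z = 0 then 1 else 0) * x (v + z) = r * s * x v := by
        rw [Finset.sum_eq_single 0] <;> simp +contextual
      have e4 : ∑ z, (r + s : ℝ) * (if z ∈ D then 1 else 0) * x (v + z) = (r + s) * (μ' * x v) := by
        rw [← hv v, hS, Finset.sum_filter, Finset.mul_sum]
        refine Finset.sum_congr rfl fun u _ => ?_
        split_ifs <;> simp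
      have e5 : ∑ z, (k + r * s : ℝ) * x (v + z) = 0 := by rw [← Finset.mul_sum, hsum, mul_zero]
      have e6 : ∑ z, (cnt z : ℝ) * x (v + z) =
          ∑ z, (r + s : ℝ) * (if z ∈ D then 1 else 0) * x (v + z) -
          ∑ z, (r * s : ℝ) * (if z = 0 then 1 else 0) * x (v + z) +
          ∑ z, (k + r * s : ℝ) * x (v + z) := by
        rw [← Finset.sum_sub_distrib, ← Finset.sum_add_distrib]
        refine Finset.sum_congr rfl fun u _ => ?_
        rw [hm]; ring
      rw [e6, e3, e4, e5, add_zero]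
    obtain ⟨v, hvne⟩ := Function.ne_iff.mp hx0
    have h5 := (hv2 v).symm.trans (hv3 v)
    have h6 : x v * ((μ' - r) * (μ' - s)) = 0 := by linear_combination h5
    rcases mul_eq_zero.mp h6 with h | h
    · exact absurd h hvne
    · rcases mul_eq_zero.mp h with h | h
      · left; linarith
      · right; linarith
  · rintro (h | h)
    · rw [h]; exact hback r hr
    · rw [h]; exact hback s hs

theorem norm_sub_lb (z : ℂ) (hz : ‖z‖ = 1) (hz1 : z ≠ 1) {t : ℝ} (ht : 0 ≤ t) :
    0 < (1 - z * (Real.exp (-t) : ℂ)).re := by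
  have h1 : Real.exp (-t) ≤ 1 := by simpa using ht
  have h0 : 0 < Real.exp (-t) := Real.exp_pos _
  have hre : z.re ≤ 1 := hz ▸ Complex.re_le_norm z
  have hre1 : z.re ≠ 1 := by
    intro h
    apply hz1
    have hn : Complex.normSq z = 1 := by rw [Complex.normSq_eq_norm_sq, hz]; norm_num
    rw [Complex.normSq_apply, h] at hn
    have : z.im = 0 := by nlinarith
    apply Complex.ext <;> simp [h, this]
  have hlt : z.re < 1 := lt_of_le_of_ne hre hre1
  rw [Complex.sub_re, Complex.re_mul_ofReal, Complex.one_re]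
  nlinarith

theorem expZeta_one_eq (x : ℝ) (hx0 : 0 < x) (hx1 : x < 1) :
    HurwitzZeta.expZeta (x : UnitAddCircle) 1 =
      -Complex.log (1 - Complex.exp (2 * Real.pi * Complex.I * x)) := by
  set z : ℂ := Complex.exp (2 * Real.pi * Complex.I * x) with hzdef
  have hz : ‖z‖ = 1 := by
    rw [hzdef, show (2 * Real.pi * Complex.I * x : ℂ) = ((2 * Real.pi * x : ℝ) : ℂ) * Complex.I by
      push_cast; ring]
    exact Complex.norm_exp_ofReal_mul_I _
  have hxne : (x : UnitAddCircle) ≠ 0 := by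
    intro h
    rw [AddCircle.coe_eq_zero_iff] at h
    obtain ⟨n, hn⟩ := h
    have hn' : (n : ℝ) = x := by simpa using hn
    have h1 : (0 : ℝ) < n := hn' ▸ hx0
    have h2 : (n : ℝ) < 1 := hn' ▸ hx1
    have : (0 : ℤ) < n := by exact_mod_cast h1
    have : n < (1 : ℤ) := by exact_mod_cast h2
    omega
  have hz1 : z ≠ 1 := by
    intro h
    rw [hzdef, Complex.exp_eq_one_iff] at h
    obtain ⟨n, hn⟩ := h
    have hpi : (2 * Real.pi * Complex.I : ℂ) ≠ 0 := by
      simp [Real.pi_ne_zero]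
    have : (x : ℂ) = n := by
      apply mul_left_cancel₀ hpi
      rw [hn]; ring
    have hn' : x = (n : ℝ) := by exact_mod_cast this
    have h1 : (0 : ℝ) < n := hn' ▸ hx0
    have h2 : (n : ℝ) < 1 := hn' ▸ hx1
    have : (0 : ℤ) < n := by exact_mod_cast h1
    have : n < (1 : ℤ) := by exact_mod_cast h2
    omega
  let F : ℝ → ℂ := fun t => z * (Real.exp (-t) : ℂ) / (1 - z * (Real.exp (-t) : ℂ))
  have hne : ∀ t : ℝ, 0 ≤ t → 1 - z * (Real.exp (-t) : ℂ) ≠ 0 := by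
    intro t ht h
    have := norm_sub_lb z hz hz1 ht
    rw [h] at this; simp at this
  have hFc : ContinuousOn F (Set.Ici 0) := by
    apply ContinuousOn.div
    · fun_prop
    · fun_prop
    · intro t ht; exact hne t ht
  have hFli : MeasureTheory.LocallyIntegrableOn F (Set.Ioi 0) MeasureTheory.volume :=
    (hFc.mono Set.Ioi_subset_Ici_self).locallyIntegrableOn measurableSet_Ioi
  have hlim : Filter.Tendsto (fun t : ℝ => 1 - z * (Real.exp (-t) : ℂ)) Filter.atTop (nhds 1) := by
    have : Filter.Tendsto (fun t : ℝ => (Real.exp (-t) : ℂ)) Filter.atTop (nhds ((0 : ℝ) : ℂ)) :=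
      (Complex.continuous_ofReal.tendsto 0).comp Real.tendsto_exp_neg_atTop_nhds_zero
    simpa using (this.const_mul z).const_sub 1
  have hFtop : F =O[Filter.atTop] fun t => Real.exp (-1 * t) := by
    have h1 : (fun t : ℝ => (1 - z * (Real.exp (-t) : ℂ))⁻¹) =O[Filter.atTop] (fun _ => (1 : ℝ)) :=
      (hlim.inv₀ one_ne_zero).isBigO_one ℝ
    have h2 : (fun t : ℝ => z * (Real.exp (-t) : ℂ)) =O[Filter.atTop]
        fun t => Real.exp (-1 * t) := by
      apply Asymptotics.IsBigO.of_bound 1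
      filter_upwards with t
      rw [norm_mul, hz, Complex.norm_real]; simp
    simpa [F, div_eq_mul_inv] using h2.mul h1
  have hF0 : F =O[nhdsWithin 0 (Set.Ioi 0)] fun x => x ^ (-(0:ℝ)) := by
    have h1 : Filter.Tendsto F (nhdsWithin 0 (Set.Ioi 0)) (nhds (F 0)) :=
      (hFc 0 (by simp)).mono_left (nhdsWithin_mono _ Set.Ioi_subset_Ici_self)
    simpa using h1.isBigO_one ℝ
  have hmd : DifferentiableAt ℂ (mellin F) 1 :=
    mellin_differentiableAt_of_isBigO_rpow_exp one_pos hFli hFtop hF0 (by simp)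
  have hmc : MellinConvergent F 1 :=
    mellinConvergent_of_isBigO_rpow_exp one_pos hFli hFtop hF0 (by simp)
  have hsum : ∀ s : ℂ, 1 < s.re → mellin F s = Complex.Gamma s * HurwitzZeta.expZeta (x : UnitAddCircle) s := by
    intro s hs
    have h1 : HasSum (fun n : ℕ => Complex.Gamma s * z ^ (n+1) / (((n + 1 : ℝ)) : ℂ) ^ s) (mellin F s) := by
      apply hasSum_mellin (a := fun n : ℕ => z ^ (n+1)) (p := fun n : ℕ => (n + 1 : ℝ))
      · intro i; right; positivity
      · linarith
      · intro t ht
        have hw : ‖z * (Real.exp (-t) : ℂ)‖ < 1 := by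
          rw [norm_mul, hz, Complex.norm_real]
          simpa using ht
        have := (hasSum_geometric_of_norm_lt_one hw).mul_left (z * (Real.exp (-t) : ℂ))
        refine HasSum.congr_fun this fun n => ?_
        rw [← pow_succ', mul_pow]
        congr 1
        rw [← Complex.ofReal_pow, ← Real.exp_nat_mul]
        congr 2
        push_cast; ring
      · have := (Real.summable_one_div_nat_rpow.mpr hs)
        rw [← summable_nat_add_iff 1] at this
        refine this.congr fun n => ?_
        rw [norm_pow, hz]; simp
    have h2 := (HurwitzZeta.hasSum_expZeta_of_one_lt_re x hs)
    rw [← hasSum_nat_add_iff' 1] at h2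
    simp only [Finset.range_one, Finset.sum_singleton, Nat.cast_zero] at h2
    rw [Complex.zero_cpow (by intro h; rw [h] at hs; simp at hs; linarith), div_zero, sub_zero] at h2
    have h3 := h2.mul_left (Complex.Gamma s)
    refine h1.unique ?_
    refine HasSum.congr_fun h3 fun n => ?_
    rw [mul_div_assoc, hzdef, ← Complex.exp_nat_mul]
    congr 3
    · ring
    · push_cast; ring
  have hL : mellin F 1 = Complex.Gamma 1 * HurwitzZeta.expZeta (x : UnitAddCircle) 1 := by
    have hc : Filter.Tendsto (fun u : ℝ => (u : ℂ)) (nhdsWithin 1 (Set.Ioi 1)) (nhds 1) := by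
      have := (Complex.continuous_ofReal.tendsto 1).mono_left (nhdsWithin_le_nhds (s := Set.Ioi 1))
      simpa using this
    have t1 := hmd.continuousAt.tendsto.comp hc
    have hG : ContinuousAt Complex.Gamma 1 := by
      apply (Complex.differentiableAt_Gamma 1 ?_).continuousAt
      intro m hm
      have := congrArg Complex.re hm
      simp at this
      have : (0:ℝ) ≤ m := by positivity
      linarith
    have t2 := (hG.tendsto.comp hc).mul
      ((HurwitzZeta.differentiable_expZeta_of_ne_zero hxne 1).continuousAt.tendsto.comp hc)
    refine tendsto_nhds_unique (t1.congr' ?_) t2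
    filter_upwards [self_mem_nhdsWithin] with u hu
    exact hsum u (by simpa using hu)
  rw [Complex.Gamma_one, one_mul] at hL
  rw [← hL]
  have hme : mellin F 1 = ∫ t in Set.Ioi (0:ℝ), F t := by
    simp [mellin]
  rw [hme]
  have hintg : MeasureTheory.IntegrableOn F (Set.Ioi 0) MeasureTheory.volume := by
    have := hmc
    rw [MellinConvergent] at this
    simpa using this
  rw [MeasureTheory.integral_Ioi_of_hasDerivAt_of_tendsto
    (f := fun t : ℝ => Complex.log (1 - z * (Real.exp (-t) : ℂ))) (m := 0) ?_ ?_ hintg ?_]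
  · simp
  · apply ContinuousAt.continuousWithinAt
    apply ContinuousAt.clog
    · fun_prop
    · exact Or.inl (norm_sub_lb z hz hz1 le_rfl)
  · intro t ht
    have h0 : HasDerivAt (fun t : ℝ => Real.exp (-t)) (- Real.exp (-t)) t := by
      simpa using (hasDerivAt_neg t).exp
    have h1 : HasDerivAt (fun t : ℝ => 1 - z * (Real.exp (-t) : ℂ)) (z * (Real.exp (-t) : ℂ)) t := by
      have := (h0.ofReal_comp.const_mul z).const_sub 1
      simpa using this
    exact h1.clog_real (Or.inl (norm_sub_lb z hz hz1 (le_of_lt ht)))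
  · have := (hlim.clog (by simp))
    simpa using this

theorem expZeta_one_sub (x : ℝ) (hx0 : 0 < x) (hx1 : x < 1) :
    HurwitzZeta.expZeta (x : UnitAddCircle) 1 - HurwitzZeta.expZeta (-(x : UnitAddCircle)) 1 =
      Real.pi * Complex.I * (1 - 2 * x) := by
  have hneg : -(x : UnitAddCircle) = ((1 - x : ℝ) : UnitAddCircle) := by
    rw [AddCircle.coe_sub, AddCircle.coe_period, zero_sub]
  rw [hneg, expZeta_one_eq x hx0 hx1, expZeta_one_eq (1 - x) (by linarith) (by linarith)]
  have hc : 1 - Complex.exp (2 * Real.pi * Complex.I * ((1 - x : ℝ) : ℂ)) =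
      (starRingEnd ℂ) (1 - Complex.exp (2 * Real.pi * Complex.I * x)) := by
    rw [map_sub, map_one, ← Complex.exp_conj]
    congr 1
    rw [show (2 * Real.pi * Complex.I * ((1 - x : ℝ) : ℂ)) =
      -(2 * Real.pi * Complex.I * x) + 2 * Real.pi * Complex.I by push_cast; ring,
      Complex.exp_add, Complex.exp_two_pi_mul_I, mul_one]
    congr 1
    rw [map_mul, map_mul, map_mul, Complex.conj_I, Complex.conj_ofReal, Complex.conj_ofReal,
      Complex.conj_ofNat]
    ring
  have hr : 0 < 2 * Real.sin (Real.pi * x) := by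
    have := Real.sin_pos_of_pos_of_lt_pi (x := Real.pi * x) (by positivity)
      (by nlinarith [Real.pi_pos])
    linarith
  have hpol : 1 - Complex.exp (2 * Real.pi * Complex.I * x) =
      ((2 * Real.sin (Real.pi * x) : ℝ) : ℂ) *
      (Complex.cos ((Real.pi * x - Real.pi / 2 : ℝ) : ℂ) +
        Complex.sin ((Real.pi * x - Real.pi / 2 : ℝ) : ℂ) * Complex.I) := by
    rw [show (2 * Real.pi * Complex.I * x : ℂ) = (2 * ((Real.pi * x : ℝ) : ℂ)) * Complex.I by
      push_cast; ring, Complex.exp_mul_I, Complex.cos_two_mul, Complex.sin_two_mul]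
    rw [← Complex.ofReal_cos, ← Complex.ofReal_sin, ← Complex.ofReal_cos, ← Complex.ofReal_sin,
      Real.cos_sub_pi_div_two, Real.sin_sub_pi_div_two]
    have h1 := Real.sin_sq_add_cos_sq (Real.pi * x)
    generalize Real.sin (Real.pi * x) = a at h1 ⊢
    generalize Real.cos (Real.pi * x) = b at h1 ⊢
    have h1' : (a : ℂ) ^ 2 + (b : ℂ) ^ 2 = 1 := by exact_mod_cast h1
    push_cast
    linear_combination -2 * h1'
  have harg : (1 - Complex.exp (2 * Real.pi * Complex.I * x)).arg = Real.pi * x - Real.pi / 2 := by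
    rw [hpol]
    apply Complex.arg_mul_cos_add_sin_mul_I hr
    constructor <;> nlinarith [Real.pi_pos]
  have hargne : (1 - Complex.exp (2 * Real.pi * Complex.I * x)).arg ≠ Real.pi := by
    rw [harg]; nlinarith [Real.pi_pos]
  rw [hc, Complex.log_conj _ hargne]
  apply Complex.ext
  · simp [Complex.log_im]
  · simp [Complex.log_im, harg]; ring

theorem LFunction_one_odd {d : ℕ} [NeZero d] (χ : DirichletCharacter ℂ d)
    (hprim : χ.IsPrimitive) (hodd : χ.Odd) (hreal : χ⁻¹ = χ) (hd : 1 < d) :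
    ‖DirichletCharacter.LFunction χ 1‖ * (d * Real.sqrt d) =
      Real.pi * ‖∑ j : ZMod d, χ j * (j.val : ℂ)‖ := by
  haveI : Fact (1 < d) := ⟨hd⟩
  set c : ℂ := χ (-1) * gaussSum χ ZMod.stdAddChar with hcdef
  have hF : ZMod.dft χ = fun j => c * χ j := by
    ext k
    rw [hprim.fourierTransform_eq_inv_mul_gaussSum, hreal, ← neg_one_mul, map_mul]
    rw [hcdef]; ring
  clear_value c
  have hchi0 : χ 0 = 0 := χ.map_nonunit (by simp)
  have hneg : ∀ j, χ (-j) = - χ j := fun j => by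
    have h := hodd.eval_neg (x := j)
    exact h
  have hc2 : c * c = -d := by
    have h1 := ZMod.dft_dft (⇑χ)
    rw [hF] at h1
    have h2 := congrFun h1 1
    rw [ZMod.dft_const_mul, hF] at h2
    simp only [map_one, hneg, smul_eq_mul, mul_one, mul_neg] at h2
    exact h2
  have hcn : ‖c‖ = Real.sqrt d := by
    have : ‖c‖ * ‖c‖ = d := by
      rw [← norm_mul, hc2]; simp
    rw [← this, Real.sqrt_mul_self (norm_nonneg _)]
  have h1 := ZMod.LFunction_dft (⇑χ) (s := 1) (Or.inl hchi0)
  have hLs : ZMod.LFunction (ZMod.dft χ) 1 = c * DirichletCharacter.LFunction χ 1 := by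
    rw [hF]
    simp only [DirichletCharacter.LFunction, ZMod.LFunction, Finset.mul_sum]
    refine Finset.sum_congr rfl fun j _ => by ring
  rw [hLs] at h1
  have h2 : ∑ j, χ j * HurwitzZeta.expZeta (ZMod.toAddCircle (-j)) 1 =
      -∑ j, χ j * HurwitzZeta.expZeta (ZMod.toAddCircle j) 1 := by
    rw [← Equiv.sum_comp (Equiv.neg (ZMod d)), ← Finset.sum_neg_distrib]
    refine Finset.sum_congr rfl fun j _ => ?_
    simp [hneg]
  have hs0 : ∑ j, χ j = 0 := by
    have : ∑ j, χ j = - ∑ j, χ j := by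
      conv_lhs => rw [← Equiv.sum_comp (Equiv.neg (ZMod d))]
      rw [← Finset.sum_neg_distrib]
      exact Finset.sum_congr rfl fun j _ => by simp [hneg]
    linear_combination this / 2
  have h3 : 2 * (c * DirichletCharacter.LFunction χ 1) =
      2 * (Real.pi * Complex.I / d) * ∑ j : ZMod d, χ j * (j.val : ℂ) := by
    have h4 : 2 * (c * DirichletCharacter.LFunction χ 1) =
      -∑ j, χ j * (HurwitzZeta.expZeta (ZMod.toAddCircle j) 1 -
        HurwitzZeta.expZeta (ZMod.toAddCircle (-j)) 1) := by
      simp only [mul_sub, Finset.sum_sub_distrib]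
      rw [h2, h1, h2]; ring
    have h5 : ∀ j : ZMod d, χ j * (HurwitzZeta.expZeta (ZMod.toAddCircle j) 1 -
        HurwitzZeta.expZeta (ZMod.toAddCircle (-j)) 1) =
        χ j * (Real.pi * Complex.I) - 2 * (Real.pi * Complex.I / d) * (χ j * (j.val : ℂ)) := by
      intro j
      by_cases hj : j = 0
      · subst hj; simp [hchi0]
      have hdpos : (0:ℝ) < d := by exact_mod_cast NeZero.pos d
      have hj0 : 0 < j.val := by
        rcases Nat.eq_zero_or_pos j.val with h | h
        · exact absurd ((ZMod.val_eq_zero j).mp h) hj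
        · exact h
      rw [map_neg, ZMod.toAddCircle_apply, expZeta_one_sub]
      · push_cast; field_simp
      · have : (0:ℝ) < j.val := by exact_mod_cast hj0
        positivity
      · rw [div_lt_one hdpos]
        exact_mod_cast ZMod.val_lt j
    rw [h4]
    simp only [h5]
    rw [Finset.sum_sub_distrib, ← Finset.sum_mul, hs0, ← Finset.mul_sum]
    ring
  have h6 : c * DirichletCharacter.LFunction χ 1 =
      (Real.pi * Complex.I / d) * ∑ j : ZMod d, χ j * (j.val : ℂ) := by
    linear_combination h3 / 2
  have h7 := congrArg norm h6
  rw [norm_mul, norm_mul, hcn] at h7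
  have hdpos : (0:ℝ) < d := by exact_mod_cast NeZero.pos d
  have h8 : ‖(Real.pi * Complex.I / d : ℂ)‖ = Real.pi / d := by
    simp [abs_of_pos Real.pi_pos]
  rw [h8] at h7
  field_simp at h7
  linear_combination h7

open Polynomial in
theorem quad_minpoly {K : Type*} [Field K] [NumberField K] (α : K) (d : ℕ) (hd : 1 < d)
    (hα : α ^ 2 = -(d : K)) : minpoly ℚ α = X ^ 2 + C (d : ℚ) := by
  symm
  apply minpoly.eq_of_irreducible_of_monic
  · rw [Polynomial.irreducible_iff_roots_eq_zero_of_degree_le_three]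
    · rw [Multiset.eq_zero_iff_forall_notMem]
      intro x hx
      rw [Polynomial.mem_roots'] at hx
      have h := hx.2
      simp only [IsRoot.def, eval_add, eval_pow, eval_X, eval_C] at h
      have : (0:ℚ) < d := by exact_mod_cast (by omega : 0 < d)
      nlinarith [sq_nonneg x]
    · rw [natDegree_X_pow_add_C]
    · rw [natDegree_X_pow_add_C]; norm_num
  · simp [hα]
  · exact monic_X_pow_add_C _ (by norm_num)

theorem quad_adjoin_top {K : Type*} [Field K] [NumberField K] (α : K)
    (hK : Algebra.adjoin ℚ {α} = ⊤) : IntermediateField.adjoin ℚ {α} = ⊤ := by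
  apply IntermediateField.toSubalgebra_injective
  rw [IntermediateField.adjoin_toSubalgebra, hK]; rfl

theorem quad_finrank {K : Type*} [Field K] [NumberField K] (α : K) (d : ℕ) (hd : 1 < d)
    (hα : α ^ 2 = -(d : K)) (hK : Algebra.adjoin ℚ {α} = ⊤) : Module.finrank ℚ K = 2 := by
  have h1 := IntermediateField.adjoin.finrank (K := ℚ) (x := α)
    (Algebra.IsIntegral.isIntegral α)
  rw [quad_minpoly α d hd hα, Polynomial.natDegree_X_pow_add_C, quad_adjoin_top α hK,
    IntermediateField.finrank_top'] at h1
  exact h1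

theorem quad_trace {K : Type*} [Field K] [NumberField K] (α : K) (d : ℕ) (hd : 1 < d)
    (hα : α ^ 2 = -(d : K)) : Algebra.trace ℚ K α = 0 := by
  rw [trace_eq_finrank_mul_minpoly_nextCoeff, quad_minpoly α d hd hα]
  have : (Polynomial.X ^ 2 + Polynomial.C (d : ℚ)).nextCoeff = 0 := by
    rw [Polynomial.nextCoeff_of_natDegree_pos (by rw [Polynomial.natDegree_X_pow_add_C]; norm_num),
      Polynomial.natDegree_X_pow_add_C]
    simp [Polynomial.coeff_X_pow, Polynomial.coeff_C]
  rw [this]; simp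

theorem quad_isIntegral {K : Type*} [Field K] [NumberField K] (α : K) (d : ℕ)
    (hα : α ^ 2 = -(d : K)) : IsIntegral ℤ α := by
  apply IsIntegral.of_pow (n := 2) (by norm_num)
  rw [hα]
  have h := (isIntegral_algebraMap (R := ℤ) (x := (d : ℤ)) (A := K)).neg
  simpa using h

theorem quad_discr {K : Type*} [Field K] [NumberField K] (α : K) (d : ℕ) (hd : 1 < d)
    (hsq : Squarefree d)
    (hα : α ^ 2 = -(d : K)) (hK : Algebra.adjoin ℚ {α} = ⊤) : (d : ℤ) ≤ |NumberField.discr K| := by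
  obtain ⟨a, ha⟩ : ∃ a : NumberField.RingOfIntegers K, (a : K) = α :=
    ⟨⟨α, quad_isIntegral α d hα⟩, rfl⟩
  have hfr : Module.finrank ℤ (NumberField.RingOfIntegers K) = 2 := by
    rw [NumberField.RingOfIntegers.rank, quad_finrank α d hd hα hK]
  let b := (Module.finBasisOfFinrankEq ℤ (NumberField.RingOfIntegers K) hfr)
  have h1 := NumberField.discr_eq_discr K b
  let v : Fin 2 → NumberField.RingOfIntegers K := ![1, a]
  have h2 : Algebra.discr ℤ v = (b.toMatrix v).det ^ 2 * NumberField.discr K := by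
    rw [← h1, ← Algebra.discr_of_matrix_vecMul, b.toMatrix_map_vecMul]
  have ta : Algebra.trace ℤ (NumberField.RingOfIntegers K) a = 0 := by
    have := Algebra.coe_trace_int a
    rw [ha, quad_trace α d hd hα] at this
    exact_mod_cast this
  have t1 : Algebra.trace ℤ (NumberField.RingOfIntegers K) 1 = 2 := by
    have := Algebra.trace_algebraMap (R := ℤ) (S := NumberField.RingOfIntegers K) 1
    rw [map_one, hfr] at this; simpa using this
  have taa : Algebra.trace ℤ (NumberField.RingOfIntegers K) (a * a) = - 2 * d := by
    have haa : a * a = algebraMap ℤ _ (-(d : ℤ)) := by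
      apply NumberField.RingOfIntegers.ext
      have hav : algebraMap (NumberField.RingOfIntegers K) K a = α := ha
      change algebraMap (NumberField.RingOfIntegers K) K (a * a) =
        algebraMap (NumberField.RingOfIntegers K) K _
      rw [map_mul, hav, ← pow_two, hα]
      simp
    rw [haa, Algebra.trace_algebraMap, hfr]; simp
  have h3 : Algebra.discr ℤ v = - 4 * d := by
    rw [Algebra.discr_def, Matrix.det_fin_two]
    simp [Algebra.traceMatrix_apply, Algebra.traceForm_apply, v, ta, t1, taa]
    ring
  rw [h3] at h2
  set D := (b.toMatrix v).det
  have hDd : D * D ∣ (4 : ℤ) * d := ⟨-NumberField.discr K, by linear_combination - h2⟩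
  have hn : D.natAbs * D.natAbs ∣ 4 * d := by
    have := Int.natAbs_dvd_natAbs.mpr hDd
    simpa [Int.natAbs_mul] using this
  have hD0 : D.natAbs ≠ 0 := by
    intro h; rw [h] at hn
    simp at hn; omega
  have hle : D.natAbs ≤ 2 := by
    -- D | 2 since D² | 4 d
    by_contra hgt
    push Not at hgt
    have hdvd : D.natAbs ∣ 2 := by
      obtain ⟨g, hg⟩ : ∃ g, g = Nat.gcd D.natAbs 2 := ⟨_, rfl⟩
      have hg2 : g ∣ 2 := hg ▸ Nat.gcd_dvd_right _ _
      rcases (Nat.dvd_prime Nat.prime_two).mp hg2 with h | h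
      · have hc : Nat.Coprime D.natAbs 2 := by rw [Nat.Coprime, ← hg, h]
        have hc4 : Nat.Coprime (D.natAbs * D.natAbs) 4 :=
          Nat.Coprime.mul_left (hc.pow_right 2) (hc.pow_right 2)
        have := hc4.dvd_of_dvd_mul_left hn
        have := Nat.isUnit_iff.mp (hsq _ this)
        omega
      · have h2D : 2 ∣ D.natAbs := h ▸ hg ▸ Nat.gcd_dvd_left _ _
        obtain ⟨k, hk⟩ := h2D
        rw [hk, show 2 * k * (2 * k) = 4 * (k * k) by ring] at hn
        have := Nat.dvd_of_mul_dvd_mul_left (by norm_num) hn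
        have := Nat.isUnit_iff.mp (hsq _ this)
        omega
    have := Nat.le_of_dvd (by norm_num) hdvd
    omega
  have hD2 : D ^ 2 ≤ 4 := by
    have : D ^ 2 = (D.natAbs : ℤ) ^ 2 := by simp
    rw [this]
    have : (D.natAbs : ℤ) ≤ 2 := by exact_mod_cast hle
    nlinarith
  have h5 : D ^ 2 * |NumberField.discr K| = 4 * d := by
    have := congrArg abs h2
    rw [abs_mul, abs_mul, abs_of_nonneg (sq_nonneg D)] at this
    simp at this
    linarith
  nlinarith [abs_nonneg (NumberField.discr K)]

theorem abs_det_of_isEmpty {ι : Type*} (hf : Fintype ι) (hdec : DecidableEq ι) (hE : IsEmpty ι)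
    (M : Matrix ι ι ℝ) : |M.det| = 1 := by
  rw [Matrix.det_isEmpty, abs_one]

theorem quad_residue_le {K : Type*} [Field K] [NumberField K] (α : K) (d : ℕ) (hd : 1 < d)
    (hsq : Squarefree d)
    (hα : α ^ 2 = -(d : K)) (hK : Algebra.adjoin ℚ {α} = ⊤) :
    NumberField.dedekindZeta_residue K ≤ Real.pi * NumberField.classNumber K / Real.sqrt d := by
  have hr : NumberField.InfinitePlace.nrRealPlaces K = 0 := by
    rw [NumberField.nrRealPlaces_eq_zero_iff]
    refine ⟨fun w => ?_⟩
    rw [← NumberField.InfinitePlace.not_isReal_iff_isComplex]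
    intro hw
    obtain ⟨φ, hφ, -⟩ := hw
    have h1 : (hφ.embedding α) ^ 2 = - (d : ℝ) := by
      rw [← map_pow, hα]; simp
    have : (0:ℝ) < d := by exact_mod_cast (by omega : 0 < d)
    nlinarith [sq_nonneg (hφ.embedding α)]
  have hc : NumberField.InfinitePlace.nrComplexPlaces K = 1 := by
    have := NumberField.InfinitePlace.card_add_two_mul_card_eq_rank K
    rw [hr, quad_finrank α d hd hα hK] at this
    omega
  have hreg : NumberField.Units.regulator K = 1 := by
    rw [NumberField.Units.regulator_eq_regOfFamily_fundSystem, NumberField.Units.regOfFamily_eq_det']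
    have hrank : NumberField.Units.rank K = 0 := by
      rw [NumberField.Units.rank, NumberField.InfinitePlace.card_eq_nrRealPlaces_add_nrComplexPlaces,
        hr, hc]
    have he : IsEmpty (Fin (NumberField.Units.rank K)) := by rw [hrank]; infer_instance
    have he2 := (NumberField.Units.equivFinRank K).symm.isEmpty
    exact abs_det_of_isEmpty _ _ he2 _
  rw [NumberField.dedekindZeta_residue_def, hr, hc, hreg]
  have hw : (2:ℝ) ≤ NumberField.Units.torsionOrder K := by
    have h1 := NumberField.Units.even_torsionOrder K
    have h2 := NumberField.Units.torsionOrder_pos K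
    obtain ⟨k, hk⟩ := h1
    exact_mod_cast (by omega : 2 ≤ NumberField.Units.torsionOrder K)
  have hs : Real.sqrt d ≤ Real.sqrt |(NumberField.discr K : ℝ)| := by
    apply Real.sqrt_le_sqrt
    have := quad_discr α d hd hsq hα hK
    exact_mod_cast this
  have hd0 : 0 < Real.sqrt d := Real.sqrt_pos.mpr (by exact_mod_cast (by omega : 0 < d))
  have hden : 2 * Real.sqrt d ≤
      NumberField.Units.torsionOrder K * Real.sqrt |(NumberField.discr K : ℝ)| := by
    apply mul_le_mul hw hs hd0.le (by positivity)
  calc _ ≤ (2 ^ 0 * (2 * Real.pi) ^ 1 * 1 * (NumberField.classNumber K : ℝ)) / (2 * Real.sqrt d) := by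
        push_cast
        apply div_le_div_of_nonneg_left _ (by positivity) hden
        have := Real.pi_pos
        positivity
    _ = _ := by field_simp

open NumberField Ideal in
theorem cnt_finite (K : Type*) [Field K] [NumberField K] (n : ℕ) :
    Finite {I : Ideal (𝓞 K) // absNorm I = n} := by
  exact (Ideal.finite_setOfPred_absNorm_eq n).to_subtype

open NumberField Ideal in
theorem cnt_mul {K : Type*} [Field K] [NumberField K] {m n : ℕ} (h : Nat.Coprime m n) :
    Nat.card {I : Ideal (𝓞 K) // absNorm I = m} * Nat.card {I : Ideal (𝓞 K) // absNorm I = n} ≤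
      Nat.card {I : Ideal (𝓞 K) // absNorm I = m * n} := by
  have key : ∀ (m n : ℕ), Nat.Coprime m n → ∀ A B : Ideal (𝓞 K), absNorm A = m → absNorm B = n →
      A = A * B ⊔ span {(m : 𝓞 K)} := by
    intro m n h A B hA hB
    have hmA : (m : 𝓞 K) ∈ A := hA ▸ absNorm_mem A
    have hnB : (n : 𝓞 K) ∈ B := hB ▸ absNorm_mem B
    apply le_antisymm
    · intro a ha
      have hb := Nat.isCoprime_iff_coprime.mpr h
      obtain ⟨u, v, huv⟩ := hb
      have huv' : (u : 𝓞 K) * m + v * n = 1 := by exact_mod_cast congrArg (Int.cast (R := 𝓞 K)) huv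
      have : a = a * n * v + m * (a * u) := by linear_combination (-a) * huv'
      rw [this]
      apply Submodule.add_mem_sup
      · exact Ideal.mul_mem_right _ _ (Ideal.mul_mem_mul ha hnB)
      · exact Ideal.mul_mem_right _ _ (Ideal.mem_span_singleton_self _)
    · apply sup_le Ideal.mul_le_left
      rw [Ideal.span_singleton_le_iff_mem]; exact hmA
  have := cnt_finite K (m * n)
  rw [← Nat.card_prod]
  let φ : ({I : Ideal (𝓞 K) // absNorm I = m} × {I : Ideal (𝓞 K) // absNorm I = n}) →
      {I : Ideal (𝓞 K) // absNorm I = m * n} :=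
    fun x => ⟨x.1.1 * x.2.1, by rw [map_mul, x.1.2, x.2.2]⟩
  apply Nat.card_le_card_of_injective φ
  rintro ⟨⟨A, hA⟩, ⟨B, hB⟩⟩ ⟨⟨A', hA'⟩, ⟨B', hB'⟩⟩ hEq
  have hAB : A * B = A' * B' := congrArg Subtype.val hEq
  have e1 : A = A' := by
    rw [key m n h A B hA hB, key m n h A' B' hA' hB', hAB]
  have e2 : B = B' := by
    rw [key n m h.symm B A hB hA, key n m h.symm B' A' hB' hA', mul_comm B, hAB, mul_comm B']
  subst e1; subst e2; rfl

open NumberField Ideal in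
theorem absNorm_nat {K : Type*} [Field K] [NumberField K] (h2 : Module.finrank ℚ K = 2) (a : ℕ) :
    absNorm (span {(a : 𝓞 K)}) = a ^ 2 := by
  rw [absNorm_span_singleton]
  have := Algebra.norm_algebraMap_of_basis (RingOfIntegers.basis K) (a : ℤ)
  rw [← Module.finrank_eq_card_basis (RingOfIntegers.basis K), NumberField.RingOfIntegers.rank, h2] at this
  simp only [algebraMap_int_eq, eq_intCast, Int.cast_natCast] at this
  rw [this]; simp [Int.natAbs_pow]

open NumberField Ideal in
theorem cnt_inert {K : Type*} [Field K] [NumberField K] (h2 : Module.finrank ℚ K = 2) (a : ℕ) :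
    1 ≤ Nat.card {I : Ideal (𝓞 K) // absNorm I = a ^ 2} := by
  have := cnt_finite K (a ^ 2)
  have : Nonempty {I : Ideal (𝓞 K) // absNorm I = a ^ 2} := ⟨⟨_, absNorm_nat h2 a⟩⟩
  exact Nat.card_pos

open NumberField Ideal in
theorem cnt_ram {K : Type*} [Field K] [NumberField K] (h2 : Module.finrank ℚ K = 2)
    (a : 𝓞 K) (l e : ℕ) (ha : a ^ 2 = -((l : 𝓞 K) * e)) (hc : Nat.Coprime l e)  (k : ℕ) :
    1 ≤ Nat.card {I : Ideal (𝓞 K) // absNorm I = l ^ k} := by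
  let P : Ideal (𝓞 K) := span {a, (l : 𝓞 K)}
  have hP : P * P = span {(l : 𝓞 K)} := by
    apply le_antisymm
    · rw [Ideal.span_mul_span']
      rw [Ideal.span_le]
      rintro _ ⟨x, hx, y, hy, rfl⟩
      simp only [SetLike.mem_coe, Ideal.mem_span_singleton]
      simp only [Set.mem_insert_iff, Set.mem_singleton_iff] at hx hy
      rcases hx with rfl | rfl <;> rcases hy with rfl | rfl
      · exact ⟨-e, by linear_combination ha⟩
      · exact dvd_mul_left _ _
      · exact dvd_mul_right _ _
      · exact dvd_mul_right _ _
    · rw [Ideal.span_singleton_le_iff_mem]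
      obtain ⟨u, v, huv⟩ := Nat.isCoprime_iff_coprime.mpr hc
      have huv' : (u : 𝓞 K) * l + v * e = 1 := by exact_mod_cast congrArg (Int.cast (R := 𝓞 K)) huv
      have hl : (l : 𝓞 K) ∈ P := Ideal.subset_span (by simp)
      have haP : a ∈ P := Ideal.subset_span (by simp)
      have : (l : 𝓞 K) = u * (l * l) - v * (a * a) := by linear_combination (-(l : 𝓞 K)) * huv' + v * ha
      rw [this]
      exact Ideal.sub_mem _ (Ideal.mul_mem_left _ _ (Ideal.mul_mem_mul hl hl))
        (Ideal.mul_mem_left _ _ (Ideal.mul_mem_mul haP haP))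
  have hN : absNorm P = l := by
    have h := congrArg absNorm hP
    rw [map_mul, absNorm_nat h2, ← pow_two] at h
    exact Nat.pow_left_injective (n := 2) (by norm_num) h
  have := cnt_finite K (l ^ k)
  have : Nonempty {I : Ideal (𝓞 K) // absNorm I = l ^ k} := ⟨⟨P ^ k, by rw [map_pow, hN]⟩⟩
  exact Nat.card_pos

open NumberField Ideal in
theorem cnt_split {K : Type*} [Field K] [NumberField K] (h2 : Module.finrank ℚ K = 2)
    (θ : 𝓞 K) (l : ℕ) (hl : l.Prime) (T M : ℤ) (hθ : θ ^ 2 = T * θ - M) (hM : (l : ℤ) ∣ M)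
    (hT : ¬ (l : ℤ) ∣ T) (htr : Algebra.trace ℤ (𝓞 K) θ = T) (k : ℕ) :
    k + 1 ≤ Nat.card {I : Ideal (𝓞 K) // absNorm I = l ^ k} := by
  obtain ⟨c, hc⟩ := hM
  have hcT : IsCoprime (l : ℤ) T := ((Nat.prime_iff_prime_int.mp hl).coprime_iff_not_dvd).mpr hT
  obtain ⟨u, v, huv⟩ := hcT
  have huv' : (u : 𝓞 K) * l + v * T = 1 := by exact_mod_cast congrArg (Int.cast (R := 𝓞 K)) huv
  have hM' : (M : 𝓞 K) = l * c := by rw [hc]; push_cast; ring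
  let θ' : 𝓞 K := T - θ
  have htr' : Algebra.trace ℤ (𝓞 K) θ' = T := by
    have h1 := Algebra.trace_algebraMap (R := ℤ) (S := 𝓞 K) T
    rw [NumberField.RingOfIntegers.rank, h2] at h1
    simp only [algebraMap_int_eq, eq_intCast] at h1
    simp only [θ', map_sub, h1, htr]; simp; ring
  let P : Ideal (𝓞 K) := span {(l : 𝓞 K), θ}
  let P' : Ideal (𝓞 K) := span {(l : 𝓞 K), θ'}
  have hlP : (l : 𝓞 K) ∈ P := Ideal.subset_span (by simp)
  have hlP' : (l : 𝓞 K) ∈ P' := Ideal.subset_span (by simp)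
  have htP : θ ∈ P := Ideal.subset_span (by simp)
  have htP' : θ' ∈ P' := Ideal.subset_span (by simp)
  have hPP' : P * P' = span {(l : 𝓞 K)} := by
    apply le_antisymm
    · rw [Ideal.span_mul_span', Ideal.span_le]
      rintro _ ⟨x, hx, y, hy, rfl⟩
      simp only [SetLike.mem_coe, Ideal.mem_span_singleton]
      simp only [Set.mem_insert_iff, Set.mem_singleton_iff] at hx hy
      rcases hx with rfl | rfl <;> rcases hy with rfl | rfl
      · exact dvd_mul_right _ _
      · exact dvd_mul_right _ _
      · exact dvd_mul_left _ _
      · exact ⟨c, by simp only [θ']; linear_combination hM' - hθ⟩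
    · rw [Ideal.span_singleton_le_iff_mem]
      have : (l : 𝓞 K) = u * (l * l) + v * (l * θ' + θ * l) := by
        simp only [θ']
        linear_combination (-(l : 𝓞 K)) * huv'
      rw [this]
      exact Ideal.add_mem _ (Ideal.mul_mem_left _ _ (Ideal.mul_mem_mul hlP hlP'))
        (Ideal.mul_mem_left _ _ (Ideal.add_mem _ (Ideal.mul_mem_mul hlP htP') (Ideal.mul_mem_mul htP hlP')))
  have hcop : IsCoprime P P' := by
    rw [Ideal.isCoprime_iff_exists]
    refine ⟨u * l + v * θ, Ideal.add_mem _ (Ideal.mul_mem_left _ _ hlP) (Ideal.mul_mem_left _ _ htP),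
      v * θ', Ideal.mul_mem_left _ _ htP', ?_⟩
    simp only [θ']; linear_combination huv'
  have hnd : ∀ w : 𝓞 K, Algebra.trace ℤ (𝓞 K) w = T → ¬ (l : 𝓞 K) ∣ w := by
    rintro w hw ⟨z, rfl⟩
    apply hT
    rw [← hw, show (l : 𝓞 K) * z = (l : ℤ) • z by simp, map_smul, smul_eq_mul]
    exact dvd_mul_right _ _
  have hP1 : P ≠ 1 := by
    intro h
    rw [h, one_mul] at hPP'
    rw [hPP', Ideal.mem_span_singleton] at htP'
    exact hnd _ htr' htP'
  have hP'1 : P' ≠ 1 := by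
    intro h
    rw [h, mul_one] at hPP'
    rw [hPP', Ideal.mem_span_singleton] at htP
    exact hnd _ htr htP
  have hN : absNorm P * absNorm P' = l ^ 2 := by rw [← map_mul, hPP', absNorm_nat h2]
  have hNP : absNorm P = l ∧ absNorm P' = l := by
    have a1 : absNorm P ≠ 1 := fun h => hP1 (by rw [absNorm_eq_one_iff] at h; rw [h, Ideal.one_eq_top])
    have a2 : absNorm P' ≠ 1 := fun h => hP'1 (by rw [absNorm_eq_one_iff] at h; rw [h, Ideal.one_eq_top])
    have := (Nat.dvd_prime_pow hl).mp (Dvd.intro _ hN)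
    obtain ⟨i, hi, hi'⟩ := this
    have hl0 := hl.pos
    interval_cases i
    · rw [pow_zero] at hi'; exact absurd hi' a1
    · simp at hi'
      refine ⟨hi', ?_⟩
      rw [hi', pow_two] at hN
      exact Nat.eq_of_mul_eq_mul_left hl0 hN
    · rw [hi'] at hN
      have : absNorm P' = 1 := by
        apply Nat.eq_of_mul_eq_mul_left (pow_pos hl0 2)
        rw [hN, mul_one]
      exact absurd this a2
  have hP0 : P ≠ 0 := fun h => by
    have := hNP.1; rw [h] at this; simp at this; exact hl.ne_zero this.symm
  have hP'0 : P' ≠ 0 := fun h => by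
    have := hNP.2; rw [h] at this; simp at this; exact hl.ne_zero this.symm
  have := cnt_finite K (l ^ k)
  let φ : Fin (k + 1) → {I : Ideal (𝓞 K) // absNorm I = l ^ k} :=
    fun i => ⟨P ^ (i : ℕ) * P' ^ (k - i), by
      rw [map_mul, map_pow, map_pow, hNP.1, hNP.2, ← pow_add]
      congr 1; have := i.2; omega⟩
  have hne : ∀ i j : ℕ, i < j → j ≤ k → P ^ i * P' ^ (k - i) ≠ P ^ j * P' ^ (k - j) := by
    intro i j hij hj h
    have e1 : P ^ i * P' ^ (k - i) = (P ^ i * P' ^ (k - j)) * P' ^ (j - i) := by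
      rw [mul_assoc, ← pow_add]; congr 2; omega
    have e2 : P ^ j * P' ^ (k - j) = (P ^ i * P' ^ (k - j)) * P ^ (j - i) := by
      rw [mul_right_comm, ← pow_add]; congr 2; omega
    rw [e1, e2] at h
    have h3 := mul_left_cancel₀ (mul_ne_zero (pow_ne_zero _ hP0) (pow_ne_zero _ hP'0)) h
    have hcc : IsCoprime (P ^ (j - i)) (P' ^ (j - i)) := hcop.pow
    rw [h3, Ideal.isCoprime_iff_sup_eq, sup_idem] at hcc
    have h4 := congrArg absNorm hcc
    rw [map_pow, hNP.1, absNorm_top] at h4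
    have := Nat.one_lt_pow (n := j - i) (by omega) hl.one_lt
    omega
  have hinj : Function.Injective φ := by
    intro i j h
    have h' : P ^ (i : ℕ) * P' ^ (k - i) = P ^ (j : ℕ) * P' ^ (k - j) := congrArg Subtype.val h
    apply Fin.ext
    rcases lt_trichotomy (i : ℕ) j with hlt | heq | hlt
    · exact absurd h' (hne i j hlt (by omega))
    · exact heq
    · exact absurd h'.symm (hne j i hlt (by omega))
  have := Nat.card_le_card_of_injective φ hinj
  simpa using this

open ArithmeticFunction in
/-- Jacobi symbol as an arithmetic function -/
noncomputable def jacAF (d : ℕ) : ArithmeticFunction ℤ :=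
  ⟨fun n => if n = 0 then 0 else jacobiSym n d, by simp⟩

theorem jacAF_apply (d n : ℕ) (hn : n ≠ 0) : jacAF d n = jacobiSym n d := by
  simp [jacAF, hn]

theorem jacAF_mult (d : ℕ) : (jacAF d).IsMultiplicative := by
  refine ⟨by simp [jacAF], ?_⟩
  intro m n hmn
  by_cases hm : m = 0
  · subst hm; simp [jacAF]
  by_cases hn : n = 0
  · subst hn; simp [jacAF]
  rw [jacAF_apply _ _ (by positivity), jacAF_apply _ _ hm, jacAF_apply _ _ hn]
  push_cast
  exact jacobiSym.mul_left _ _ _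

open ArithmeticFunction in
theorem rsum_prime_pow (d l k : ℕ) (hl : l.Prime) :
    ((ArithmeticFunction.zeta : ArithmeticFunction ℤ) * jacAF d) (l ^ k) =
      ∑ i ∈ Finset.range (k + 1), (jacobiSym l d) ^ i := by
  rw [ArithmeticFunction.coe_zeta_mul_apply, Nat.sum_divisors_prime_pow hl]
  refine Finset.sum_congr rfl fun i _ => ?_
  rw [jacAF_apply _ _ (pow_ne_zero _ hl.ne_zero)]
  push_cast
  rw [jacobiSym.pow_left]

theorem neg_square_of_jac (d l : ℕ) (hd4 : d % 4 = 3) (hl : l.Prime) (hl2 : l ≠ 2)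
    (hJ : jacobiSym l d = 1) : ∃ t : ℤ, (l : ℤ) ∣ t ^ 2 + d := by
  haveI := Fact.mk hl
  have hlo : l % 2 = 1 := by
    rcases hl.eq_two_or_odd with h | h
    · exact absurd h hl2
    · exact h
  have hdo : Odd d := Nat.odd_iff.mpr (by omega)
  have hloo : Odd l := Nat.odd_iff.mpr hlo
  have h1 : jacobiSym (-(d : ℤ)) l = 1 := by
    rw [← neg_one_mul, jacobiSym.mul_left, jacobiSym.at_neg_one hloo]
    rcases Nat.odd_mod_four_iff.mp hlo with h | h
    · rw [ZMod.χ₄_nat_one_mod_four h, one_mul, ← hJ]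
      exact (jacobiSym.quadratic_reciprocity_one_mod_four h hdo).symm
    · have h5 := jacobiSym.quadratic_reciprocity_three_mod_four h hd4
      rw [ZMod.χ₄_nat_three_mod_four h]
      linarith
  rw [← jacobiSym.legendreSym.to_jacobiSym] at h1
  have h0 : ((-(d : ℤ) : ℤ) : ZMod l) ≠ 0 := by
    intro h
    rw [(legendreSym.eq_zero_iff l (-(d : ℤ))).mpr h] at h1
    exact zero_ne_one h1
  rw [legendreSym.eq_one_iff l h0] at h1
  obtain ⟨y, hy⟩ := h1
  refine ⟨(y.val : ℤ), ?_⟩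
  rw [← ZMod.intCast_zmod_eq_zero_iff_dvd] 
  push_cast
  rw [ZMod.natCast_zmod_val]
  push_cast at hy
  linear_combination -hy

open NumberField Ideal in
theorem cnt_prime_pow {K : Type*} [Field K] [NumberField K] (α : K) (d : ℕ) (hd : 1 < d)
    (hsq : Squarefree d) (hd4 : d % 4 = 3)
    (hα : α ^ 2 = -(d : K)) (hK : Algebra.adjoin ℚ {α} = ⊤) (l k : ℕ) (hl : l.Prime) :
    |((ArithmeticFunction.zeta : ArithmeticFunction ℤ) * jacAF d) (l ^ k)| ≤
      (Nat.card {I : Ideal (𝓞 K) // absNorm I = l ^ k} : ℤ) := by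
  have h2 := quad_finrank α d hd hα hK
  rw [rsum_prime_pow d l k hl]
  obtain ⟨a, ha⟩ : ∃ a : NumberField.RingOfIntegers K, algebraMap (𝓞 K) K a = α :=
    ⟨⟨α, quad_isIntegral α d hα⟩, rfl⟩
  have haa : a ^ 2 = -(d : 𝓞 K) := by
    apply NumberField.RingOfIntegers.ext
    change algebraMap (NumberField.RingOfIntegers K) K _ =
        algebraMap (NumberField.RingOfIntegers K) K _
    rw [map_pow, ha, hα]; simp
  have ta : Algebra.trace ℤ (NumberField.RingOfIntegers K) a = 0 := by
    have := Algebra.coe_trace_int a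
    have h3 := quad_trace α d hd hα
    rw [← ha] at h3
    rw [h3] at this
    exact_mod_cast this
  have tint : ∀ t : ℤ, Algebra.trace ℤ (𝓞 K) (t : 𝓞 K) = 2 * t := by
    intro t
    have h1 := Algebra.trace_algebraMap (R := ℤ) (S := 𝓞 K) t
    rw [NumberField.RingOfIntegers.rank, h2] at h1
    simpa using h1
  rcases jacobiSym.trichotomy l d with h | h | h
  · -- ramified
    rw [h, Finset.sum_range_succ']
    simp only [pow_zero, ne_eq, Nat.add_eq_zero_iff, one_ne_zero, and_false, not_false_eq_true,
      zero_pow, Finset.sum_const_zero, zero_add, abs_one]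
    have hdl : l ∣ d := by
      have hne : NeZero d := ⟨by omega⟩
      rw [jacobiSym.eq_zero_iff_not_coprime] at h
      by_contra hnd
      apply h
      rw [Int.gcd_natCast_natCast]
      exact (hl.coprime_iff_not_dvd).mpr hnd
    obtain ⟨e, he⟩ := hdl
    have hc : Nat.Coprime l e := by
      rw [he] at hsq
      exact Nat.coprime_of_squarefree_mul hsq
    exact_mod_cast cnt_ram h2 a l e (by rw [haa, he]; push_cast; ring) hc k
  · -- split
    rw [h]
    simp only [one_pow, Finset.sum_const, Finset.card_range, nsmul_eq_mul, mul_one]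
    rw [abs_of_nonneg (by positivity)]
    by_cases hl2 : l = 2
    · subst hl2
      have hd8 : d % 8 = 7 := by
        have h8 := jacobiSym.at_two (b := d) (Nat.odd_iff.mpr (by omega))
        push_cast at h
        rw [h, ZMod.χ₈_nat_eq_if_mod_eight] at h8
        by_contra hne
        have h3 : d % 8 = 3 := by omega
        have h4 : d % 2 ≠ 0 := by omega
        simp [h3, h4] at h8
      obtain ⟨c, hc⟩ : ∃ c : ℕ, 1 + d = 4 * (2 * c) := ⟨(1 + d) / 8, by omega⟩
      have hcK : (1 : K) + d = 4 * (2 * c) := by exact_mod_cast congrArg (Nat.cast (R := K)) hc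
      have hx : ((1 + α) / 2) ^ 2 - (1 + α) / 2 + 2 * c = 0 := by
        linear_combination hα / 4 - hcK / 4
      have hintg : IsIntegral ℤ ((1 + α) / 2) := by
        refine ⟨Polynomial.X ^ 2 + (-Polynomial.X + Polynomial.C (2 * c : ℤ)), ?_, ?_⟩
        · apply Polynomial.monic_X_pow_add (n := 2)
          refine lt_of_le_of_lt (Polynomial.degree_add_le _ _) ?_
          rw [max_lt_iff]
          constructor
          · rw [Polynomial.degree_neg, Polynomial.degree_X]; norm_num
          · exact lt_of_le_of_lt Polynomial.degree_C_le (by norm_num)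
        · simp
          linear_combination hx
      obtain ⟨θ, hθ⟩ : ∃ a : NumberField.RingOfIntegers K, algebraMap (𝓞 K) K a = (1 + α) / 2 :=
        ⟨⟨_, hintg⟩, rfl⟩
      have h2K : algebraMap (𝓞 K) K 2 = 2 := map_ofNat _ 2
      have h2θ : 2 * θ = 1 + a := by
        apply NumberField.RingOfIntegers.ext
        change algebraMap (NumberField.RingOfIntegers K) K _ =
          algebraMap (NumberField.RingOfIntegers K) K _
        rw [map_mul, hθ, map_add, ha, h2K]; simp; ring
      have := cnt_split h2 θ 2 hl 1 (2 * c) ?_ ?_ ?_ ?_ k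
      · exact_mod_cast this
      · apply NumberField.RingOfIntegers.ext
        change algebraMap (NumberField.RingOfIntegers K) K _ =
          algebraMap (NumberField.RingOfIntegers K) K _
        simp only [map_pow, hθ, map_sub, map_mul]
        simp [h2K]
        linear_combination hx
      · exact dvd_mul_right _ _
      · norm_num
      · have h5 := congrArg (Algebra.trace ℤ (𝓞 K)) h2θ
        rw [map_add, ta, show (2 : 𝓞 K) * θ = (2 : ℤ) • θ by simp, map_smul,
          show (1 : 𝓞 K) = ((1 : ℤ) : 𝓞 K) by simp, tint] at h5
        simp at h5
        exact h5
    · obtain ⟨t, ht⟩ := neg_square_of_jac d l hd4 hl hl2 h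
      have hld : ¬ (l : ℤ) ∣ d := by
        intro hdvd
        have hne : NeZero d := ⟨by omega⟩
        have h0 : jacobiSym l d = 0 := by
          rw [jacobiSym.eq_zero_iff_not_coprime, Int.gcd_natCast_natCast]
          intro hcop
          exact (hl.coprime_iff_not_dvd.mp hcop) (by exact_mod_cast hdvd)
        rw [h0] at h; exact zero_ne_one h
      have := cnt_split h2 (t + a) l hl (2 * t) (t ^ 2 + d) ?_ ht ?_ ?_ k
      · exact_mod_cast this
      · push_cast; linear_combination haa
      · intro hdvd
        have hpr := Nat.prime_iff_prime_int.mp hl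
        rcases hpr.dvd_or_dvd hdvd with h5 | h5
        · have : l ∣ 2 := by exact_mod_cast h5
          exact hl2 ((Nat.prime_dvd_prime_iff_eq hl Nat.prime_two).mp this)
        · apply hld
          have := dvd_sub ht (dvd_pow h5 (two_ne_zero))
          simpa using this
      · rw [map_add, ta, tint]; ring
  · -- inert
    rw [h]
    rcases Nat.even_or_odd k with hk | hk
    · obtain ⟨j, rfl⟩ := hk
      have hgs : ∑ i ∈ Finset.range (j + j + 1), (-1 : ℤ) ^ i = 1 := by
        rw [neg_one_geom_sum]; simp [parity_simps]
      rw [hgs]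
      have := cnt_inert h2 (l ^ j)
      rw [← pow_mul, mul_two] at this
      simpa using this
    · have hgs : ∑ i ∈ Finset.range (k + 1), (-1 : ℤ) ^ i = 0 := by
        rw [neg_one_geom_sum]; simp [hk.add_one]
      rw [hgs]; simp

open NumberField Ideal in
theorem rsum_le_cnt {K : Type*} [Field K] [NumberField K] (α : K) (d : ℕ) (hd : 1 < d)
    (hsq : Squarefree d) (hd4 : d % 4 = 3)
    (hα : α ^ 2 = -(d : K)) (hK : Algebra.adjoin ℚ {α} = ⊤) (n : ℕ) :
    |((ArithmeticFunction.zeta : ArithmeticFunction ℤ) * jacAF d) n| ≤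
      (Nat.card {I : Ideal (𝓞 K) // absNorm I = n} : ℤ) := by
  have hmult : ((ArithmeticFunction.zeta : ArithmeticFunction ℤ) * jacAF d).IsMultiplicative :=
    ArithmeticFunction.isMultiplicative_zeta.natCast.mul (jacAF_mult d)
  induction n using Nat.recOnPosPrimePosCoprime with
  | prime_pow p n hp hn => exact cnt_prime_pow α d hd hsq hd4 hα hK p n hp
  | zero => simp
  | one =>
    have h := cnt_prime_pow α d hd hsq hd4 hα hK 2 0 Nat.prime_two
    simpa only [pow_zero] using h
  | coprime a b ha hb hab iha ihb =>
    rw [hmult.map_mul_of_coprime hab, abs_mul]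
    calc _ ≤ _ := mul_le_mul iha ihb (abs_nonneg _) (by positivity)
      _ ≤ _ := by exact_mod_cast cnt_mul hab

/-- Jacobi symbol as a Dirichlet character. -/
noncomputable def jacChar (d : ℕ) [NeZero d] : DirichletCharacter ℂ d where
  toFun x := (jacobiSym x.val d : ℂ)
  map_one' := by
    rcases Nat.lt_or_ge 1 d with h | h
    · have : Fact (1 < d) := ⟨h⟩
      rw [ZMod.val_one]; simp
    · have h1 : d = 1 := by have := NeZero.pos d; omega
      subst h1; simp
  map_mul' x y := by
    rw [ZMod.val_mul, Int.natCast_mod, ← jacobiSym.mod_left]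
    push_cast
    rw [jacobiSym.mul_left]; push_cast; rfl
  map_nonunit' x hx := by
    have : jacobiSym x.val d = 0 := by
      rw [jacobiSym.eq_zero_iff_not_coprime, Int.gcd_natCast_natCast]
      intro h
      apply hx
      have := (ZMod.unitOfCoprime x.val h).isUnit
      simpa using this
    show ((jacobiSym (x.val : ℤ) d : ℤ) : ℂ) = 0
    rw [this]; exact Int.cast_zero

theorem jacChar_apply (d : ℕ) [NeZero d] (x : ZMod d) :
    jacChar d x = (jacobiSym x.val d : ℂ) := rfl

theorem jacChar_int (d : ℕ) [NeZero d] (n : ℤ) : jacChar d (n : ZMod d) = (jacobiSym n d : ℂ) := by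
  rw [jacChar_apply, ZMod.val_intCast, ← jacobiSym.mod_left]

theorem jacChar_nat (d : ℕ) [NeZero d] (n : ℕ) : jacChar d (n : ZMod d) = (jacobiSym n d : ℂ) := by
  have := jacChar_int d n
  simpa using this

theorem jacChar_odd (d : ℕ) [NeZero d] (hd4 : d % 4 = 3) : (jacChar d).Odd := by
  have := jacChar_int d (-1)
  rw [jacobiSym.at_neg_one (Nat.odd_iff.mpr (by omega)), ZMod.χ₄_nat_three_mod_four hd4] at this
  rw [DirichletCharacter.Odd]
  simpa using this

theorem jacChar_inv (d : ℕ) [NeZero d] : (jacChar d)⁻¹ = jacChar d := by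
  have : jacChar d * jacChar d = 1 := by
    ext u
    rw [MulChar.mul_apply, MulChar.one_apply_coe, jacChar_apply]
    have hg : (u : ZMod d).val.Coprime d := ZMod.val_coe_unit_coprime u
    have := jacobiSym.sq_one (a := ((u : ZMod d).val : ℤ)) (b := d)
      (by rw [Int.gcd_natCast_natCast]; exact hg)
    rw [← Int.cast_mul, ← pow_two, this]; simp
  exact inv_eq_of_mul_eq_one_left this

theorem exists_jac_neg_one (p : ℕ) [Fact p.Prime] (hp : p ≠ 2) : ∃ a : ℕ, jacobiSym a p = -1 := by
  have hc : ringChar (ZMod p) ≠ 2 := by rwa [ZMod.ringChar_zmod_n]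
  obtain ⟨a, ha⟩ := quadraticChar_exists_neg_one hc
  refine ⟨a.val, ?_⟩
  rw [← jacobiSym.legendreSym.to_jacobiSym, legendreSym]
  simpa using ha

theorem jacChar_not_factors (p₁ p₂ : ℕ) [Fact p₁.Prime] [Fact p₂.Prime] (hp₂ : p₂ ≠ 2)
    (hne : p₁ ≠ p₂) [NeZero (p₁ * p₂)] (c : ℕ) (hc : c ∣ p₁) :
    ¬ (jacChar (p₁ * p₂)).FactorsThrough c := by
  intro hf
  obtain ⟨a, ha⟩ := exists_jac_neg_one p₂ hp₂
  have hcop : Nat.Coprime p₁ p₂ := (Nat.coprime_primes Fact.out Fact.out).mpr hne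
  obtain ⟨x, hx1, hx2⟩ := Nat.chineseRemainder hcop 1 a
  have hJ : jacobiSym x (p₁ * p₂) = -1 := by
    rw [jacobiSym.mul_right, jacobiSym.mod_left x p₁, jacobiSym.mod_left x p₂]
    rw [← Int.natCast_mod, ← Int.natCast_mod, hx1, hx2, Int.natCast_mod, Int.natCast_mod,
      ← jacobiSym.mod_left, ← jacobiSym.mod_left, ha]
    simp
  have hxc : Nat.Coprime x (p₁ * p₂) := by
    by_contra h
    have : jacobiSym x (p₁ * p₂) = 0 := by
      rw [jacobiSym.eq_zero_iff_not_coprime, Int.gcd_natCast_natCast]; exact h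
    rw [hJ] at this; norm_num at this
  have hcd : c ∣ p₁ * p₂ := hc.mul_right _
  rw [DirichletCharacter.factorsThrough_iff_ker_unitsMap hcd] at hf
  have hmem : ZMod.unitOfCoprime x hxc ∈ (ZMod.unitsMap hcd).ker := by
    rw [MonoidHom.mem_ker]
    ext
    simp only [ZMod.unitsMap_val, ZMod.coe_unitOfCoprime, Units.val_one]
    rw [ZMod.cast_natCast hcd]
    have : x ≡ 1 [MOD c] := Nat.ModEq.of_dvd hc hx1
    simpa using (ZMod.natCast_eq_natCast_iff x 1 c).mpr this
  have h1 := hf hmem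
  rw [MonoidHom.mem_ker] at h1
  have h2 := congrArg Units.val h1
  rw [MulChar.coe_toUnitHom, ZMod.coe_unitOfCoprime, jacChar_nat, hJ] at h2
  norm_num at h2

theorem jacChar_primitive (p₁ p₂ : ℕ) [Fact p₁.Prime] [Fact p₂.Prime] (hp₁ : p₁ ≠ 2) (hp₂ : p₂ ≠ 2)
    (hne : p₁ ≠ p₂) [NeZero (p₁ * p₂)] : (jacChar (p₁ * p₂)).IsPrimitive := by
  rw [DirichletCharacter.isPrimitive_def]
  have hf := DirichletCharacter.factorsThrough_conductor (jacChar (p₁ * p₂))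
  have hd := DirichletCharacter.conductor_dvd_level (jacChar (p₁ * p₂))
  set c := (jacChar (p₁ * p₂)).conductor
  have h1 : ¬ c ∣ p₁ := fun h => jacChar_not_factors p₁ p₂ hp₂ hne c h hf
  have hP₁ : p₁.Prime := Fact.out
  have hP₂ : p₂.Prime := Fact.out
  have h2 : ¬ c ∣ p₂ := by
    intro h
    have hcomm := mul_comm p₁ p₂
    have key : ∀ D : ℕ, ∀ [NeZero D], D = p₁ * p₂ → ¬ (jacChar D).FactorsThrough c := by
      intro D _ hD
      rw [hcomm] at hD
      subst hD
      exact jacChar_not_factors p₂ p₁ hp₁ hne.symm c h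
    exact key _ rfl hf
  rcases (Nat.dvd_mul).mp hd with ⟨a, b, ha, hb, hab⟩
  rcases (Nat.dvd_prime hP₁).mp ha with rfl | rfl
  · exact absurd (by rw [← hab, one_mul]; exact hb) h2
  · rcases (Nat.dvd_prime hP₂).mp hb with rfl | rfl
    · exact absurd (by rw [← hab, mul_one]) h1
    · exact hab.symm

open NumberField Filter Topology in
theorem L_one_le_residue {K : Type*} [Field K] [NumberField K] (α : K) (d : ℕ) [NeZero d] (hd : 1 < d)
    (hsq : Squarefree d) (hd4 : d % 4 = 3)
    (hα : α ^ 2 = -(d : K)) (hK : Algebra.adjoin ℚ {α} = ⊤) :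
    ‖DirichletCharacter.LFunction (jacChar d) 1‖ ≤ dedekindZeta_residue K := by
  have hne1 : jacChar d ≠ 1 := by
    intro h
    have := jacChar_odd d hd4
    rw [h, DirichletCharacter.Odd] at this
    rw [MulChar.one_apply (by simp)] at this
    norm_num at this
  have hc : Tendsto (fun u : ℝ => (u : ℂ)) (𝓝[>] 1) (𝓝[≠] 1) := by
    apply tendsto_nhdsWithin_of_tendsto_nhds_of_eventually_within
    · have := (Complex.continuous_ofReal.tendsto 1).mono_left (nhdsWithin_le_nhds (s := Set.Ioi 1))
      simpa using this
    · filter_upwards [self_mem_nhdsWithin] with u hu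
      have : u ≠ 1 := ne_of_gt hu
      simpa using this
  have t1 := (riemannZeta_residue_one.comp hc).mul
    (((DirichletCharacter.differentiable_LFunction hne1) 1).continuousAt.tendsto.comp
      (hc.mono_right nhdsWithin_le_nhds))
  rw [one_mul] at t1
  have t2 := tendsto_sub_one_mul_dedekindZeta_nhdsGT K
  have t1' := t1.norm
  have t2' := t2.norm
  have hpos := dedekindZeta_residue_pos K
  have hnr : ‖(dedekindZeta_residue K : ℂ)‖ = dedekindZeta_residue K := by
    rw [Complex.norm_real, Real.norm_of_nonneg hpos.le]
  rw [hnr] at t2'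
  refine le_of_tendsto_of_tendsto t1' t2' ?_
  have hev := t2'.eventually (lt_mem_nhds hpos)
  filter_upwards [self_mem_nhdsWithin, hev] with s hs hs0
  have hs1 : 1 < (s : ℂ).re := by simpa using hs
  simp only [Function.comp]
  rw [mul_assoc, norm_mul ((s:ℂ)-1), norm_mul ((s:ℂ)-1)]
  apply mul_le_mul_of_nonneg_left _ (norm_nonneg _)
  -- main inequality
  let r : ArithmeticFunction ℤ := (ArithmeticFunction.zeta : ArithmeticFunction ℤ) * jacAF d
  have hL1 : DirichletCharacter.LFunction (jacChar d) s =
      LSeries (fun n => ((jacAF d : ArithmeticFunction ℂ)) n) s := by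
    rw [DirichletCharacter.LFunction_eq_LSeries _ hs1]
    apply LSeries_congr
    intro n hn
    rw [jacChar_nat, ArithmeticFunction.intCoe_apply, jacAF_apply _ _ hn]
  have hsj : LSeriesSummable (fun n => ((jacAF d : ArithmeticFunction ℂ)) n) s := by
    refine (LSeriesSummable_congr s ?_).mp (DirichletCharacter.LSeriesSummable_of_one_lt_re (jacChar d) hs1)
    intro n hn
    rw [jacChar_nat, ArithmeticFunction.intCoe_apply, jacAF_apply _ _ hn]
  have hsz := ArithmeticFunction.LSeriesSummable_zeta_iff.mpr hs1
  have hprod : riemannZeta s * DirichletCharacter.LFunction (jacChar d) s =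
      LSeries (fun n => ((r n : ℤ) : ℂ)) s := by
    have := ArithmeticFunction.LSeries_mul' (f := (ArithmeticFunction.zeta : ArithmeticFunction ℂ))
      (g := (jacAF d : ArithmeticFunction ℂ)) (s := s) ?_ hsj
    · rw [hL1, ← ArithmeticFunction.LSeries_zeta_eq_riemannZeta hs1]
      have e1 : LSeries (fun n => ((r n : ℤ) : ℂ)) s = LSeries (fun n =>
          ((ArithmeticFunction.zeta : ArithmeticFunction ℂ) * (jacAF d : ArithmeticFunction ℂ)) n) s := by
        congr 1
        ext n
        rw [← ArithmeticFunction.intCoe_apply]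
        simp only [r]
        rw [ArithmeticFunction.intCoe_mul, ArithmeticFunction.coe_coe]
      rw [e1, this]; rfl
    · exact hsz
  rw [hprod]
  have hsum : LSeriesSummable (fun n ↦ (Nat.card {I : Ideal (𝓞 K) // Ideal.absNorm I = n} : ℂ)) s := by
    by_contra hns
    have : dedekindZeta K s = 0 := by
      rw [dedekindZeta]; exact tsum_eq_zero_of_not_summable hns
    rw [this] at hs0
    simp at hs0
  have hbd : ∀ n, ‖LSeries.term (fun n => ((r n : ℤ) : ℂ)) s n‖ ≤
      ‖LSeries.term (fun n ↦ (Nat.card {I : Ideal (𝓞 K) // Ideal.absNorm I = n} : ℂ)) s n‖ := by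
    intro n
    rw [LSeries.norm_term_eq, LSeries.norm_term_eq]
    split_ifs with hn
    · exact le_rfl
    · gcongr
      have := rsum_le_cnt α d hd hsq hd4 hα hK n
      rw [Complex.norm_natCast, Complex.norm_intCast]
      exact_mod_cast this
  have hsr : LSeriesSummable (fun n => ((r n : ℤ) : ℂ)) s :=
    Summable.of_norm_bounded (hsum.norm) hbd
  calc ‖LSeries (fun n => ((r n : ℤ) : ℂ)) s‖ ≤ ∑' n, ‖LSeries.term (fun n => ((r n : ℤ) : ℂ)) s n‖ :=
        norm_tsum_le_tsum_norm hsr.norm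
    _ ≤ ∑' n, ‖LSeries.term (fun n ↦ (Nat.card {I : Ideal (𝓞 K) // Ideal.absNorm I = n} : ℂ)) s n‖ :=
        Summable.tsum_le_tsum hbd hsr.norm hsum.norm
    _ = ‖dedekindZeta K s‖ := by
        have e : ∀ n, LSeries.term (fun n ↦ (Nat.card {I : Ideal (𝓞 K) // Ideal.absNorm I = n} : ℂ)) s n
          = ((‖LSeries.term (fun n ↦ (Nat.card {I : Ideal (𝓞 K) // Ideal.absNorm I = n} : ℂ)) s n‖ : ℝ) : ℂ) := by
          intro n
          rw [LSeries.norm_term_eq, LSeries.term_def]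
          split_ifs with hn
          · simp
          · rw [Complex.norm_natCast, Complex.ofReal_div, Complex.ofReal_natCast]
            congr 1
            rw [Complex.ofReal_cpow (by positivity)]; simp
        rw [dedekindZeta, LSeries, tsum_congr e, ← Complex.ofReal_tsum, Complex.norm_real,
          Real.norm_of_nonneg]
        exact tsum_nonneg fun n => norm_nonneg _

theorem class_bound {K : Type*} [Field K] [NumberField K] (α : K) (p₁ p₂ : ℕ) (hp₁ : p₁.Prime)
    (hp₂ : p₂.Prime) (h1 : p₁ % 4 = 1) (h2 : p₂ % 4 = 3)
    (hα : α ^ 2 = -((p₁ : K) * p₂)) (hK : Algebra.adjoin ℚ {α} = ⊤) :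
    |∑ j ∈ Finset.range (p₁ * p₂), jacobiSym j (p₁ * p₂) * (j : ℤ)| ≤
      (p₁ * p₂ : ℤ) * NumberField.classNumber K := by
  have := Fact.mk hp₁
  have := Fact.mk hp₂
  have hd0 : 0 < p₁ * p₂ := Nat.mul_pos hp₁.pos hp₂.pos
  have hnz : NeZero (p₁ * p₂) := ⟨hd0.ne'⟩
  have hne : p₁ ≠ p₂ := by intro h; omega
  have hd1 : 1 < p₁ * p₂ := by nlinarith [hp₁.two_le, hp₂.two_le]
  have hd4 : (p₁ * p₂) % 4 = 3 := by rw [Nat.mul_mod, h1, h2]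
  have hsq : Squarefree (p₁ * p₂) :=
    (Nat.squarefree_mul ((Nat.coprime_primes hp₁ hp₂).mpr hne)).mpr
      ⟨hp₁.squarefree, hp₂.squarefree⟩
  have hα' : α ^ 2 = -(((p₁ * p₂ : ℕ)) : K) := by rw [hα]; push_cast; rfl
  have A := LFunction_one_odd (jacChar (p₁ * p₂)) (jacChar_primitive p₁ p₂ (by omega) (by omega) hne)
    (jacChar_odd _ hd4) (jacChar_inv _) hd1
  have B := L_one_le_residue α (p₁ * p₂) hd1 hsq hd4 hα' hK
  have C := quad_residue_le α (p₁ * p₂) hd1 hsq hα' hK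
  have hS : ∑ j : ZMod (p₁ * p₂), jacChar (p₁ * p₂) j * (j.val : ℂ) =
      ((∑ j ∈ Finset.range (p₁ * p₂), jacobiSym j (p₁ * p₂) * (j : ℤ) : ℤ) : ℂ) := by
    push_cast
    refine Finset.sum_nbij' (fun j => j.val) (fun j => (j : ZMod (p₁ * p₂))) ?_ ?_ ?_ ?_ ?_
    · intro a _; simp [ZMod.val_lt]
    · intro a _; simp
    · intro a _; simp
    · intro a ha; exact ZMod.val_natCast_of_lt (by simpa using ha)
    · intro a _; rw [jacChar_apply]
  rw [hS, Complex.norm_intCast] at A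
  have key : ∀ (d L R x hh : ℝ), 0 < d → L * (d * √d) = Real.pi * x → L ≤ R →
      R ≤ Real.pi * hh / √d → x ≤ d * hh := by
    intro d L R x hh hd A B C
    have hs : 0 < √d := Real.sqrt_pos.mpr hd
    have h1 : L * √d ≤ Real.pi * hh := by
      have := B.trans C
      rwa [le_div_iff₀ hs] at this
    have h2 : Real.pi * x ≤ Real.pi * (d * hh) := by
      rw [← A]; nlinarith
    exact le_of_mul_le_mul_left h2 Real.pi_pos
  have hd0' : (0:ℝ) < ((p₁ * p₂ : ℕ) : ℝ) := by exact_mod_cast hd0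
  have := key _ _ _ _ _ hd0' A B C
  rw [← Int.cast_abs] at this
  have h3 : ((|∑ j ∈ Finset.range (p₁ * p₂), jacobiSym j (p₁ * p₂) * (j : ℤ)| : ℤ) : ℝ) ≤
      (((p₁ * p₂ : ℤ) * NumberField.classNumber K : ℤ) : ℝ) := by
    push_cast at this ⊢
    exact this
  exact_mod_cast h3

theorem jac_sum_zero (d : ℕ) (hd4 : d % 4 = 3) : ∑ j ∈ Finset.range d, jacobiSym j d = 0 := by
  have hnz : NeZero d := ⟨by omega⟩
  have hne1 : jacChar d ≠ 1 := by
    intro h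
    have := jacChar_odd d hd4
    rw [h, DirichletCharacter.Odd] at this
    rw [MulChar.one_apply (by simp)] at this
    norm_num at this
  have := MulChar.sum_eq_zero_of_ne_one hne1
  have hS : ∑ j : ZMod d, jacChar d j = ((∑ j ∈ Finset.range d, jacobiSym j d : ℤ) : ℂ) := by
    push_cast
    refine Finset.sum_nbij' (fun j => j.val) (fun j => (j : ZMod d)) ?_ ?_ ?_ ?_ ?_
    · intro a _; simp [ZMod.val_lt]
    · intro a _; simp
    · intro a _; simp
    · intro a ha; exact ZMod.val_natCast_of_lt (by simpa using ha)
    · intro a _; rw [jacChar_apply]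
  rw [hS] at this
  exact_mod_cast this

theorem jac_wsum_mul (d M : ℕ) (hd4 : d % 4 = 3) :
    ∑ x ∈ Finset.range (d * M), jacobiSym x d * (x : ℤ) =
      M * ∑ y ∈ Finset.range d, jacobiSym y d * (y : ℤ) := by
  induction M with
  | zero => simp
  | succ M ih =>
    rw [Nat.mul_succ, Finset.sum_range_add, ih]
    have : ∀ x ∈ Finset.range d, jacobiSym ((d * M + x : ℕ) : ℤ) d * ((d * M + x : ℕ) : ℤ) =
        jacobiSym x d * (x : ℤ) + (d * M : ℤ) * jacobiSym x d := by
      intro x _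
      have : jacobiSym ((d * M + x : ℕ) : ℤ) d = jacobiSym x d := by
        rw [jacobiSym.mod_left]; push_cast
        rw [Int.add_comm, Int.add_mul_emod_self_left, ← jacobiSym.mod_left]
      rw [this]; push_cast; ring
    rw [Finset.sum_congr rfl this, Finset.sum_add_distrib, ← Finset.mul_sum, jac_sum_zero d hd4]
    push_cast; ring

theorem coset_sum (N d M f h e' p : ℕ) (hN : N = d * M) (hN0 : 0 < N)
    (hrad : ∀ x, Nat.Coprime x N ↔ Nat.Coprime x d) (hd4 : d % 4 = 3)
    (hJp : jacobiSym p d = 1) (hpN : p.Coprime N)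
    (hf : f = orderOf (p : ZMod N)) (hford : 2 * f = Nat.totient N) (hfe : f = h + 2 * e')
    (hB : |∑ j ∈ Finset.range d, jacobiSym j d * (j : ℤ)| ≤ (d : ℤ) * h)
    (t : ℕ) (ht : t.Coprime N) : N * e' ≤ ∑ i ∈ Finset.range f, (p ^ i * t) % N := by
  have hnz : NeZero N := ⟨hN0.ne'⟩
  have hnzd : NeZero d := ⟨by omega⟩
  have hdodd : Odd d := Nat.odd_iff.mpr (by omega)
  set u : ℕ → Bool → ℕ := fun i ε => if ε then (p ^ i * t) % N else N - (p ^ i * t) % N with hu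
  have hcop : ∀ i, (p ^ i * t).Coprime N := fun i => (hpN.pow_left i).mul_left ht
  have hN1 : 1 < N := by
    rcases Nat.lt_or_ge 1 N with h1 | h1
    · exact h1
    · have : N = 1 := by omega
      rw [hN] at this
      have := Nat.eq_one_of_mul_eq_one_right this
      omega
  have hmodc : ∀ i, ((p ^ i * t) % N).Coprime N := fun i => by
    have := hcop i
    rwa [Nat.Coprime, ← Nat.gcd_rec, Nat.gcd_comm] 
  have hpos : ∀ i, 0 < (p ^ i * t) % N := fun i => by
    rcases Nat.eq_zero_or_pos ((p ^ i * t) % N) with h0 | h0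
    · have := hmodc i
      rw [h0, Nat.coprime_zero_left] at this; omega
    · exact h0
  have hlt : ∀ i, (p ^ i * t) % N < N := fun i => Nat.mod_lt _ hN0
  have hJt0 : jacobiSym t d ≠ 0 := by
    rw [ne_eq, jacobiSym.eq_zero_iff_not_coprime, Int.gcd_natCast_natCast, not_not]
    exact (hrad t).mp ht
  have hdN : (d : ℤ) ∣ N := by rw [hN]; push_cast; exact dvd_mul_right _ _
  have hJ1 : ∀ i, jacobiSym ((u i true : ℕ) : ℤ) d = jacobiSym t d := fun i => by
    simp only [hu, if_true]
    rw [jacobiSym.mod_left]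
    push_cast
    rw [Int.emod_emod_of_dvd _ hdN, ← jacobiSym.mod_left, jacobiSym.mul_left, jacobiSym.pow_left, hJp]
    simp
  have hJ2 : ∀ i, jacobiSym ((u i false : ℕ) : ℤ) d = - jacobiSym t d := fun i => by
    rw [← hJ1 i]
    simp only [hu, if_true, Bool.false_eq_true, if_false]
    rw [Nat.cast_sub (hlt i).le, ← neg_one_mul, ← ZMod.χ₄_nat_three_mod_four hd4,
      ← jacobiSym.at_neg_one hdodd, ← jacobiSym.mul_left, jacobiSym.mod_left]
    rw [jacobiSym.mod_left (-1 * _)]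
    congr 1
    apply Int.ModEq.symm
    rw [Int.modEq_iff_dvd]
    ring_nf
    exact hdN
  have hinj : ∀ i j, i < f → j < f → (p ^ i * t) % N = (p ^ j * t) % N → i = j := by
    intro i j hi hj hij
    have h1 : (p ^ i * t) ≡ (p ^ j * t) [MOD N] := hij
    have h2 := Nat.ModEq.cancel_right_of_coprime (by rwa [Nat.gcd_comm]) h1
    have h3 := (ZMod.natCast_eq_natCast_iff _ _ _).mpr h2
    push_cast at h3
    rw [hf] at hi hj
    exact pow_injOn_Iio_orderOf hi hj h3
  have himg : ((Finset.range f) ×ˢ (Finset.univ : Finset Bool)).image (fun x => u x.1 x.2) =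
      (Finset.range N).filter (fun x => x.Coprime N) := by
    apply Finset.eq_of_subset_of_card_le
    · intro x hx
      rw [Finset.mem_image] at hx
      obtain ⟨⟨i, ε⟩, hi, rfl⟩ := hx
      rw [Finset.mem_filter, Finset.mem_range]
      rcases ε with _ | _
      · simp only [hu, Bool.false_eq_true, if_false]
        refine ⟨by have := hpos i; omega, ?_⟩
        exact (Nat.coprime_self_sub_left (hlt i).le).mpr (hmodc i)
      · exact ⟨hlt i, hmodc i⟩
    · rw [Finset.card_image_of_injOn]
      · rw [Finset.card_product, Finset.card_range, Finset.card_univ, Fintype.card_bool]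
        rw [Nat.totient_eq_card_coprime] at hford
        have : (Finset.range N).filter (fun x => x.Coprime N) = (Finset.range N).filter (N.Coprime) := by
          ext x; simp [Nat.coprime_comm]
        rw [this, ← hford]; omega
      · rintro ⟨i, ε⟩ hi ⟨j, δ⟩ hj hij
        simp only [Finset.coe_product, Set.mem_prod, Finset.mem_coe, Finset.mem_range] at hi hj
        simp only at hij
        have a1 := hJ1 i
        have a2 := hJ2 i
        have b1 := hJ1 j
        have b2 := hJ2 j
        rcases ε with _ | _ <;> rcases δ with _ | _
        · simp only [hu, Bool.false_eq_true, if_false] at hij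
          have := hlt i; have := hlt j
          rw [hinj i j hi.1 hj.1 (by omega)]
        · rw [hij] at a2; omega
        · rw [hij] at a1; omega
        · simp only [hu, if_true] at hij
          rw [hinj i j hi.1 hj.1 hij]
  have hinjOn : Set.InjOn (fun x : ℕ × Bool => u x.1 x.2) ((Finset.range f) ×ˢ (Finset.univ : Finset Bool) : Finset (ℕ × Bool)) := by
    rintro ⟨i, ε⟩ hi ⟨j, δ⟩ hj hij
    simp only [Finset.coe_product, Set.mem_prod, Finset.mem_coe, Finset.mem_range] at hi hj
    simp only at hij
    have a1 := hJ1 i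
    have a2 := hJ2 i
    have b1 := hJ1 j
    have b2 := hJ2 j
    rcases ε with _ | _ <;> rcases δ with _ | _
    · simp only [hu, Bool.false_eq_true, if_false] at hij
      have := hlt i; have := hlt j
      rw [hinj i j hi.1 hj.1 (by omega)]
    · rw [hij] at a2; omega
    · rw [hij] at a1; omega
    · simp only [hu, if_true] at hij
      rw [hinj i j hi.1 hj.1 hij]
  have hW := jac_wsum_mul d M hd4
  rw [← hN] at hW
  have hW2 : ∑ x ∈ Finset.range N, jacobiSym x d * (x : ℤ) =
      ∑ x ∈ (Finset.range N).filter (fun x => x.Coprime N), jacobiSym x d * (x : ℤ) := by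
    rw [Finset.sum_filter]
    apply Finset.sum_congr rfl
    intro x _
    split_ifs with hx
    · rfl
    · rw [hrad] at hx
      rw [jacobiSym.eq_zero_iff_not_coprime.mpr, zero_mul]
      rwa [Int.gcd_natCast_natCast]
  rw [← himg, Finset.sum_image hinjOn, Finset.sum_product] at hW2
  have hW3 : ∀ i ∈ Finset.range f, ∑ y : Bool, jacobiSym ((u i y : ℕ) : ℤ) d * ((u i y : ℕ) : ℤ) =
      jacobiSym t d * (2 * (((p ^ i * t) % N : ℕ) : ℤ) - N) := by
    intro i _
    rw [Fintype.sum_bool, hJ1, hJ2]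
    simp only [hu, if_true, Bool.false_eq_true, if_false]
    rw [Nat.cast_sub (hlt i).le]; ring
  rw [Finset.sum_congr rfl hW3, ← Finset.mul_sum, Finset.sum_sub_distrib, ← Finset.mul_sum,
    Finset.sum_const, Finset.card_range, nsmul_eq_mul, hW] at hW2
  have hJabs : |jacobiSym t d| = 1 := by
    have := jacobiSym.sq_one (a := (t:ℤ)) (b := d) (by rw [Int.gcd_natCast_natCast]; exact (hrad t).mp ht)
    exact (sq_eq_sq₀ (abs_nonneg _) zero_le_one).mp (by rw [sq_abs, this]; norm_num)
  have hW4 := congrArg abs hW2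
  rw [abs_mul, abs_mul, hJabs, one_mul, Nat.abs_cast] at hW4
  have h5 : |2 * ∑ i ∈ Finset.range f, (((p ^ i * t) % N : ℕ) : ℤ) - f * N| ≤ N * h := by
    rw [← hW4, hN]; push_cast
    nlinarith [Int.natCast_nonneg M]
  have h6 := (abs_le.mp h5).1
  have : (N * e' : ℤ) ≤ ∑ i ∈ Finset.range f, (((p ^ i * t) % N : ℕ) : ℤ) := by
    rw [hfe] at h6 ⊢; push_cast at h6 ⊢; nlinarith
  exact_mod_cast this

theorem exists_val (p : ℕ) (hp : p.Prime) : ∃ V : ValuationSubring ℂ, (p : ℂ) ∈ V.nonunits ∧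
    ∀ z : ℂ, IsIntegral ℤ z → z ∈ V := by
  let A : Subring ℂ := (Int.castRingHom ℂ).range
  let P : A := ⟨(p : ℂ), (p : ℤ), by simp⟩
  have hI : Ideal.span {P} ≠ ⊤ := by
    rw [Ne, Ideal.span_singleton_eq_top]
    intro hu
    obtain ⟨y, hy⟩ := hu.exists_right_inv
    obtain ⟨y, n, rfl⟩ := y
    have h1 := congrArg Subtype.val hy
    have h2 : (p : ℂ) * (n : ℂ) = 1 := by simpa using h1
    have h3 : (p : ℤ) * n = 1 := by exact_mod_cast h2
    have := Int.isUnit_iff.mp (IsUnit.of_mul_eq_one _ h3)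
    have := hp.two_le
    omega
  obtain ⟨V, hV, hV2⟩ := Ideal.image_subset_nonunits_valuationSubring _ hI
  refine ⟨V, hV2 ⟨P, Ideal.mem_span_singleton_self _, rfl⟩, ?_⟩
  intro z hz
  have : IsIntegral V z := hz.tower_top
  obtain ⟨y, hy⟩ := (IsIntegrallyClosed.isIntegral_iff (R := V) (K := ℂ)).mp this
  rw [← hy]; exact y.2

theorem exists_teich (p : ℕ) (hp : p.Prime) (V : ValuationSubring ℂ) (hpV : (p : ℂ) ∈ V.nonunits)
    (hV : ∀ z : ℂ, IsIntegral ℤ z → z ∈ V)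
    {F : Type*} [Field F] [Fintype F] (f : ℕ) (hf : f ≠ 0) (hcard : Fintype.card F = p ^ f)
    (γ : Fˣ) (hγ : ∀ x : Fˣ, x ∈ Subgroup.zpowers γ) :
    ∃ ι : F →+* IsLocalRing.ResidueField V, ∃ ω : MulChar F ℂ,
      ∀ x : F, ∃ h : ω x ∈ V, IsLocalRing.residue V ⟨ω x, h⟩ = ι x := by
  classical
  have := Fact.mk hp
  have hchar : CharP F p := charP_of_card_eq_prime_pow hcard
  let _ : Algebra (ZMod p) F := ZMod.algebra F p
  have hq2 : 2 ≤ p ^ f := le_trans hp.two_le (Nat.le_self_pow hf p)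
  obtain ⟨n, hn⟩ : ∃ n, p ^ f = n + 1 := ⟨p ^ f - 1, by omega⟩
  have hn0 : n ≠ 0 := by omega
  have hnpos : 0 < n := by omega
  have : NeZero n := ⟨hn0⟩
  have hprim := Complex.isPrimitiveRoot_exp n hn0
  set ζ := Complex.exp (2 * Real.pi * Complex.I / n) with hζ
  have hζV : ζ ∈ V := hV _ (hprim.isIntegral hnpos)
  let z : V := ⟨ζ, hζV⟩
  have hz : IsPrimitiveRoot z n := by
    apply IsPrimitiveRoot.of_map_of_injective (f := V.subtype) _ Subtype.val_injective
    exact hprim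
  have hprod := Polynomial.X_pow_sub_one_eq_prod hnpos hz
  have hprod' := congrArg (Polynomial.map (IsLocalRing.residue V)) hprod
  rw [Polynomial.map_prod] at hprod'
  simp only [Polynomial.map_sub, Polynomial.map_pow, Polynomial.map_X, Polynomial.map_one,
    Polynomial.map_C] at hprod'
  -- characteristic of the residue field
  have hp0 : ((p : ℕ) : IsLocalRing.ResidueField V) = 0 := by
    have h1 : (p : V) ∈ IsLocalRing.maximalIdeal V := by
      have := (ValuationSubring.mem_nonunits_iff_exists_mem_maximalIdeal).mp hpV
      obtain ⟨h, h2⟩ := this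
      exact h2
    have := (IsLocalRing.residue_eq_zero_iff _).mpr h1
    simpa using this
  have hck : CharP (IsLocalRing.ResidueField V) p := by
    obtain ⟨c, hc⟩ := CharP.exists (IsLocalRing.ResidueField V)
    have hd : c ∣ p := (CharP.cast_eq_zero_iff (IsLocalRing.ResidueField V) c p).mp hp0
    rcases (Nat.dvd_prime hp).mp hd with rfl | rfl
    · exact absurd rfl (CharP.ringChar_ne_one (R := IsLocalRing.ResidueField V) |> fun h => by
        rw [ringChar.eq (IsLocalRing.ResidueField V) 1] at h; exact h)
    · exact hc
  let _ : Algebra (ZMod p) (IsLocalRing.ResidueField V) := ZMod.algebra _ p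
  have hspl := FiniteField.isSplittingField_of_card_eq p f hcard
  let ι : F →ₐ[ZMod p] IsLocalRing.ResidueField V := Polynomial.IsSplittingField.lift F
    (Polynomial.X ^ p ^ f - Polynomial.X : Polynomial (ZMod p)) (by
      simp only [Polynomial.map_sub, Polynomial.map_pow, Polynomial.map_X]
      have : (Polynomial.X ^ p ^ f - Polynomial.X : Polynomial (IsLocalRing.ResidueField V)) =
        Polynomial.X * (Polynomial.X ^ n - 1) := by rw [hn]; ring
      rw [this, hprod']
      apply Polynomial.Splits.mul Polynomial.Splits.X
      apply Polynomial.Splits.prod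
      intro i _
      exact Polynomial.Splits.X_sub_C _)
  have hcu : Fintype.card Fˣ = n := by
    rw [Fintype.card_units, hcard, hn]; rfl
  have hιγ : (ι γ) ^ n = 1 := by
    have : γ ^ n = 1 := by rw [← hcu]; exact pow_card_eq_one
    rw [← map_pow, ← Units.val_pow_eq_pow_val, this]; simp
  have hev := congrArg (Polynomial.eval (ι γ)) hprod'
  rw [Polynomial.eval_prod] at hev
  simp only [Polynomial.eval_sub, Polynomial.eval_pow, Polynomial.eval_X, Polynomial.eval_one, hιγ,
    sub_self, Polynomial.eval_C] at hev
  obtain ⟨w, hw, hw2⟩ := Finset.prod_eq_zero_iff.mp hev.symm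
  rw [Polynomial.mem_nthRootsFinset hnpos] at hw
  have hwC : (w : ℂ) ^ n = 1 := by
    have := congrArg Subtype.val hw
    simpa using this
  let wu : ℂˣ := Units.ofPowEqOne (w : ℂ) n hwC hn0
  have hwu : wu ∈ rootsOfUnity (Fintype.card Fˣ) ℂ := by
    rw [mem_rootsOfUnity, hcu]
    exact Units.pow_ofPowEqOne hwC hn0
  refine ⟨ι.toRingHom, MulChar.ofRootOfUnity hwu hγ, ?_⟩
  intro x
  by_cases hx : x = 0
  · subst hx
    refine ⟨by rw [MulChar.map_zero]; exact V.zero_mem, ?_⟩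
    have : (⟨(MulChar.ofRootOfUnity hwu hγ) 0, by rw [MulChar.map_zero]; exact V.zero_mem⟩ : V) = 0 := by
      apply Subtype.ext; exact MulChar.map_zero _
    rw [this]; simp
  · obtain ⟨k, hk⟩ := (mem_powers_iff_mem_zpowers.mpr (hγ (Units.mk0 x hx)))
    have hxk : x = (γ : F) ^ k := by
      have := congrArg Units.val hk
      simpa using this.symm
    have hval : MulChar.ofRootOfUnity hwu hγ x = (w : ℂ) ^ k := by
      rw [hxk, map_pow, MulChar.ofRootOfUnity_spec]; rfl
    refine ⟨by rw [hval]; exact V.pow_mem w.2 k, ?_⟩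
    have : (⟨(MulChar.ofRootOfUnity hwu hγ) x, by rw [hval]; exact pow_mem w.2 k⟩ : V) = w ^ k := by
      apply Subtype.ext; exact hval.trans (by simp)
    rw [this, map_pow, ← sub_eq_zero.mp hw2, hxk]
    simp

theorem digsum_div (p : ℕ) (hp : 1 < p) (a : ℕ) :
    (Nat.digits p a).sum = a % p + (Nat.digits p (a / p)).sum := by
  rcases Nat.eq_zero_or_pos a with rfl | h
  · simp
  · rw [Nat.digits_def' hp h, List.sum_cons]

theorem digsum_legendre (p : ℕ) (hp : 1 < p) (f : ℕ) : ∀ a < p ^ f,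
    ((p : ℤ) - 1) * ∑ j ∈ Finset.range f, ((a / p ^ (j + 1) : ℕ) : ℤ) + (Nat.digits p a).sum = a := by
  induction f with
  | zero => intro a ha; have : a = 0 := by simpa using ha
            subst this; simp
  | succ f ih =>
    intro a ha
    have h1 : a / p < p ^ f := Nat.div_lt_of_lt_mul (by rwa [pow_succ'] at ha)
    have h2 := ih _ h1
    rw [Finset.sum_range_succ', digsum_div p hp]
    have h3 : ∀ j, a / p ^ (j + 1 + 1) = a / p / p ^ (j + 1) := fun j => by
      rw [Nat.div_div_eq_div_mul, ← pow_succ']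
    simp only [h3, zero_add, pow_one]
    have h4 : ((p : ℤ) * (a / p : ℕ) + (a % p : ℕ)) = a := by exact_mod_cast Nat.div_add_mod a p
    push_cast at *
    linear_combination h2 + h4

theorem shift_mod (p f a i : ℕ) (hp : 1 < p) (hi : i < f) (ha : a < p ^ f - 1) :
    (((p ^ i * a) % (p ^ f - 1) : ℕ) : ℤ) = p ^ i * a - (p ^ f - 1) * (a / p ^ (f - i) : ℕ) := by
  set A := a / p ^ (f - i)
  set B := a % p ^ (f - i)
  have hAB : a = p ^ (f - i) * A + B := (Nat.div_add_mod _ _).symm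
  have hpp : p ^ i * p ^ (f - i) = p ^ f := by rw [← pow_add]; congr 1; omega
  have hi1 : 1 ≤ p ^ i := Nat.one_le_pow _ _ (by omega)
  have hf1 : 1 ≤ p ^ f := Nat.one_le_pow _ _ (by omega)
  have hB : B + 1 ≤ p ^ (f - i) := Nat.mod_lt _ (by positivity)
  have hA : A + 1 ≤ p ^ i := Nat.div_lt_of_lt_mul (by rw [mul_comm, hpp]; omega)
  have hlt : A + p ^ i * B < p ^ f - 1 := by
    by_contra hcon
    have h1 : p ^ i * (B + 1) ≤ p ^ f := by rw [← hpp]; exact Nat.mul_le_mul_left _ hB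
    have h2 : p ^ i * (B + 1) = p ^ f := by rw [Nat.mul_add] at *; omega
    have h3 : A + 1 = p ^ i := by rw [Nat.mul_add] at *; omega
    have h4 : B + 1 = p ^ (f - i) := by
      rw [← hpp] at h2; exact Nat.eq_of_mul_eq_mul_left (by omega) h2
    have h5 : a + 1 = p ^ f := by
      rw [hAB, add_assoc, h4, ← Nat.mul_succ, Nat.succ_eq_add_one, h3, mul_comm, hpp]
    omega
  have heq : p ^ i * a = (A + p ^ i * B) + (p ^ f - 1) * A := by
    have : p ^ f = (p ^ f - 1) + 1 := by omega
    generalize p ^ f - 1 = q at *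
    rw [hAB]
    calc p ^ i * (p ^ (f - i) * A + B) = (p ^ i * p ^ (f - i)) * A + p ^ i * B := by ring
      _ = _ := by rw [hpp, this]; ring
  rw [heq, Nat.add_mul_mod_self_left, Nat.mod_eq_of_lt hlt]
  have h6 : ((p ^ i * a : ℕ) : ℤ) = ((A + p ^ i * B) + (p ^ f - 1) * A : ℕ) := by rw [heq]
  rw [Nat.cast_add, Nat.cast_mul (p ^ f - 1), Nat.cast_sub hf1] at h6
  push_cast at h6 ⊢
  linear_combination -h6

theorem sigma_eq (p f a : ℕ) (hp : 1 < p) (ha : a < p ^ f - 1) :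
    (p - 1) * ∑ i ∈ Finset.range f, (p ^ i * a) % (p ^ f - 1) = (p ^ f - 1) * (Nat.digits p a).sum := by
  have hf1 : 1 ≤ p ^ f := Nat.one_le_pow _ _ (by omega)
  have h1 := digsum_legendre p hp f a (by omega)
  have h2 : ∑ i ∈ Finset.range f, (((p ^ i * a) % (p ^ f - 1) : ℕ) : ℤ) =
      (∑ i ∈ Finset.range f, (p : ℤ) ^ i) * a - (p ^ f - 1) * ∑ j ∈ Finset.range f, ((a / p ^ (j + 1) : ℕ) : ℤ) := by
    rw [Finset.sum_congr rfl (fun i hi => shift_mod p f a i hp (Finset.mem_range.mp hi) ha),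
      Finset.sum_sub_distrib, Finset.sum_mul, ← Finset.mul_sum]
    congr 2
    rw [← Finset.sum_range_reflect]
    apply Finset.sum_congr rfl
    intro j hj
    have := Finset.mem_range.mp hj
    congr 3; omega
  have h3 : (∑ i ∈ Finset.range f, (p : ℤ) ^ i) * (p - 1) = p ^ f - 1 := geom_sum_mul _ _
  have h4 : (((p - 1) * ∑ i ∈ Finset.range f, (p ^ i * a) % (p ^ f - 1) : ℕ) : ℤ) =
      (((p ^ f - 1) * (Nat.digits p a).sum : ℕ) : ℤ) := by
    rw [Nat.cast_mul, Nat.cast_sum, h2, Nat.cast_mul, Nat.cast_sub hf1, Nat.cast_sub hp.le,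
      Nat.cast_pow, Nat.cast_one]
    linear_combination -((p:ℤ) ^ f - 1) * h1 + a * h3
  exact_mod_cast h4

/-- reflection of the digit sum -/
theorem digsum_reflect (p f a : ℕ) (hp : 1 < p) (ha : a < p ^ f - 1) (ha0 : 0 < a) :
    (Nat.digits p a).sum + (Nat.digits p (p ^ f - 1 - a)).sum = f * (p - 1) := by
  have h1 := sigma_eq p f a hp ha
  have h2 := sigma_eq p f (p ^ f - 1 - a) hp (by omega)
  have hcop : ∀ i, Nat.Coprime (p ^ i) (p ^ f - 1) := by
    intro i
    apply Nat.Coprime.pow_left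
    rcases Nat.eq_zero_or_pos f with rfl | hf
    · simp at ha
    have : p ∣ p ^ f := dvd_pow_self _ hf.ne'
    have hf1 : 1 ≤ p ^ f := Nat.one_le_pow _ _ (by omega)
    rw [Nat.coprime_iff_gcd_eq_one]
    have hd1 := (Nat.gcd_dvd_left p (p ^ f - 1)).trans this
    have hd2 := Nat.gcd_dvd_right p (p ^ f - 1)
    have := (Nat.dvd_sub hd1 hd2)
    rw [show p ^ f - (p ^ f - 1) = 1 by omega] at this
    exact Nat.dvd_one.mp this
  have h3 : ∀ i ∈ Finset.range f, (p ^ i * a) % (p ^ f - 1) + (p ^ i * (p ^ f - 1 - a)) % (p ^ f - 1)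
      = p ^ f - 1 := by
    intro i _
    set q := p ^ f - 1
    have hq : 0 < q := by omega
    have ha1 : (p ^ i * a) % q ≠ 0 := by
      intro h
      have := (hcop i).symm.dvd_of_dvd_mul_left (Nat.dvd_of_mod_eq_zero h)
      exact absurd (Nat.le_of_dvd ha0 this) (by omega)
    have hs : ((p ^ i * a) % q + (p ^ i * (q - a)) % q) % q = 0 := by
      rw [← Nat.add_mod, ← Nat.mul_add, show a + (q - a) = q by omega]; simp
    have l1 := Nat.mod_lt (p ^ i * a) hq
    have l2 := Nat.mod_lt (p ^ i * (q - a)) hq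
    obtain ⟨c, hc⟩ := Nat.dvd_of_mod_eq_zero hs
    have : c = 1 := by
      have c1 : 0 < c := by
        rcases Nat.eq_zero_or_pos c with rfl | h
        · omega
        · exact h
      have c2 : c < 2 := by
        by_contra h
        have : q * 2 ≤ q * c := Nat.mul_le_mul_left _ (by omega)
        omega
      omega
    rw [hc, this, mul_one]
  have h4 : ∑ i ∈ Finset.range f, (p ^ i * a) % (p ^ f - 1) +
      ∑ i ∈ Finset.range f, (p ^ i * (p ^ f - 1 - a)) % (p ^ f - 1) = f * (p ^ f - 1) := by
    rw [← Finset.sum_add_distrib, Finset.sum_congr rfl h3]; simp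
  have h5 : (p ^ f - 1) * ((Nat.digits p a).sum + (Nat.digits p (p ^ f - 1 - a)).sum) =
      (p ^ f - 1) * (f * (p - 1)) := by
    rw [Nat.mul_add, ← h1, ← h2, ← Nat.mul_add, h4]; ring
  exact Nat.eq_of_mul_eq_mul_left (by omega) h5

/-- The canonical additive character `x ↦ ζ_p^{Tr x}`. -/
noncomputable def psiF (p : ℕ) [Fact p.Prime] (F : Type*) [Field F] [Algebra (ZMod p) F] :
    AddChar F ℂ :=
  (ZMod.stdAddChar (N := p)).compAddMonoidHom (Algebra.trace (ZMod p) F).toAddMonoidHom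

theorem psiF_apply (p : ℕ) [Fact p.Prime] (F : Type*) [Field F] [Algebra (ZMod p) F] (x : F) :
    psiF p F x = ZMod.stdAddChar (Algebra.trace (ZMod p) F x) := rfl

theorem psiF_frob (p : ℕ) [Fact p.Prime] (F : Type*) [Field F] [Fintype F] [Algebra (ZMod p) F]
    (x : F) : psiF p F (x ^ p) = psiF p F x := by
  rw [psiF_apply, psiF_apply]
  congr 1
  have := Algebra.trace_eq_of_algEquiv (FiniteField.frobeniusAlgEquivOfAlgebraic (ZMod p) F) x
  rw [← this]
  simp [FiniteField.coe_frobeniusAlgEquivOfAlgebraic, ZMod.card]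

theorem psiF_prim (p : ℕ) [Fact p.Prime] (F : Type*) [Field F] [Fintype F] [Algebra (ZMod p) F] :
    (psiF p F).IsPrimitive := by
  apply AddChar.IsPrimitive.of_ne_one
  obtain ⟨a, ha⟩ : ∃ a : F, Algebra.trace (ZMod p) F a ≠ 0 := by
    by_contra! hf
    have htr := (traceForm_nondegenerate (ZMod p) F).1 1
    simp_rw [Algebra.traceForm_apply] at htr
    exact one_ne_zero (htr fun b => hf _)
  intro h
  apply ha
  have h1 : psiF p F a = 1 := by rw [h]; rfl
  rw [psiF_apply] at h1
  apply ZMod.injective_stdAddChar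
  rw [h1, AddChar.map_zero_eq_one]

/-- the standard `p`-th root of unity -/
noncomputable def zetaP (p : ℕ) [Fact p.Prime] : ℂ := ZMod.stdAddChar (1 : ZMod p)

theorem zetaP_pow (p : ℕ) [Fact p.Prime] (x : ZMod p) : ZMod.stdAddChar x = zetaP p ^ x.val := by
  rw [zetaP, ← AddChar.map_nsmul_eq_pow]; simp

theorem zetaP_prim (p : ℕ) [Fact p.Prime] : IsPrimitiveRoot (zetaP p) p := by
  have hp : p.Prime := Fact.out
  have h1 : zetaP p ^ p = 1 := by
    rw [zetaP, ← AddChar.map_nsmul_eq_pow]; simp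
  have h2 : zetaP p ≠ 1 := by
    intro h
    have : (1 : ZMod p) = 0 := by
      apply ZMod.injective_stdAddChar
      rw [AddChar.map_zero_eq_one]; exact h
    exact one_ne_zero this
  rw [IsPrimitiveRoot.iff_orderOf]
  exact orderOf_eq_prime h1 h2

theorem val_p (p : ℕ) [Fact p.Prime] (V : ValuationSubring ℂ)
    (hV : ∀ z : ℂ, IsIntegral ℤ z → z ∈ V) :
    V.valuation (p : ℂ) = V.valuation (zetaP p - 1) ^ (p - 1) := by
  have hp : p.Prime := Fact.out
  have hz := zetaP_prim p
  have h1 := Polynomial.eval_one_cyclotomic_prime (R := ℂ) (p := p)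
  rw [Polynomial.cyclotomic_eq_prod_X_sub_primitiveRoots hz, Polynomial.eval_prod] at h1
  rw [← h1, map_prod]
  have hle : ∀ (μ : ℂ) (k : ℕ), IsPrimitiveRoot μ p → V.valuation (μ ^ k - 1) ≤ V.valuation (μ - 1) := by
    intro μ k hμ
    rw [← geom_sum_mul μ k, map_mul]
    have : V.valuation (∑ i ∈ Finset.range k, μ ^ i) ≤ 1 := by
      rw [V.valuation_le_one_iff]
      apply sum_mem
      intro i _
      exact pow_mem (hV _ (hμ.isIntegral hp.pos)) i
    exact mul_le_of_le_one_left' this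
  have : ∀ μ ∈ primitiveRoots p ℂ, V.valuation (Polynomial.eval 1 (Polynomial.X - Polynomial.C μ)) =
      V.valuation (zetaP p - 1) := by
    intro μ hμ
    rw [mem_primitiveRoots hp.pos] at hμ
    simp only [Polynomial.eval_sub, Polynomial.eval_X, Polynomial.eval_C]
    rw [Valuation.map_sub_swap]
    apply le_antisymm
    · obtain ⟨k, _, rfl⟩ := hz.eq_pow_of_pow_eq_one hμ.pow_eq_one
      exact hle _ _ hz
    · obtain ⟨k, _, hk⟩ := hμ.eq_pow_of_pow_eq_one hz.pow_eq_one
      rw [← hk]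
      exact hle _ _ hμ
  rw [Finset.prod_congr rfl this, Finset.prod_const, Complex.card_primitiveRoots, Nat.totient_prime hp]

theorem residue_zetaP (p : ℕ) [Fact p.Prime] (V : ValuationSubring ℂ) (hpV : (p : ℂ) ∈ V.nonunits)
    (hV : ∀ z : ℂ, IsIntegral ℤ z → z ∈ V) (h : zetaP p ∈ V) :
    IsLocalRing.residue V ⟨zetaP p, h⟩ = 1 := by
  have hp : p.Prime := Fact.out
  have hlt : V.valuation (p : ℂ) < 1 := V.mem_nonunits_iff.mp hpV
  rw [val_p p V hV] at hlt
  have h2 : V.valuation (zetaP p - 1) < 1 := by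
    by_contra hc
    exact absurd (one_le_pow_of_one_le' (not_lt.mp hc) (p - 1)) (not_le.mpr hlt)
  rw [← sub_eq_zero, ← map_one (IsLocalRing.residue V), ← map_sub, IsLocalRing.residue_eq_zero_iff,
    V.valuation_lt_one_iff]
  exact h2

theorem val_gauss_teich (p : ℕ) [Fact p.Prime] (V : ValuationSubring ℂ) (hpV : (p : ℂ) ∈ V.nonunits)
    (hV : ∀ z : ℂ, IsIntegral ℤ z → z ∈ V)
    {F : Type*} [Field F] [Fintype F] [Algebra (ZMod p) F] (f : ℕ) (hf : f ≠ 0)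
    (hcard : Fintype.card F = p ^ f)
    (hq : 2 < p ^ f) (ι : F →+* IsLocalRing.ResidueField V) (ω : MulChar F ℂ)
    (hω : ∀ x : F, ∃ h : ω x ∈ V, IsLocalRing.residue V ⟨ω x, h⟩ = ι x) (hω1 : ω⁻¹ ≠ 1) :
    V.valuation (gaussSum ω⁻¹ (psiF p F)) = V.valuation (zetaP p - 1) := by
  classical
  have hp : p.Prime := Fact.out
  have hzV : zetaP p ∈ V := hV _ ((zetaP_prim p).isIntegral hp.pos)
  let z : V := ⟨zetaP p, hzV⟩
  have hz1 : IsLocalRing.residue V z = 1 := residue_zetaP p V hpV hV hzV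
  let W : F → V := fun x => ∑ j ∈ Finset.range (Algebra.trace (ZMod p) F x).val, z ^ j
  have hW : ∀ x, psiF p F x - 1 = (W x : ℂ) * (zetaP p - 1) := by
    intro x
    rw [psiF_apply, zetaP_pow, ← geom_sum_mul]
    congr 1
    simp [W, z]
  have hWr : ∀ x, IsLocalRing.residue V (W x) = ι (∑ i ∈ Finset.range f, x ^ p ^ i) := by
    intro x
    simp only [W, map_sum, map_pow, hz1, one_pow, Finset.sum_const, Finset.card_range, nsmul_eq_mul, mul_one]
    have h1 := FiniteField.algebraMap_trace_eq_sum_pow (ZMod p) F x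
    rw [Nat.card_zmod] at h1
    have h2 : Module.finrank (ZMod p) F = f := by
      have := Module.card_eq_pow_finrank (K := ZMod p) (V := F)
      rw [ZMod.card, hcard] at this
      exact (Nat.pow_right_injective hp.two_le this).symm
    rw [h2] at h1
    have h3 := congrArg ι h1
    simp only [map_sum, map_pow] at h3
    rw [← h3]
    have h4 : algebraMap (ZMod p) F (Algebra.trace (ZMod p) F x) = ((Algebra.trace (ZMod p) F x).val : F) := by
      conv_lhs => rw [← ZMod.natCast_zmod_val (Algebra.trace (ZMod p) F x)]
      rw [map_natCast]
    rw [h4, map_natCast]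
  have hωV : ∀ x, ω⁻¹ x ∈ V := by
    intro x
    rw [MulChar.inv_apply']
    exact (hω _).1
  let O : F → V := fun x => ⟨ω⁻¹ x, hωV x⟩
  have hO : ∀ x, IsLocalRing.residue V (O x) = ι x⁻¹ := by
    intro x
    obtain ⟨h, h2⟩ := hω x⁻¹
    rw [← h2]
    congr 1
    apply Subtype.ext
    exact MulChar.inv_apply' ω x
  have hg : gaussSum ω⁻¹ (psiF p F) = ((∑ x, O x * W x : V) : ℂ) * (zetaP p - 1) := by
    have h0 := MulChar.sum_eq_zero_of_ne_one hω1
    rw [gaussSum]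
    have : ∀ x, ω⁻¹ x * psiF p F x = ω⁻¹ x * (W x : ℂ) * (zetaP p - 1) + ω⁻¹ x := by
      intro x
      rw [mul_assoc, ← hW]; ring
    rw [Finset.sum_congr rfl (fun x _ => this x), Finset.sum_add_distrib, h0, add_zero, ← Finset.sum_mul]
    congr 1
    push_cast
    rfl
  have hres : IsLocalRing.residue V (∑ x, O x * W x) = -1 := by
    rw [map_sum]
    simp only [map_mul, hO, hWr]
    simp only [← map_mul]
    rw [← map_sum, ← map_one ι, ← map_neg]
    congr 1
    simp only [Finset.mul_sum]
    rw [Finset.sum_comm]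
    have hi : ∀ i ∈ Finset.range f, ∑ x : F, x⁻¹ * x ^ p ^ i = if i = 0 then -1 else 0 := by
      intro i hi
      have h1 : ∀ x : F, x⁻¹ * x ^ p ^ i = if x = 0 then 0 else x ^ (p ^ i - 1) := by
        intro x
        split_ifs with hx
        · subst hx; simp
        · have : p ^ i = (p ^ i - 1) + 1 := by have := Nat.one_le_pow i p hp.pos; omega
          conv_lhs => rw [this, pow_succ']
          field_simp
      rw [Finset.sum_congr rfl (fun x _ => h1 x)]
      have hlt : p ^ i < p ^ f := Nat.pow_lt_pow_right hp.one_lt (Finset.mem_range.mp hi)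
      split_ifs with hi0
      · subst hi0
        simp only [pow_zero, Nat.sub_self]
        have hite : ∀ x : F, (if x = 0 then (0 : F) else 1) = if ¬ x = 0 then 1 else 0 := by
          intro x; split_ifs <;> simp_all
        rw [Finset.sum_congr rfl (fun x _ => hite x), ← Finset.sum_filter, Finset.sum_const]
        have : (Finset.univ.filter (fun x : F => ¬ x = 0)).card = p ^ f - 1 := by
          rw [Finset.filter_ne' Finset.univ (0 : F), Finset.card_erase_of_mem (Finset.mem_univ _), Finset.card_univ, hcard]
        rw [this, nsmul_eq_mul, Nat.cast_sub (by omega)]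
        have : ((p ^ f : ℕ) : F) = 0 := by rw [← hcard]; exact FiniteField.cast_card_eq_zero F
        rw [this]; simp
      · have hne : p ^ i - 1 ≠ 0 := by
          have := Nat.one_lt_pow hi0 hp.one_lt
          omega
        have h2 : ∀ x : F, (if x = 0 then 0 else x ^ (p ^ i - 1)) = x ^ (p ^ i - 1) := by
          intro x
          split_ifs with hx
          · subst hx; rw [zero_pow hne]
          · rfl
        rw [Finset.sum_congr rfl (fun x _ => h2 x)]
        apply FiniteField.sum_pow_lt_card_sub_one
        rw [hcard]
        have := Nat.one_le_pow i p hp.pos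
        omega
    rw [Finset.sum_congr rfl hi]
    simp [Nat.pos_of_ne_zero hf]
  have hunit : V.valuation ((∑ x, O x * W x : V) : ℂ) = 1 := by
    rw [← V.valuation_eq_one_iff, ← IsLocalRing.notMem_maximalIdeal, ← IsLocalRing.residue_eq_zero_iff,
      hres]
    exact neg_ne_zero.mpr one_ne_zero
  rw [hg, map_mul, hunit, one_mul]

theorem gauss_frob' (p : ℕ) [Fact p.Prime] {F : Type*} [Field F] [Fintype F] [Algebra (ZMod p) F]
    (χ : MulChar F ℂ) : gaussSum (χ ^ p) (psiF p F) = gaussSum χ (psiF p F) := by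
  have hp : p.Prime := Fact.out
  have : CharP F p := (Algebra.charP_iff (ZMod p) F p).mp inferInstance
  have hb : Function.Bijective (frobenius F p) := (Finite.injective_iff_bijective).mp (frobenius_inj F p)
  conv_rhs => rw [gaussSum, ← hb.sum_comp]
  rw [gaussSum]
  apply Finset.sum_congr rfl
  intro x _
  rw [frobenius_def, psiF_frob, MulChar.pow_apply' _ hp.ne_zero, map_pow]

theorem gauss_isIntegral {F : Type*} [Field F] [Fintype F]
    (χ : MulChar F ℂ) (ψ : AddChar F ℂ) : IsIntegral ℤ (gaussSum χ ψ) := by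
  classical
  rw [gaussSum]
  apply IsIntegral.sum
  intro x _
  apply IsIntegral.mul
  · by_cases hx : x = 0
    · subst hx; rw [MulChar.map_zero]; exact isIntegral_zero
    · have h1 : (χ x) ^ (Fintype.card F - 1) = 1 := by
        rw [← map_pow, FiniteField.pow_card_sub_one_eq_one x hx, map_one]
      have hpos : 0 < Fintype.card F - 1 := by have := Fintype.one_lt_card (α := F); omega
      exact IsIntegral.of_pow hpos (by rw [h1]; exact isIntegral_one)
  · have hpos : 0 < Fintype.card F := Fintype.card_pos
    refine IsIntegral.of_pow hpos ?_
    rw [← AddChar.map_nsmul_eq_pow, card_nsmul_eq_zero, AddChar.map_zero_eq_one]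
    exact isIntegral_one

theorem mulchar_isIntegral {F : Type*} [Field F] [Fintype F]
    (χ : MulChar F ℂ) (x : F) : IsIntegral ℤ (χ x) := by
  classical
  by_cases hx : x = 0
  · subst hx; rw [MulChar.map_zero]; exact isIntegral_zero
  · have h1 : (χ x) ^ (Fintype.card F - 1) = 1 := by
      rw [← map_pow, FiniteField.pow_card_sub_one_eq_one x hx, map_one]
    have hpos : 0 < Fintype.card F - 1 := by have := Fintype.one_lt_card (α := F); omega
    exact IsIntegral.of_pow hpos (by rw [h1]; exact isIntegral_one)

theorem jacobi_isIntegral {F : Type*} [Field F] [Fintype F]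
    (χ φ : MulChar F ℂ) : IsIntegral ℤ (jacobiSum χ φ) := by
  rw [jacobiSum]
  exact IsIntegral.sum _ fun x _ => (mulchar_isIntegral _ _).mul (mulchar_isIntegral _ _)

theorem teich_pow_ne (V : ValuationSubring ℂ) {F : Type*} [Field F] [Fintype F]
    (γ : Fˣ) (hγ : ∀ x : Fˣ, x ∈ Subgroup.zpowers γ)
    (ι : F →+* IsLocalRing.ResidueField V) (ω : MulChar F ℂ)
    (hω : ∀ x : F, ∃ h : ω x ∈ V, IsLocalRing.residue V ⟨ω x, h⟩ = ι x) :
    orderOf (ω γ) = Fintype.card F - 1 := by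
  classical
  have hog : orderOf γ = Fintype.card F - 1 := by
    rw [orderOf_eq_card_of_forall_mem_zpowers hγ, Nat.card_eq_fintype_card, Fintype.card_units]
  apply Nat.dvd_antisymm
  · apply orderOf_dvd_of_pow_eq_one
    rw [← map_pow, FiniteField.pow_card_sub_one_eq_one _ γ.ne_zero, map_one]
  · rw [← hog]
    apply orderOf_dvd_of_pow_eq_one
    have h1 := pow_orderOf_eq_one (ω γ)
    obtain ⟨h, h2⟩ := hω γ
    have h3 : (⟨ω γ, h⟩ : V) ^ orderOf (ω γ) = 1 := Subtype.ext h1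
    have h4 := congrArg (IsLocalRing.residue V) h3
    rw [map_pow, h2, map_one, ← map_pow, ← map_one ι] at h4
    ext
    simpa using ι.injective h4

theorem stick_ge (p : ℕ) [Fact p.Prime] (V : ValuationSubring ℂ) (hpV : (p : ℂ) ∈ V.nonunits)
    (hV : ∀ z : ℂ, IsIntegral ℤ z → z ∈ V)
    {F : Type*} [Field F] [Fintype F] [Algebra (ZMod p) F] (f : ℕ) (hf : f ≠ 0)
    (hcard : Fintype.card F = p ^ f) (hq : 2 < p ^ f)
    (γ : Fˣ) (hγ : ∀ x : Fˣ, x ∈ Subgroup.zpowers γ)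
    (ι : F →+* IsLocalRing.ResidueField V) (ω : MulChar F ℂ)
    (hω : ∀ x : F, ∃ h : ω x ∈ V, IsLocalRing.residue V ⟨ω x, h⟩ = ι x) (a : ℕ) (ha : a < p ^ f - 1) :
    V.valuation (zetaP p - 1) ^ (Nat.digits p a).sum ≤ V.valuation (gaussSum (ω⁻¹ ^ a) (psiF p F)) := by
  have hp : p.Prime := Fact.out
  have hord := teich_pow_ne V γ hγ ι ω hω
  rw [hcard] at hord
  have hne : ∀ a, 0 < a → a < p ^ f - 1 → ω⁻¹ ^ a ≠ 1 := by
    intro a h1 h2 h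
    rw [inv_pow, inv_eq_one] at h
    have h3 : (ω ^ a) γ = 1 := by rw [h, MulChar.one_apply_coe]
    rw [MulChar.pow_apply_coe] at h3
    have := Nat.le_of_dvd h1 (orderOf_dvd_of_pow_eq_one h3)
    omega
  have hψ1 : psiF p F ≠ 1 := by
    have := psiF_prim p F
    intro h
    have := this one_ne_zero
    rw [h] at this
    exact this (by ext; simp [AddChar.mulShift_apply])
  induction a using Nat.strong_induction_on with
  | _ a ih =>
    rcases Nat.eq_zero_or_pos a with rfl | ha0
    · simp only [Nat.digits_zero, List.sum_nil, pow_zero]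
      rw [gaussSum_one_left hψ1, Valuation.map_neg, map_one]
    · by_cases hr : a % p = 0
      · have hdiv : a = (a / p) * p := (Nat.div_mul_cancel (Nat.dvd_of_mod_eq_zero hr)).symm
        have hlt : a / p < a := Nat.div_lt_self ha0 hp.one_lt
        have := ih (a / p) hlt (by omega)
        rw [digsum_div p hp.one_lt, hr, zero_add]
        conv_rhs => rw [hdiv, pow_mul, gauss_frob']
        exact this
      · have h1 := ih (a - 1) (by omega) (by omega)
        have hs : (Nat.digits p a).sum = (Nat.digits p (a - 1)).sum + 1 := by
          rw [digsum_div p hp.one_lt a, digsum_div p hp.one_lt (a - 1)]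
          have e1 := Nat.div_add_mod a p
          have e2 : a - 1 = p * (a / p) + (a % p - 1) := by omega
          have e3 : a % p < p := Nat.mod_lt _ hp.pos
          have e4 : (a - 1) % p = a % p - 1 := by
            rw [e2, Nat.mul_add_mod, Nat.mod_eq_of_lt (by omega)]
          have e5 : (a - 1) / p = a / p := by
            clear h1 ih
            generalize a / p = m at *
            rw [e2, Nat.mul_add_div hp.pos, Nat.div_eq_of_lt (by omega), add_zero]
          rw [e4, e5]; omega
        have h2 := val_gauss_teich p V hpV hV f hf hcard hq ι ω hω
          (by simpa using hne 1 one_pos (by omega))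
        have hmul : ω⁻¹ ^ (a - 1) * ω⁻¹ = ω⁻¹ ^ a := by
          rw [← pow_succ]; congr 1; omega
        have h3 := jacobiSum_mul_nontrivial (χ := ω⁻¹ ^ (a - 1)) (φ := ω⁻¹)
          (by rw [hmul]; exact hne a ha0 ha) (psiF p F)
        rw [hmul] at h3
        have h4 := congrArg V.valuation h3
        rw [map_mul, map_mul, h2] at h4
        have h5 : V.valuation (jacobiSum (ω⁻¹ ^ (a - 1)) ω⁻¹) ≤ 1 := by
          rw [V.valuation_le_one_iff]; exact hV _ (jacobi_isIntegral _ _)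
        rw [hs, pow_succ]
        calc _ ≤ V.valuation (gaussSum (ω⁻¹ ^ (a - 1)) (psiF p F)) * V.valuation (zetaP p - 1) := by gcongr
          _ = _ := h4.symm
          _ ≤ _ := mul_le_of_le_one_right' h5

theorem stick_le (p : ℕ) [Fact p.Prime] (V : ValuationSubring ℂ) (hpV : (p : ℂ) ∈ V.nonunits)
    (hV : ∀ z : ℂ, IsIntegral ℤ z → z ∈ V)
    {F : Type*} [Field F] [Fintype F] [Algebra (ZMod p) F] (f : ℕ) (hf : f ≠ 0)
    (hcard : Fintype.card F = p ^ f) (hq : 2 < p ^ f)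
    (γ : Fˣ) (hγ : ∀ x : Fˣ, x ∈ Subgroup.zpowers γ)
    (ι : F →+* IsLocalRing.ResidueField V) (ω : MulChar F ℂ)
    (hω : ∀ x : F, ∃ h : ω x ∈ V, IsLocalRing.residue V ⟨ω x, h⟩ = ι x) (a : ℕ) (ha : a < p ^ f - 1)
    (ha0 : 0 < a) :
    V.valuation (gaussSum (ω⁻¹ ^ a) (psiF p F)) ≤ V.valuation (zetaP p - 1) ^ (Nat.digits p a).sum := by
  have hp : p.Prime := Fact.out
  have hord := teich_pow_ne V γ hγ ι ω hω
  rw [hcard] at hord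
  have h1 := stick_ge p V hpV hV f hf hcard hq γ hγ ι ω hω (p ^ f - 1 - a) (by omega)
  have hne : ω⁻¹ ^ a ≠ 1 := by
    intro h
    rw [inv_pow, inv_eq_one] at h
    have h3 : (ω ^ a) γ = 1 := by rw [h, MulChar.one_apply_coe]
    rw [MulChar.pow_apply_coe] at h3
    have := Nat.le_of_dvd ha0 (orderOf_dvd_of_pow_eq_one h3)
    omega
  have hinv : ω⁻¹ ^ (p ^ f - 1 - a) = (ω⁻¹ ^ a)⁻¹ := by
    apply eq_inv_of_mul_eq_one_left
    rw [← pow_add, show p ^ f - 1 - a + a = p ^ f - 1 by omega, inv_pow, inv_eq_one,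
      MulChar.eq_iff hγ, MulChar.pow_apply_coe, MulChar.one_apply_coe, ← hord, pow_orderOf_eq_one]
  have h2 := gaussSum_mul_gaussSum_eq_card hne (psiF_prim p F)
  have h3 := mul_gaussSum_inv_eq_gaussSum ((ω⁻¹ ^ a)⁻¹) (psiF p F)
  have hv1 : V.valuation ((ω⁻¹ ^ a)⁻¹ (-1)) = 1 := by
    have : ((ω⁻¹ ^ a)⁻¹ (-1)) ^ 2 = 1 := by rw [← map_pow]; simp
    have h4 := congrArg V.valuation this
    rw [map_pow, map_one] at h4
    exact (pow_eq_one_iff_of_nonneg zero_le' two_ne_zero).mp h4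
  have h4 := congrArg V.valuation h2
  have h5 := congrArg V.valuation h3
  rw [map_mul, hv1, one_mul] at h5
  rw [map_mul, h5, hcard, Nat.cast_pow, map_pow, val_p p V hV, ← pow_mul, mul_comm (p - 1),
    ← digsum_reflect p f a hp.one_lt ha ha0, pow_add, ← hinv] at h4
  have hpi : V.valuation (zetaP p - 1) ≠ 0 := by
    rw [ne_eq, map_eq_zero, sub_eq_zero]
    exact (zetaP_prim p).ne_one hp.one_lt
  have hpos : 0 < V.valuation (zetaP p - 1) ^ (Nat.digits p (p ^ f - 1 - a)).sum :=
    pow_pos (zero_lt_iff.mpr hpi) _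
  refine le_of_mul_le_mul_right ?_ hpos
  rw [← h4]
  gcongr

theorem stick_main (p : ℕ) [Fact p.Prime] (V : ValuationSubring ℂ) (hpV : (p : ℂ) ∈ V.nonunits)
    (hV : ∀ z : ℂ, IsIntegral ℤ z → z ∈ V)
    {F : Type*} [Field F] [Fintype F] [Algebra (ZMod p) F] (f : ℕ) (hf : f ≠ 0)
    (hcard : Fintype.card F = p ^ f) (hq : 2 < p ^ f)
    (γ : Fˣ) (hγ : ∀ x : Fˣ, x ∈ Subgroup.zpowers γ) (N e' : ℕ) (hN : 1 < N)
    (hbound : ∀ t : ℕ, t.Coprime N → N * e' ≤ ∑ i ∈ Finset.range f, (p ^ i * t) % N)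
    (χ : MulChar F ℂ) (hχ : orderOf (χ γ) = N) :
    V.valuation (gaussSum χ (psiF p F)) ≤ V.valuation (p : ℂ) ^ e' := by
  have hp : p.Prime := Fact.out
  obtain ⟨ι, ω, hω⟩ := exists_teich p hp V hpV hV f hf hcard γ hγ
  have hord := teich_pow_ne V γ hγ ι ω hω
  rw [hcard] at hord
  have hq1 : 0 < p ^ f - 1 := by omega
  have : NeZero (p ^ f - 1) := ⟨hq1.ne'⟩
  have hprim : IsPrimitiveRoot (ω⁻¹ γ) (p ^ f - 1) := by
    rw [MulChar.inv_apply_eq_inv']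
    exact (IsPrimitiveRoot.iff_orderOf.mpr hord).inv
  obtain ⟨a, ha, hχa⟩ := hprim.eq_pow_of_pow_eq_one (ξ := χ γ) (by
    rw [← map_pow, ← hcard, FiniteField.pow_card_sub_one_eq_one _ γ.ne_zero, map_one])
  have hχa' : χ = ω⁻¹ ^ a := by
    rw [MulChar.eq_iff hγ, MulChar.pow_apply_coe, hχa]
  have ha0 : 0 < a := by
    rcases Nat.eq_zero_or_pos a with rfl | h
    · rw [← hχa] at hχ; simp at hχ; omega
    · exact h
  rw [← hχa, orderOf_pow' _ ha0.ne', ← hprim.eq_orderOf] at hχ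
  set M := (p ^ f - 1).gcd a with hM
  have hM0 : 0 < M := Nat.gcd_pos_of_pos_right _ ha0
  obtain ⟨t, hat⟩ : M ∣ a := Nat.gcd_dvd_right _ _
  have hMq : M ∣ p ^ f - 1 := Nat.gcd_dvd_left _ _
  have hqMN : p ^ f - 1 = M * N := by rw [← hχ, Nat.mul_div_cancel' hMq]
  have htN : t.Coprime N := by
    have := Nat.coprime_div_gcd_div_gcd (m := p ^ f - 1) (n := a) hM0
    rw [← hM, hχ, hat, Nat.mul_div_cancel_left _ hM0] at this
    exact this.symm
  have hσ := sigma_eq p f a hp.one_lt ha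
  have hσ2 : ∑ i ∈ Finset.range f, (p ^ i * a) % (p ^ f - 1) =
      M * ∑ i ∈ Finset.range f, (p ^ i * t) % N := by
    rw [Finset.mul_sum]
    apply Finset.sum_congr rfl
    intro i _
    rw [hqMN, hat, ← Nat.mul_mod_mul_left]
    congr 1; ring
  have hs : (p - 1) * e' ≤ (Nat.digits p a).sum := by
    apply Nat.le_of_mul_le_mul_left _ hq1
    rw [← hσ, hσ2]
    calc (p ^ f - 1) * ((p - 1) * e') = (p - 1) * (M * (N * e')) := by rw [hqMN]; ring
      _ ≤ _ := by gcongr; exact hbound t htN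
  rw [hχa', val_p p V hV, ← pow_mul]
  refine (stick_le p V hpV hV f hf hcard hq γ hγ ι ω hω a ha ha0).trans ?_
  refine pow_le_pow_right_of_le_one' ?_ hs
  rw [V.valuation_le_one_iff]
  exact sub_mem (hV _ ((zetaP_prim p).isIntegral hp.pos)) (one_mem _)

theorem primroot_cover (M p : ℕ) (hM : 0 < M) (hpM : p.Coprime M)
    (hord : orderOf (p : ZMod M) = Nat.totient M) (t : ℕ) (ht : t.Coprime M) :
    ∃ i : ℕ, t ≡ p ^ i [MOD M] := by
  have : NeZero M := ⟨hM.ne'⟩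
  have h1 : orderOf (ZMod.unitOfCoprime p hpM) = Nat.card (ZMod M)ˣ := by
    rw [← orderOf_units, ZMod.coe_unitOfCoprime, hord, Nat.card_eq_fintype_card, ZMod.card_units_eq_totient]
  have h2 : Subgroup.zpowers (ZMod.unitOfCoprime p hpM) = ⊤ := by
    rw [← Subgroup.card_eq_iff_eq_top, Nat.card_zpowers, h1]
  have h3 : ZMod.unitOfCoprime t ht ∈ Subgroup.zpowers (ZMod.unitOfCoprime p hpM) := by
    rw [h2]; trivial
  rw [← mem_powers_iff_mem_zpowers] at h3
  obtain ⟨i, hi⟩ := h3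
  refine ⟨i, ?_⟩
  rw [← ZMod.natCast_eq_natCast_iff]
  have := congrArg Units.val hi
  simp at this
  push_cast
  exact this.symm

theorem coprime_of_orderOf (M p : ℕ) (hM : 0 < M)
    (hord : orderOf (p : ZMod M) = Nat.totient M) : p.Coprime M := by
  rw [← ZMod.isUnit_iff_coprime]
  have h1 := pow_orderOf_eq_one (p : ZMod M)
  rw [hord] at h1
  exact IsUnit.of_pow_eq_one h1 (Nat.totient_pos.mpr hM).ne'

theorem jac_primroot (p l m : ℕ) (hl : l.Prime) (hl2 : l ≠ 2) (hm : 1 ≤ m)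
    (hord : orderOf (p : ZMod (l ^ m)) = Nat.totient (l ^ m)) : jacobiSym p l = -1 := by
  have : Fact l.Prime := ⟨hl⟩
  have hpM := coprime_of_orderOf (l ^ m) p (pow_pos hl.pos _) hord
  obtain ⟨a, ha⟩ := exists_jac_neg_one l hl2
  have hal : a.Coprime l := by
    by_contra h
    have := jacobiSym.eq_zero_iff_not_coprime (a := a) (b := l) |>.mpr (by rwa [Int.gcd_natCast_natCast])
    omega
  obtain ⟨i, hi⟩ := primroot_cover (l ^ m) p (pow_pos hl.pos _) hpM hord a (hal.pow_right m)
  have hi2 : a ≡ p ^ i [MOD l] := hi.of_dvd (dvd_pow_self l (by omega))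
  have h1 : jacobiSym a l = jacobiSym p l ^ i := by
    rw [jacobiSym.mod_left, show ((a : ℤ) % l) = (p ^ i : ℕ) % l by exact_mod_cast hi2, ← jacobiSym.mod_left]
    push_cast; rw [jacobiSym.pow_left]
  have hpl : p.Coprime l := Nat.Coprime.coprime_dvd_right (dvd_pow_self l (by omega)) hpM
  rcases jacobiSym.eq_one_or_neg_one (a := p) (b := l) (by rwa [Int.gcd_natCast_natCast]) with h | h
  · rw [h, one_pow] at h1; omega
  · exact h

theorem coset_cover (N d f p : ℕ) (hN0 : 0 < N) (hdN : d ∣ N) (hd4 : d % 4 = 3)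
    (hJp : jacobiSym p d = 1) (hpN : p.Coprime N) (hf : f = orderOf (p : ZMod N))
    (hford : 2 * f = Nat.totient N) (t : ℕ) (ht : t.Coprime N) :
    (jacobiSym t d = 1 ∧ ∃ i, t ≡ p ^ i [MOD N]) ∨ (jacobiSym t d = -1 ∧ ∃ i, N ∣ t + p ^ i) := by
  have : NeZero N := ⟨hN0.ne'⟩
  have hJ : ∀ i, jacobiSym ((p ^ i : ℕ) : ℤ) d = 1 := by
    intro i; push_cast; rw [jacobiSym.pow_left, hJp, one_pow]
  have hJm : ∀ x i, N ∣ x + p ^ i → jacobiSym (x : ℤ) d = -1 := by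
    intro x i hx
    have h1 : (x : ℤ) % d = (-1 * ((p ^ i : ℕ) : ℤ)) % d := by
      apply Int.ModEq.symm
      rw [Int.modEq_iff_dvd]
      have : (d : ℤ) ∣ ((x + p ^ i : ℕ) : ℤ) := by exact_mod_cast hdN.trans hx
      convert this using 1
      push_cast; ring
    rw [jacobiSym.mod_left, h1, ← jacobiSym.mod_left, jacobiSym.mul_left, hJ, mul_one,
      jacobiSym.at_neg_one (by rw [Nat.odd_iff]; omega), ZMod.χ₄_nat_three_mod_four hd4]
  have hJ1 : ∀ x i, x ≡ p ^ i [MOD N] → jacobiSym (x : ℤ) d = 1 := by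
    intro x i hx
    have := hx.of_dvd hdN
    rw [jacobiSym.mod_left, show ((x : ℤ) % d) = (p ^ i : ℕ) % d by exact_mod_cast this,
      ← jacobiSym.mod_left, hJ]
  set u := ZMod.unitOfCoprime p hpN with hu
  have hou : orderOf u = f := by rw [hf, ← orderOf_units, hu, ZMod.coe_unitOfCoprime]
  have hf0 : 0 < f := by rw [← hou]; exact orderOf_pos u
  have hidx : (Subgroup.zpowers u).index = 2 := by
    have h1 := (Subgroup.zpowers u).card_mul_index
    rw [Nat.card_zpowers, hou, Nat.card_eq_fintype_card, ZMod.card_units_eq_totient, ← hford, mul_comm] at h1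
    exact Nat.eq_of_mul_eq_mul_right hf0 h1
  have hneg : (-1 : (ZMod N)ˣ) ∉ Subgroup.zpowers u := by
    rw [← mem_powers_iff_mem_zpowers]
    rintro ⟨i, hi⟩
    have h1 := congrArg Units.val hi
    simp [hu] at h1
    have h2 : N ∣ 1 + p ^ i := by
      rw [← ZMod.natCast_eq_zero_iff]; push_cast; rw [h1]; ring
    have := hJm 1 i h2
    simp at this
  have hiff := Subgroup.mul_mem_iff_of_index_two hidx (a := -1) (b := ZMod.unitOfCoprime t ht)
  by_cases hm : ZMod.unitOfCoprime t ht ∈ Subgroup.zpowers u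
  · left
    rw [← mem_powers_iff_mem_zpowers] at hm
    obtain ⟨i, hi⟩ := hm
    have h1 := congrArg Units.val hi
    simp [hu] at h1
    have h2 : t ≡ p ^ i [MOD N] := by
      rw [← ZMod.natCast_eq_natCast_iff]; push_cast; exact h1.symm
    exact ⟨hJ1 t i h2, i, h2⟩
  · right
    have hm2 := hiff.mpr (by simp [hneg, hm])
    rw [← mem_powers_iff_mem_zpowers] at hm2
    obtain ⟨i, hi⟩ := hm2
    have h1 := congrArg Units.val hi
    simp [hu] at h1
    have h2 : N ∣ t + p ^ i := by
      rw [← ZMod.natCast_eq_zero_iff]; push_cast; rw [h1]; ring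
    exact ⟨hJm t i h2, i, h2⟩

theorem val_root_sub_one (l : ℕ) (hl : l.Prime) (V : ValuationSubring ℂ) (hlV : (l : ℂ) ∈ V.nonunits)
    (hV : ∀ z : ℂ, IsIntegral ℤ z → z ∈ V) (k : ℕ) (z : ℂ) (hz : z ^ (l ^ k) = 1) :
    V.valuation (z - 1) < 1 := by
  have : Fact l.Prime := ⟨hl⟩
  have hzi : z ∈ V := hV z (IsIntegral.of_pow (pow_pos hl.pos k) (by rw [hz]; exact isIntegral_one))
  have hl0 : ((l : ℕ) : IsLocalRing.ResidueField V) = 0 := by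
    have h1 : (⟨(l : ℂ), natCast_mem V l⟩ : V) ∈ IsLocalRing.maximalIdeal V := by
      rw [IsLocalRing.mem_maximalIdeal]
      have := (V.valuation_lt_one_iff ⟨(l : ℂ), natCast_mem V l⟩).mpr (by
        rw [ValuationSubring.mem_nonunits_iff] at hlV; exact hlV)
      exact this
    have h2 := (IsLocalRing.residue_eq_zero_iff _).mpr h1
    have h3 : (⟨(l : ℂ), natCast_mem V l⟩ : V) = ((l : ℕ) : V) := Subtype.ext (by simp)
    rw [h3, map_natCast] at h2
    exact h2
  have hrc := CharP.ringChar_of_prime_eq_zero hl hl0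
  have : CharP (IsLocalRing.ResidueField V) l := by rw [← hrc]; infer_instance
  have h4 : (⟨z, hzi⟩ : V) ^ (l ^ k) = 1 := Subtype.ext hz
  have h5 := congrArg (IsLocalRing.residue V) h4
  rw [map_pow, map_one] at h5
  have h6 : (IsLocalRing.residue V ⟨z, hzi⟩ - 1) ^ (l ^ k) = 0 := by
    rw [sub_pow_char_pow, h5, one_pow, sub_self]
  have h7 := eq_zero_of_pow_eq_zero h6
  rw [← map_one (IsLocalRing.residue V), ← map_sub, IsLocalRing.residue_eq_zero_iff,
    V.valuation_lt_one_iff] at h7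
  exact h7

theorem gauss_cong (l : ℕ) (hl : l.Prime) (V : ValuationSubring ℂ) (hlV : (l : ℂ) ∈ V.nonunits)
    (hV : ∀ z : ℂ, IsIntegral ℤ z → z ∈ V) (k : ℕ) {F : Type*} [Field F] [Fintype F]
    (ψ : AddChar F ℂ) (χ φ : MulChar F ℂ) (hφ : φ ^ (l ^ k) = 1) :
    V.valuation (gaussSum (χ * φ) ψ - gaussSum χ ψ) < 1 := by
  have h0 : gaussSum (χ * φ) ψ - gaussSum χ ψ = ∑ x, χ x * (φ x - 1) * ψ x := by
    rw [gaussSum, gaussSum, ← Finset.sum_sub_distrib]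
    refine Finset.sum_congr rfl fun x _ => ?_
    rw [MulChar.mul_apply]; ring
  rw [h0]
  refine Valuation.map_sum_lt _ one_ne_zero fun x _ => ?_
  by_cases hx : x = 0
  · subst hx; rw [MulChar.map_zero]; simp
  · have h1 : φ x ^ (l ^ k) = 1 := by
      rw [← MulChar.pow_apply' _ (pow_pos hl.pos k).ne', hφ, MulChar.one_apply (Ne.isUnit hx)]
    have h2 := val_root_sub_one l hl V hlV hV k _ h1
    have h3 : V.valuation (χ x) ≤ 1 := by
      rw [V.valuation_le_one_iff]; exact hV _ (mulchar_isIntegral _ _)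
    have h4 : V.valuation (ψ x) ≤ 1 := by
      rw [V.valuation_le_one_iff]
      apply hV
      have hpos : 0 < Fintype.card F := Fintype.card_pos
      refine IsIntegral.of_pow hpos ?_
      rw [← AddChar.map_nsmul_eq_pow, card_nsmul_eq_zero, AddChar.map_zero_eq_one]
      exact isIntegral_one
    rw [map_mul, map_mul]
    calc _ ≤ 1 * V.valuation (φ x - 1) * 1 := by gcongr
      _ < 1 := by simpa using h2

theorem dvd_of_val_lt (l : ℕ) (hl : l.Prime) (V : ValuationSubring ℂ) (hlV : (l : ℂ) ∈ V.nonunits)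
    (z : ℤ) (hz : V.valuation (z : ℂ) < 1) : (l : ℤ) ∣ z := by
  by_contra h
  have hc : IsCoprime (l : ℤ) z := (Nat.prime_iff_prime_int.mp hl).coprime_iff_not_dvd.mpr h
  obtain ⟨a, b, hab⟩ := hc
  have hab' : (a : ℂ) * l + b * z = 1 := by exact_mod_cast hab
  have h1 : V.valuation ((a : ℂ) * l + b * z) < 1 := by
    apply Valuation.map_add_lt
    · rw [map_mul]
      have : V.valuation (a : ℂ) ≤ 1 := by
        rw [V.valuation_le_one_iff]; exact intCast_mem V a
      rw [ValuationSubring.mem_nonunits_iff] at hlV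
      exact (mul_le_of_le_one_left' this).trans_lt hlV
    · rw [map_mul]
      have : V.valuation (b : ℂ) ≤ 1 := by
        rw [V.valuation_le_one_iff]; exact intCast_mem V b
      exact (mul_le_of_le_one_left' this).trans_lt hz
  rw [hab', map_one] at h1
  exact lt_irrefl _ h1

theorem psiF_ne_one (p : ℕ) [Fact p.Prime] (F : Type*) [Field F] [Fintype F] [Algebra (ZMod p) F] :
    psiF p F ≠ 1 := by
  intro h
  have := psiF_prim p F one_ne_zero
  rw [h] at this
  exact this (by ext; simp [AddChar.mulShift_apply])

theorem gauss_frob_pow (p : ℕ) [Fact p.Prime] {F : Type*} [Field F] [Fintype F] [Algebra (ZMod p) F]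
    (χ : MulChar F ℂ) (i : ℕ) : gaussSum (χ ^ (p ^ i)) (psiF p F) = gaussSum χ (psiF p F) := by
  induction i with
  | zero => simp
  | succ i ih => rw [pow_succ, pow_mul, gauss_frob', ih]

theorem gauss_mul_inv (p : ℕ) [Fact p.Prime] {F : Type*} [Field F] [Fintype F] [Algebra (ZMod p) F]
    (χ : MulChar F ℂ) (hχ : χ ≠ 1) (h1 : χ (-1) = 1) :
    gaussSum χ (psiF p F) * gaussSum χ⁻¹ (psiF p F) = Fintype.card F := by
  have h2 := gaussSum_mul_gaussSum_eq_card hχ (psiF_prim p F)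
  have h3 := mul_gaussSum_inv_eq_gaussSum (χ⁻¹) (psiF p F)
  rw [MulChar.inv_apply_eq_inv', h1, inv_one, one_mul] at h3
  rw [← h3, h2]

theorem gauss_pure (p : ℕ) [Fact p.Prime] {F : Type*} [Field F] [Fintype F] [Algebra (ZMod p) F]
    (l k : ℕ) (hl : l.Prime) (hl2 : l ≠ 2) (χ : MulChar F ℂ) (hχ : χ ^ (l ^ k) = 1) (hχ1 : χ ≠ 1)
    (hneg : χ (-1) = 1) (i : ℕ) (hi : l ^ k ∣ p ^ i + 1) (S : ℤ)
    (hS : (Fintype.card F : ℤ) = S ^ 2) (hmod : (l : ℤ) ∣ S + 1) :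
    gaussSum χ (psiF p F) = S := by
  obtain ⟨V, hlV, hV⟩ := exists_val l hl
  have h1 : χ ^ (p ^ i) = χ⁻¹ := by
    apply eq_inv_of_mul_eq_one_left
    rw [← pow_succ]
    obtain ⟨c, hc⟩ := hi
    rw [hc, pow_mul, hχ, one_pow]
  have h2 := gauss_mul_inv p χ hχ1 hneg
  rw [← h1, gauss_frob_pow] at h2
  have hS' : (Fintype.card F : ℂ) = (S : ℂ) ^ 2 := by exact_mod_cast congrArg (Int.cast : ℤ → ℂ) hS
  rw [hS', ← pow_two] at h2
  rcases sq_eq_sq_iff_eq_or_eq_neg.mp h2 with h | h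
  · exact h
  · exfalso
    have h3 := gauss_cong l hl V hlV hV k (psiF p F) 1 χ hχ
    rw [one_mul, h, gaussSum_one_left (psiF_ne_one p F)] at h3
    have h4 := dvd_of_val_lt l hl V hlV (-S - -1) (by push_cast; exact h3)
    have h5 : (l : ℤ) ∣ 2 := by
      have := dvd_add hmod h4
      rwa [show S + 1 + (-S - -1) = 2 by ring] at this
    have h6 : l ∣ 2 := by exact_mod_cast h5
    exact hl2 ((Nat.prime_dvd_prime_iff_eq hl Nat.prime_two).mp h6)

theorem mulchar_zpow {F : Type*} [Field F] (θ : MulChar F ℂ) (γ : Fˣ) (z : ℤ) :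
    θ ((γ ^ z : Fˣ) : F) = (θ γ) ^ z := by
  rw [← MulChar.coe_toUnitHom, map_zpow, Units.val_zpow_eq_zpow_val, MulChar.coe_toUnitHom]

theorem mem_cycClass {F : Type*} [Field F] [Fintype F] (γ : Fˣ)
    (hγ : ∀ x : Fˣ, x ∈ Subgroup.zpowers γ) (N : ℕ) (ζ : ℂ) (hζ : IsPrimitiveRoot ζ N)
    (θ : MulChar F ℂ) (hθ : θ γ = ζ⁻¹) (hN : 0 < N) (c : ℕ) (x : Fˣ) :
    (x : F) ∈ cycClass γ N c ↔ θ x * ζ ^ c = 1 := by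
  have hζ0 : ζ ≠ 0 := hζ.ne_zero hN.ne'
  constructor
  · rintro ⟨k, hk⟩
    rw [hk, mulchar_zpow, hθ, ← zpow_natCast ζ c, inv_zpow', ← zpow_add₀ hζ0,
      hζ.zpow_eq_one_iff_dvd]
    exact ⟨-k, by ring⟩
  · intro h
    obtain ⟨z, rfl⟩ := hγ x
    simp only at h ⊢
    rw [mulchar_zpow, hθ, ← zpow_natCast ζ c, inv_zpow', ← zpow_add₀ hζ0,
      hζ.zpow_eq_one_iff_dvd] at h
    obtain ⟨k, hk⟩ := h
    refine ⟨-k, ?_⟩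
    congr 2
    linarith

open scoped Classical in
theorem ind_cycClass {F : Type*} [Field F] [Fintype F] (γ : Fˣ)
    (hγ : ∀ x : Fˣ, x ∈ Subgroup.zpowers γ) (N : ℕ) (ζ : ℂ) (hζ : IsPrimitiveRoot ζ N)
    (θ : MulChar F ℂ) (hθ : θ γ = ζ⁻¹) (hN : 0 < N) (c : ℕ) (x : F) :
    ∑ t ∈ Finset.range N, (θ ^ t) x * ζ ^ (t * c) = if x ∈ cycClass γ N c then (N : ℂ) else 0 := by
  by_cases hx : x = 0
  · subst hx
    rw [if_neg, Finset.sum_eq_zero]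
    · intro t _; rw [MulChar.map_zero, zero_mul]
    · rintro ⟨k, hk⟩; exact (Units.ne_zero _) hk.symm
  · obtain ⟨u, rfl⟩ : ∃ u : Fˣ, (u : F) = x := ⟨Units.mk0 x hx, rfl⟩
    have h1 : ∀ t ∈ Finset.range N, (θ ^ t) (u : F) * ζ ^ (t * c) = (θ u * ζ ^ c) ^ t := by
      intro t _
      rw [MulChar.pow_apply_coe, mul_pow, ← pow_mul, mul_comm c t]
    rw [Finset.sum_congr rfl h1]
    have h2 := mem_cycClass γ hγ N ζ hζ θ hθ hN c u
    by_cases h3 : θ u * ζ ^ c = 1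
    · rw [if_pos (h2.mpr h3), h3]; simp
    · rw [if_neg (fun h => h3 (h2.mp h))]
      have h4 : (θ u * ζ ^ c) ^ N = 1 := by
        obtain ⟨z, rfl⟩ := hγ u
        simp only
        have h6 : (ζ⁻¹ ^ z) ^ N = 1 := by
          rw [← zpow_natCast (ζ⁻¹ ^ z), zpow_comm, zpow_natCast, inv_pow, hζ.pow_eq_one, inv_one, one_zpow]
        rw [mul_pow, mulchar_zpow, hθ, ← pow_mul, mul_comm c N, pow_mul, hζ.pow_eq_one, one_pow,
          h6, one_mul]
      have h5 := mul_neg_geom_sum (θ u * ζ ^ c) N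
      rw [h4, sub_self] at h5
      exact (mul_eq_zero.mp h5).resolve_left (sub_ne_zero.mpr (Ne.symm h3))

open scoped Classical in
theorem ind_D {F : Type*} [Field F] [Fintype F] (γ : Fˣ)
    (hγ : ∀ x : Fˣ, x ∈ Subgroup.zpowers γ) (N : ℕ) (ζ : ℂ) (hζ : IsPrimitiveRoot ζ N)
    (θ : MulChar F ℂ) (hθ : θ γ = ζ⁻¹) (M₁ M₂ K₁ K₂ : ℕ) (hN : N = M₁ * M₂) (hM₁ : 0 < M₁) (hM₂ : 0 < M₂)
    (hcop : M₁.Coprime M₂) (hK₁ : K₁ ≤ M₁) (hK₂ : K₂ ≤ M₂)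
    (D : Set F) (hD : D = ⋃ i < K₁, ⋃ j < K₂, cycClass γ N (M₂ * i + M₁ * j)) (x : F) :
    ∑ i ∈ Finset.range K₁, ∑ j ∈ Finset.range K₂, ∑ t ∈ Finset.range N,
      (θ ^ t) x * ζ ^ (t * (M₂ * i + M₁ * j)) = if x ∈ D then (N : ℂ) else 0 := by
  have hN0 : 0 < N := by rw [hN]; positivity
  simp_rw [ind_cycClass γ hγ N ζ hζ θ hθ hN0]
  have hmem : x ∈ D ↔ ∃ i < K₁, ∃ j < K₂, x ∈ cycClass γ N (M₂ * i + M₁ * j) := by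
    rw [hD]; simp
  by_cases hx : x ∈ D
  · rw [if_pos hx]
    obtain ⟨i, hi, j, hj, hij⟩ := hmem.mp hx
    have huniq : ∀ i' < K₁, ∀ j' < K₂, x ∈ cycClass γ N (M₂ * i' + M₁ * j') → i' = i ∧ j' = j := by
      intro i' hi' j' hj' hij'
      have hx0 : x ≠ 0 := by
        obtain ⟨k, hk⟩ := hij
        rw [hk]; exact Units.ne_zero _
      obtain ⟨u, rfl⟩ : ∃ u : Fˣ, (u : F) = x := ⟨Units.mk0 x hx0, rfl⟩
      rw [mem_cycClass γ hγ N ζ hζ θ hθ hN0] at hij hij'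
      have h1 : ζ ^ (M₂ * i + M₁ * j) = ζ ^ (M₂ * i' + M₁ * j') := by
        have h0 : θ u ≠ 0 := left_ne_zero_of_mul_eq_one hij
        exact mul_left_cancel₀ h0 (hij.trans hij'.symm)
      rw [← pow_mod_orderOf ζ (M₂ * i + M₁ * j), ← pow_mod_orderOf ζ (M₂ * i' + M₁ * j'),
        ← hζ.eq_orderOf] at h1
      replace h1 := hζ.pow_inj (Nat.mod_lt _ hN0) (Nat.mod_lt _ hN0) h1
      have h2 : M₂ * i + M₁ * j ≡ M₂ * i' + M₁ * j' [MOD N] := h1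
      have h3 : M₂ * i ≡ M₂ * i' [MOD M₁] := by
        have := h2.of_dvd (hN ▸ Dvd.intro _ rfl : M₁ ∣ N)
        simpa [Nat.ModEq] using this
      have h4 : M₁ * j ≡ M₁ * j' [MOD M₂] := by
        have := h2.of_dvd (hN ▸ Dvd.intro_left _ rfl : M₂ ∣ N)
        simpa [Nat.ModEq] using this
      have h5 := Nat.ModEq.cancel_left_of_coprime (by exact hcop) h3
      have h6 := Nat.ModEq.cancel_left_of_coprime (by exact hcop.symm) h4
      exact ⟨(Nat.ModEq.eq_of_lt_of_lt h5 (by omega) (by omega)).symm,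
        (Nat.ModEq.eq_of_lt_of_lt h6 (by omega) (by omega)).symm⟩
    rw [Finset.sum_eq_single_of_mem i (Finset.mem_range.mpr hi),
      Finset.sum_eq_single_of_mem j (Finset.mem_range.mpr hj), if_pos hij]
    · intro j' hj' hne
      rw [if_neg]
      intro h; exact hne (huniq i hi j' (Finset.mem_range.mp hj') h).2
    · intro i' hi' hne
      refine Finset.sum_eq_zero fun j' hj' => ?_
      rw [if_neg]
      intro h; exact hne (huniq i' (Finset.mem_range.mp hi') j' (Finset.mem_range.mp hj') h).1
  · rw [if_neg hx]
    refine Finset.sum_eq_zero fun i hi => Finset.sum_eq_zero fun j hj => ?_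
    rw [if_neg]
    intro h
    exact hx (hmem.mpr ⟨i, Finset.mem_range.mp hi, j, Finset.mem_range.mp hj, h⟩)

open scoped Classical in
theorem period_D {F : Type*} [Field F] [Fintype F] (γ : Fˣ)
    (hγ : ∀ x : Fˣ, x ∈ Subgroup.zpowers γ) (N : ℕ) (ζ : ℂ) (hζ : IsPrimitiveRoot ζ N)
    (θ : MulChar F ℂ) (hθ : θ γ = ζ⁻¹) (M₁ M₂ K₁ K₂ : ℕ) (hN : N = M₁ * M₂) (hM₁ : 0 < M₁) (hM₂ : 0 < M₂)
    (hcop : M₁.Coprime M₂) (hK₁ : K₁ ≤ M₁) (hK₂ : K₂ ≤ M₂)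
    (D : Set F) (hD : D = ⋃ i < K₁, ⋃ j < K₂, cycClass γ N (M₂ * i + M₁ * j))
    (ψ : AddChar F ℂ) (a : ℕ) :
    (N : ℂ) * ∑ x ∈ Finset.univ.filter (· ∈ D), ψ (((γ ^ a : Fˣ) : F) * x) =
      ∑ i ∈ Finset.range K₁, ∑ j ∈ Finset.range K₂, ∑ t ∈ Finset.range N,
        gaussSum (θ ^ t) ψ * ζ ^ (t * (a + M₂ * i + M₁ * j)) := by
  have hN0 : 0 < N := by rw [hN]; positivity
  have hζ0 : ζ ≠ 0 := hζ.ne_zero hN0.ne'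
  have hg : ∀ t, ∑ x, (θ ^ t) x * ψ (((γ ^ a : Fˣ) : F) * x) = gaussSum (θ ^ t) ψ * ζ ^ (t * a) := by
    intro t
    have h1 := gaussSum_mulShift (θ ^ t) ψ (γ ^ a)
    rw [MulChar.pow_apply_coe, Units.val_pow_eq_pow_val, map_pow, hθ, ← pow_mul, inv_pow, mul_comm a t] at h1
    have h2 : gaussSum (θ ^ t) (ψ.mulShift ((γ ^ a : Fˣ) : F)) = ∑ x, (θ ^ t) x * ψ (((γ ^ a : Fˣ) : F) * x) := by
      rw [gaussSum]; simp only [AddChar.mulShift_apply]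
    rw [← h2, ← h1, Units.val_pow_eq_pow_val]
    have : ζ ^ (t * a) ≠ 0 := pow_ne_zero _ hζ0
    field_simp
  have h3 : (N : ℂ) * ∑ x ∈ Finset.univ.filter (· ∈ D), ψ (((γ ^ a : Fˣ) : F) * x) =
      ∑ x, (if x ∈ D then (N : ℂ) else 0) * ψ (((γ ^ a : Fˣ) : F) * x) := by
    rw [Finset.sum_filter, Finset.mul_sum]
    refine Finset.sum_congr rfl fun x _ => ?_
    split_ifs <;> simp
  rw [h3]
  simp_rw [← ind_D γ hγ N ζ hζ θ hθ M₁ M₂ K₁ K₂ hN hM₁ hM₂ hcop hK₁ hK₂ D hD, Finset.sum_mul]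
  rw [Finset.sum_comm]
  refine Finset.sum_congr rfl fun i _ => ?_
  rw [Finset.sum_comm]
  refine Finset.sum_congr rfl fun j _ => ?_
  rw [Finset.sum_comm]
  refine Finset.sum_congr rfl fun t _ => ?_
  rw [add_assoc, mul_add t a, pow_add, ← mul_assoc, ← hg, Finset.sum_mul]
  refine Finset.sum_congr rfl fun x _ => ?_
  ring

open scoped Classical in
theorem card_D {F : Type*} [Field F] [Fintype F] (γ : Fˣ)
    (hγ : ∀ x : Fˣ, x ∈ Subgroup.zpowers γ) (N : ℕ) (ζ : ℂ) (hζ : IsPrimitiveRoot ζ N)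
    (θ : MulChar F ℂ) (hθ : θ γ = ζ⁻¹) (M₁ M₂ K₁ K₂ : ℕ) (hN : N = M₁ * M₂) (hM₁ : 0 < M₁) (hM₂ : 0 < M₂)
    (hcop : M₁.Coprime M₂) (hK₁ : K₁ ≤ M₁) (hK₂ : K₂ ≤ M₂)
    (D : Set F) (hD : D = ⋃ i < K₁, ⋃ j < K₂, cycClass γ N (M₂ * i + M₁ * j)) :
    N * (Finset.univ.filter (· ∈ D)).card = K₁ * K₂ * (Fintype.card F - 1) := by
  have hN0 : 0 < N := by rw [hN]; positivity
  have h3 : (N : ℂ) * (Finset.univ.filter (· ∈ D)).card = ∑ x, (if x ∈ D then (N : ℂ) else 0) := by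
    rw [← Finset.sum_filter, Finset.sum_const, nsmul_eq_mul, mul_comm]
  simp_rw [← ind_D γ hγ N ζ hζ θ hθ M₁ M₂ K₁ K₂ hN hM₁ hM₂ hcop hK₁ hK₂ D hD] at h3
  have h4 : ∀ c : ℕ, ∑ t ∈ Finset.range N, ∑ x, (θ ^ t) x * ζ ^ (t * c) = ((Fintype.card F - 1 : ℕ) : ℂ) := by
    intro c
    rw [Finset.sum_eq_single_of_mem 0 (Finset.mem_range.mpr hN0)]
    · simp only [pow_zero, zero_mul, mul_one]
      rw [MulChar.sum_one_eq_card_units, Fintype.card_units]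
    · intro t ht ht0
      rw [← Finset.sum_mul, MulChar.sum_eq_zero_of_ne_one, zero_mul]
      intro h
      have h5 : (θ ^ t) γ = 1 := by rw [h, MulChar.one_apply_coe]
      rw [MulChar.pow_apply_coe, hθ, inv_pow, inv_eq_one, hζ.pow_eq_one_iff_dvd] at h5
      have := Nat.le_of_dvd (Nat.pos_of_ne_zero ht0) h5
      rw [Finset.mem_range] at ht; omega
  rw [Finset.sum_comm] at h3
  have h5 : ∀ i ∈ Finset.range K₁, ∑ x : F, ∑ j ∈ Finset.range K₂, ∑ t ∈ Finset.range N,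
      (θ ^ t) x * ζ ^ (t * (M₂ * i + M₁ * j)) = K₂ * ((Fintype.card F - 1 : ℕ) : ℂ) := by
    intro i _
    rw [Finset.sum_comm]
    rw [Finset.sum_congr rfl (g := fun _ => ((Fintype.card F - 1 : ℕ) : ℂ))]
    · simp
    · intro j _
      rw [Finset.sum_comm, h4]
  rw [Finset.sum_congr rfl h5, Finset.sum_const, Finset.card_range, nsmul_eq_mul, ← mul_assoc] at h3
  exact_mod_cast h3

theorem S_vanish (l L w a : ℕ) (hl : 0 < l) (hL : 0 < L) (ζ : ℂ) (hζ : IsPrimitiveRoot ζ (l * L))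
    (hw : w.Coprime (l * L)) (t : ℕ) (ht : l ∣ t) (ht2 : ¬ l * L ∣ t) :
    ∑ i ∈ Finset.range L, ζ ^ (t * (a + w * i)) = 0 := by
  have h1 : ∀ i ∈ Finset.range L, ζ ^ (t * (a + w * i)) = ζ ^ (t * a) * (ζ ^ (t * w)) ^ i := by
    intro i _
    rw [← pow_mul, ← pow_add]; congr 1; ring
  rw [Finset.sum_congr rfl h1, ← Finset.mul_sum]
  have h2 : ζ ^ (t * w) ≠ 1 := by
    rw [ne_eq, hζ.pow_eq_one_iff_dvd]
    intro h
    exact ht2 (hw.symm.dvd_of_dvd_mul_right h)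
  have h3 : (ζ ^ (t * w)) ^ L = 1 := by
    rw [← pow_mul, hζ.pow_eq_one_iff_dvd]
    obtain ⟨s, rfl⟩ := ht
    exact ⟨s * w, by ring⟩
  have h5 := mul_neg_geom_sum (ζ ^ (t * w)) L
  rw [h3, sub_self] at h5
  rw [(mul_eq_zero.mp h5).resolve_left (sub_ne_zero.mpr (Ne.symm h2)), mul_zero]

theorem S_fold (l L w a : ℕ) (hl : 0 < l) (hL : 0 < L) (ζ : ℂ) (hζ : IsPrimitiveRoot ζ (l * L))
    (hw : w.Coprime (l * L)) (i₀ κ : ℕ) (hi₀ : i₀ < L) (hκ : a + w * i₀ = L * κ) (H : ℕ → ℂ) :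
    ∑ t ∈ Finset.range (l * L), H (t % l) * ∑ i ∈ Finset.range L, ζ ^ (t * (a + w * i)) =
      L * ∑ u ∈ Finset.range l, H u * (ζ ^ L) ^ (u * κ) := by
  have hz : ∀ i < L, ∑ v ∈ Finset.range L, ζ ^ (l * v * (a + w * i)) = if i = i₀ then (L : ℂ) else 0 := by
    intro i hi
    have h1 : ∀ v ∈ Finset.range L, ζ ^ (l * v * (a + w * i)) = (ζ ^ (l * (a + w * i))) ^ v := by
      intro v _
      rw [← pow_mul]; congr 1; ring
    rw [Finset.sum_congr rfl h1]
    split_ifs with h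
    · subst h
      have : ζ ^ (l * (a + w * i)) = 1 := by
        rw [hζ.pow_eq_one_iff_dvd, hκ]; exact ⟨κ, by ring⟩
      rw [this]; simp
    · have h2 : ζ ^ (l * (a + w * i)) ≠ 1 := by
        rw [ne_eq, hζ.pow_eq_one_iff_dvd, Nat.mul_dvd_mul_iff_left hl]
        intro h3
        apply h
        have h4 : a + w * i ≡ a + w * i₀ [MOD L] := by
          rw [Nat.ModEq, Nat.mod_eq_zero_of_dvd h3, hκ, Nat.mul_mod_right]
        have h5 := Nat.ModEq.add_left_cancel' a h4
        have h6 := Nat.ModEq.cancel_left_of_coprime (c := w) (by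
          exact (hw.coprime_dvd_right (Dvd.intro_left l rfl)).symm) h5
        exact Nat.ModEq.eq_of_lt_of_lt h6 hi hi₀
      have h3 : (ζ ^ (l * (a + w * i))) ^ L = 1 := by
        rw [← pow_mul, hζ.pow_eq_one_iff_dvd]
        exact ⟨a + w * i, by ring⟩
      have h5 := mul_neg_geom_sum (ζ ^ (l * (a + w * i))) L
      rw [h3, sub_self] at h5
      exact (mul_eq_zero.mp h5).resolve_left (sub_ne_zero.mpr (Ne.symm h2))
  have hsplit : ∀ g : ℕ → ℂ, ∑ t ∈ Finset.range (l * L), g t =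
      ∑ u ∈ Finset.range l, ∑ v ∈ Finset.range L, g (u + l * v) := by
    intro g
    rw [← Finset.sum_product', eq_comm]
    refine Finset.sum_nbij' (fun x => x.1 + l * x.2) (fun t => (t % l, t / l)) ?_ ?_ ?_ ?_ ?_
    · rintro ⟨u, v⟩ h
      simp only [Finset.mem_product, Finset.mem_range] at h ⊢
      calc u + l * v < l + l * v := by omega
        _ = l * (v + 1) := by ring
        _ ≤ l * L := Nat.mul_le_mul_left _ h.2
    · intro t h
      simp only [Finset.mem_product, Finset.mem_range] at h ⊢
      exact ⟨Nat.mod_lt _ hl, Nat.div_lt_of_lt_mul h⟩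
    · rintro ⟨u, v⟩ h
      simp only [Finset.mem_product, Finset.mem_range] at h ⊢
      rw [Nat.add_mul_mod_self_left, Nat.mod_eq_of_lt h.1, Nat.add_mul_div_left _ _ hl,
        Nat.div_eq_of_lt h.1, zero_add]
    · intro t _; simp only; exact Nat.mod_add_div t l
    · intro _ _; rfl
  rw [hsplit, Finset.mul_sum]
  refine Finset.sum_congr rfl fun u hu => ?_
  rw [Finset.mem_range] at hu
  have h1 : ∀ v ∈ Finset.range L, H ((u + l * v) % l) * ∑ i ∈ Finset.range L, ζ ^ ((u + l * v) * (a + w * i))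
      = ∑ i ∈ Finset.range L, H u * ζ ^ (u * (a + w * i)) * ζ ^ (l * v * (a + w * i)) := by
    intro v _
    rw [Nat.add_mul_mod_self_left, Nat.mod_eq_of_lt hu, Finset.mul_sum]
    refine Finset.sum_congr rfl fun i _ => ?_
    rw [mul_assoc, ← pow_add]; congr 2; ring
  rw [Finset.sum_congr rfl h1, Finset.sum_comm]
  simp_rw [← Finset.mul_sum]
  rw [Finset.sum_eq_single_of_mem i₀ (Finset.mem_range.mpr hi₀)]
  · rw [hz i₀ hi₀, if_pos rfl, hκ, ← pow_mul]
    rw [show u * (L * κ) = L * (u * κ) by ring]; ring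
  · intro i hi hne
    rw [hz i (Finset.mem_range.mp hi), if_neg hne, mul_zero]

theorem crt_sum (M₁ M₂ : ℕ) (hM₁ : 0 < M₁) (hM₂ : 0 < M₂) (hcop : M₁.Coprime M₂) (g : ℕ → ℂ)
    (hg : ∀ t, g (t % (M₁ * M₂)) = g t) :
    ∑ t ∈ Finset.range (M₁ * M₂), g t =
      ∑ t₁ ∈ Finset.range M₁, ∑ t₂ ∈ Finset.range M₂, g (M₂ * t₁ + M₁ * t₂) := by
  have hN : 0 < M₁ * M₂ := by positivity
  have hinj : Set.InjOn (fun x : ℕ × ℕ => (M₂ * x.1 + M₁ * x.2) % (M₁ * M₂))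
      (Finset.range M₁ ×ˢ Finset.range M₂ : Finset (ℕ × ℕ)) := by
    rintro ⟨i, j⟩ h ⟨i', j'⟩ h' hij
    simp only [Finset.coe_product, Set.mem_prod, Finset.mem_coe, Finset.mem_range] at h h' hij
    have h2 : M₂ * i + M₁ * j ≡ M₂ * i' + M₁ * j' [MOD M₁ * M₂] := hij
    have h3 : M₂ * i ≡ M₂ * i' [MOD M₁] := by
      have := h2.of_dvd (Dvd.intro _ rfl : M₁ ∣ M₁ * M₂)
      simpa [Nat.ModEq] using this
    have h4 : M₁ * j ≡ M₁ * j' [MOD M₂] := by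
      have := h2.of_dvd (Dvd.intro_left _ rfl : M₂ ∣ M₁ * M₂)
      simpa [Nat.ModEq] using this
    have h5 := Nat.ModEq.cancel_left_of_coprime (by exact hcop) h3
    have h6 := Nat.ModEq.cancel_left_of_coprime (by exact hcop.symm) h4
    exact Prod.ext (Nat.ModEq.eq_of_lt_of_lt h5 h.1 h'.1) (Nat.ModEq.eq_of_lt_of_lt h6 h.2 h'.2)
  have himg : (Finset.range M₁ ×ˢ Finset.range M₂).image
      (fun x : ℕ × ℕ => (M₂ * x.1 + M₁ * x.2) % (M₁ * M₂)) = Finset.range (M₁ * M₂) := by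
    apply Finset.eq_of_subset_of_card_le
    · intro x hx
      rw [Finset.mem_image] at hx
      obtain ⟨y, _, rfl⟩ := hx
      exact Finset.mem_range.mpr (Nat.mod_lt _ hN)
    · rw [Finset.card_image_of_injOn hinj]; simp
  rw [← himg, Finset.sum_image hinj, Finset.sum_product]
  refine Finset.sum_congr rfl fun i _ => Finset.sum_congr rfl fun j _ => hg _

/-- the two-dimensional folding -/
theorem fold2 (l₁ L₁ l₂ L₂ a : ℕ) (hl₁ : 0 < l₁) (hL₁ : 0 < L₁) (hl₂ : 0 < l₂) (hL₂ : 0 < L₂)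
    (hcop : (l₁ * L₁).Coprime (l₂ * L₂)) (ζ : ℂ) (N : ℕ) (hN : N = (l₁ * L₁) * (l₂ * L₂))
    (hζ : IsPrimitiveRoot ζ N) (G : ℕ → ℂ) (hG : ∀ t, G (t % N) = G t) (Gh : ℕ → ℕ → ℂ)
    (hGh : ∀ t₁ t₂, (t₁ = 0 ∨ ¬ l₁ ∣ t₁) → (t₂ = 0 ∨ ¬ l₂ ∣ t₂) →
      G (l₂ * L₂ * t₁ + l₁ * L₁ * t₂) = Gh (t₁ % l₁) (t₂ % l₂))
    (i₀ κ₁ j₀ κ₂ : ℕ) (hi₀ : i₀ < L₁) (hκ₁ : a + l₂ * L₂ * i₀ = L₁ * κ₁)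
    (hj₀ : j₀ < L₂) (hκ₂ : a + l₁ * L₁ * j₀ = L₂ * κ₂) :
    ∑ i ∈ Finset.range L₁, ∑ j ∈ Finset.range L₂, ∑ t ∈ Finset.range N,
        G t * ζ ^ (t * (a + l₂ * L₂ * i + l₁ * L₁ * j)) =
      (L₁ : ℂ) * L₂ * ∑ u ∈ Finset.range l₁, ∑ v ∈ Finset.range l₂,
        Gh u v * (ζ ^ (l₂ * L₂ * L₁)) ^ (u * κ₁) * (ζ ^ (l₁ * L₁ * L₂)) ^ (v * κ₂) := by
  set M₁ := l₁ * L₁ with hM₁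
  set M₂ := l₂ * L₂ with hM₂
  have hM₁0 : 0 < M₁ := by positivity
  have hM₂0 : 0 < M₂ := by positivity
  have hN0 : 0 < N := by rw [hN]; positivity
  have hζ₁ : IsPrimitiveRoot (ζ ^ M₂) M₁ := hζ.pow hN0 (by rw [hN, mul_comm])
  have hζ₂ : IsPrimitiveRoot (ζ ^ M₁) M₂ := hζ.pow hN0 (by rw [hN])
  set S₁ : ℕ → ℂ := fun t => ∑ i ∈ Finset.range L₁, (ζ ^ M₂) ^ (t * (a + M₂ * i)) with hS₁
  set S₂ : ℕ → ℂ := fun t => ∑ j ∈ Finset.range L₂, (ζ ^ M₁) ^ (t * (a + M₁ * j)) with hS₂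
  have hv₁ : ∀ t < M₁, t ≠ 0 → l₁ ∣ t → S₁ t = 0 := by
    intro t ht ht0 hlt
    exact S_vanish l₁ L₁ M₂ a hl₁ hL₁ _ hζ₁ hcop.symm t hlt
      (fun h => by have := Nat.le_of_dvd (Nat.pos_of_ne_zero ht0) h; omega)
  have hv₂ : ∀ t < M₂, t ≠ 0 → l₂ ∣ t → S₂ t = 0 := by
    intro t ht ht0 hlt
    exact S_vanish l₂ L₂ M₁ a hl₂ hL₂ _ hζ₂ hcop t hlt
      (fun h => by have := Nat.le_of_dvd (Nat.pos_of_ne_zero ht0) h; omega)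
  have step1 : ∑ i ∈ Finset.range L₁, ∑ j ∈ Finset.range L₂, ∑ t ∈ Finset.range N,
        G t * ζ ^ (t * (a + M₂ * i + M₁ * j)) =
      ∑ t₁ ∈ Finset.range M₁, ∑ t₂ ∈ Finset.range M₂, G (M₂ * t₁ + M₁ * t₂) * (S₁ t₁ * S₂ t₂) := by
    have e1 : ∀ i j, ∑ t ∈ Finset.range N, G t * ζ ^ (t * (a + M₂ * i + M₁ * j)) =
        ∑ t₁ ∈ Finset.range M₁, ∑ t₂ ∈ Finset.range M₂, G (M₂ * t₁ + M₁ * t₂) *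
          ((ζ ^ M₂) ^ (t₁ * (a + M₂ * i)) * (ζ ^ M₁) ^ (t₂ * (a + M₁ * j))) := by
      intro i j
      rw [hN, crt_sum M₁ M₂ hM₁0 hM₂0 hcop (fun t => G t * ζ ^ (t * (a + M₂ * i + M₁ * j)))]
      · refine Finset.sum_congr rfl fun t₁ _ => Finset.sum_congr rfl fun t₂ _ => ?_
        congr 1
        rw [← pow_mul, ← pow_mul, ← pow_add,
          show (M₂ * t₁ + M₁ * t₂) * (a + M₂ * i + M₁ * j) = (M₂ * (t₁ * (a + M₂ * i)) +
            M₁ * (t₂ * (a + M₁ * j))) + (M₁ * M₂) * (t₁ * j + t₂ * i) by ring, ← hN,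
          pow_add _ _ (N * _), pow_mul ζ N, hζ.pow_eq_one, one_pow, mul_one]
      · intro t
        rw [← hN, hG, pow_mul, pow_mul ζ t]
        congr 2
        conv_lhs => rw [hζ.eq_orderOf, pow_mod_orderOf]
    simp_rw [e1]
    have e2 : ∀ t₁ t₂, S₁ t₁ * S₂ t₂ = ∑ i ∈ Finset.range L₁, ∑ j ∈ Finset.range L₂,
        ((ζ ^ M₂) ^ (t₁ * (a + M₂ * i)) * (ζ ^ M₁) ^ (t₂ * (a + M₁ * j))) := by
      intro t₁ t₂
      rw [hS₁, hS₂, Finset.sum_mul_sum]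
    simp_rw [e2, Finset.mul_sum]
    rw [Finset.sum_congr rfl (fun i _ => Finset.sum_comm), Finset.sum_comm]
    refine Finset.sum_congr rfl fun t₁ _ => ?_
    rw [Finset.sum_congr rfl (fun i _ => Finset.sum_comm), Finset.sum_comm]
  rw [step1]
  have step2 : ∑ t₁ ∈ Finset.range M₁, ∑ t₂ ∈ Finset.range M₂, G (M₂ * t₁ + M₁ * t₂) * (S₁ t₁ * S₂ t₂) =
      ∑ t₁ ∈ Finset.range M₁, ∑ t₂ ∈ Finset.range M₂, Gh (t₁ % l₁) (t₂ % l₂) * (S₁ t₁ * S₂ t₂) := by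
    refine Finset.sum_congr rfl fun t₁ ht₁ => Finset.sum_congr rfl fun t₂ ht₂ => ?_
    rw [Finset.mem_range] at ht₁ ht₂
    by_cases h1 : t₁ = 0 ∨ ¬ l₁ ∣ t₁
    · by_cases h2 : t₂ = 0 ∨ ¬ l₂ ∣ t₂
      · rw [hGh t₁ t₂ h1 h2]
      · push Not at h2
        rw [hv₂ t₂ ht₂ h2.1 h2.2]; ring
    · push Not at h1
      rw [hv₁ t₁ ht₁ h1.1 h1.2]; ring
  rw [step2]
  have step3 : ∀ t₁ ∈ Finset.range M₁, ∑ t₂ ∈ Finset.range M₂, Gh (t₁ % l₁) (t₂ % l₂) * (S₁ t₁ * S₂ t₂) =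
      (L₂ * ∑ v ∈ Finset.range l₂, Gh (t₁ % l₁) v * ((ζ ^ M₁) ^ L₂) ^ (v * κ₂)) * S₁ t₁ := by
    intro t₁ _
    rw [← S_fold l₂ L₂ M₁ a hl₂ hL₂ _ hζ₂ hcop j₀ κ₂ hj₀ hκ₂ (fun v => Gh (t₁ % l₁) v), Finset.sum_mul]
    refine Finset.sum_congr rfl fun t₂ _ => ?_
    simp only [hS₂]; ring
  rw [Finset.sum_congr rfl step3]
  have := S_fold l₁ L₁ M₂ a hl₁ hL₁ _ hζ₁ hcop.symm i₀ κ₁ hi₀ hκ₁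
    (fun u => L₂ * ∑ v ∈ Finset.range l₂, Gh u v * ((ζ ^ M₁) ^ L₂) ^ (v * κ₂))
  rw [this]
  simp_rw [Finset.mul_sum, Finset.sum_mul, ← pow_mul]
  refine Finset.sum_congr rfl fun u _ => ?_
  rw [Finset.mul_sum]
  refine Finset.sum_congr rfl fun v _ => ?_
  ring

theorem sum_range_zmod (l : ℕ) [NeZero l] (g : ZMod l → ℂ) :
    ∑ u ∈ Finset.range l, g (u : ZMod l) = ∑ x, g x := by
  refine Finset.sum_nbij' (fun u => (u : ZMod l)) (fun x => x.val) ?_ ?_ ?_ ?_ ?_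
  · intro _ _; exact Finset.mem_univ _
  · intro x _; exact Finset.mem_range.mpr (ZMod.val_lt x)
  · intro u hu; exact ZMod.val_cast_of_lt (Finset.mem_range.mp hu)
  · intro x _; exact ZMod.natCast_zmod_val x
  · intro _ _; rfl

theorem jac_quad (l : ℕ) [Fact l.Prime] (u : ℕ) :
    ((jacobiSym u l : ℤ) : ℂ) = ((quadraticChar (ZMod l)).ringHomComp (Int.castRingHom ℂ)) (u : ZMod l) := by
  rw [← jacobiSym.legendreSym.to_jacobiSym, legendreSym]
  simp [MulChar.ringHomComp_apply]

theorem T_zero (l : ℕ) (hl : l.Prime) (hl2 : l ≠ 2) (ω : ℂ) (hω : IsPrimitiveRoot ω l) (κ : ℕ) (hκ : l ∣ κ) :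
    ∑ u ∈ Finset.range l, ((jacobiSym u l : ℤ) : ℂ) * ω ^ (u * κ) = 0 := by
  have : Fact l.Prime := ⟨hl⟩
  have h1 : ∀ u ∈ Finset.range l, ((jacobiSym u l : ℤ) : ℂ) * ω ^ (u * κ) =
      ((quadraticChar (ZMod l)).ringHomComp (Int.castRingHom ℂ)) (u : ZMod l) := by
    intro u _
    rw [jac_quad, (hω.pow_eq_one_iff_dvd _).mpr (Dvd.dvd.mul_left hκ u), mul_one]
  rw [Finset.sum_congr rfl h1, sum_range_zmod]
  apply MulChar.sum_eq_zero_of_ne_one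
  rw [MulChar.ringHomComp_ne_one_iff (RingHom.injective_int _)]
  exact quadraticChar_ne_one (by rw [ZMod.ringChar_zmod_n]; exact hl2)

theorem T_sq (l : ℕ) (hl : l.Prime) (hl2 : l ≠ 2) (ω : ℂ) (hω : IsPrimitiveRoot ω l) (κ : ℕ) (hκ : ¬ l ∣ κ) :
    (∑ u ∈ Finset.range l, ((jacobiSym u l : ℤ) : ℂ) * ω ^ (u * κ)) ^ 2 = jacobiSym (-1) l * l := by
  have : Fact l.Prime := ⟨hl⟩
  have hω' : IsPrimitiveRoot (ω ^ κ) l := hω.pow_of_coprime κ (by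
    rw [Nat.coprime_comm]; exact (Nat.Prime.coprime_iff_not_dvd hl).mpr hκ)
  set ψ := AddChar.zmodChar l hω'.pow_eq_one with hψ
  have hprim : ψ.IsPrimitive := AddChar.zmodChar_primitive_of_primitive_root l hω'
  have h1 : ∀ u ∈ Finset.range l, ((jacobiSym u l : ℤ) : ℂ) * ω ^ (u * κ) =
      ((quadraticChar (ZMod l)).ringHomComp (Int.castRingHom ℂ)) (u : ZMod l) * ψ (u : ZMod l) := by
    intro u hu
    rw [jac_quad, hψ, AddChar.zmodChar_apply, ZMod.val_cast_of_lt (Finset.mem_range.mp hu), ← pow_mul,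
      mul_comm κ u]
  rw [Finset.sum_congr rfl h1, sum_range_zmod l (fun x => ((quadraticChar (ZMod l)).ringHomComp (Int.castRingHom ℂ)) x * ψ x)]
  have h2 := gaussSum_sq (χ := (quadraticChar (ZMod l)).ringHomComp (Int.castRingHom ℂ)) (by
    rw [MulChar.ringHomComp_ne_one_iff (RingHom.injective_int _)]
    exact quadraticChar_ne_one (by rw [ZMod.ringChar_zmod_n]; exact hl2))
    ((quadraticChar_isQuadratic (ZMod l)).comp _) hprim
  rw [gaussSum] at h2
  rw [h2, ZMod.card]
  congr 1
  rw [← jacobiSym.legendreSym.to_jacobiSym, legendreSym]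
  simp [MulChar.ringHomComp_apply]

theorem R_eval (l : ℕ) (hl : 0 < l) (ω : ℂ) (hω : IsPrimitiveRoot ω l) (κ : ℕ) :
    ∑ u ∈ Finset.range l, (if u = 0 then (0:ℂ) else 1) * ω ^ (u * κ) = (if l ∣ κ then (l : ℂ) else 0) - 1 := by
  have h0 : ∑ u ∈ Finset.range l, ω ^ (u * κ) = if l ∣ κ then (l : ℂ) else 0 := by
    have h1 : ∀ u ∈ Finset.range l, ω ^ (u * κ) = (ω ^ κ) ^ u := by
      intro u _; rw [← pow_mul, mul_comm]
    rw [Finset.sum_congr rfl h1]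
    split_ifs with h
    · rw [(hω.pow_eq_one_iff_dvd _).mpr h]; simp
    · have h3 : (ω ^ κ) ^ l = 1 := by rw [← pow_mul, mul_comm, pow_mul, hω.pow_eq_one, one_pow]
      have h5 := mul_neg_geom_sum (ω ^ κ) l
      rw [h3, sub_self] at h5
      refine (mul_eq_zero.mp h5).resolve_left (sub_ne_zero.mpr (Ne.symm ?_))
      rwa [ne_eq, hω.pow_eq_one_iff_dvd]
  rw [← h0]
  have h2 : ∀ u ∈ Finset.range l, (if u = 0 then (0:ℂ) else 1) * ω ^ (u * κ) =
      ω ^ (u * κ) - if u = 0 then 1 else 0 := by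
    intro u _; split_ifs with h
    · subst h; simp
    · simp
  rw [Finset.sum_congr rfl h2, Finset.sum_sub_distrib, Finset.sum_ite_eq' (Finset.range l) 0,
    if_pos (Finset.mem_range.mpr hl)]

/-- limiting Gauss sum values as a function of residues -/
noncomputable def Ghat (l₁ l₂ : ℕ) (G1 G2 X W : ℂ) (u v : ℕ) : ℂ :=
  if u = 0 then (if v = 0 then -1 else G2) else if v = 0 then G1 else
    (X + ((jacobiSym u l₁ : ℤ) : ℂ) * ((jacobiSym v l₂ : ℤ) : ℂ) * W) / 2

theorem Ghat_sum (l₁ l₂ : ℕ) (hl₁ : l₁.Prime) (hl₂ : l₂.Prime) (ω₁ ω₂ : ℂ)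
    (hω₁ : IsPrimitiveRoot ω₁ l₁) (hω₂ : IsPrimitiveRoot ω₂ l₂) (κ₁ κ₂ : ℕ) (G1 G2 X W : ℂ) :
    ∑ u ∈ Finset.range l₁, ∑ v ∈ Finset.range l₂,
        Ghat l₁ l₂ G1 G2 X W u v * ω₁ ^ (u * κ₁) * ω₂ ^ (v * κ₂) =
      -1 + G1 * ((if l₁ ∣ κ₁ then (l₁ : ℂ) else 0) - 1) + G2 * ((if l₂ ∣ κ₂ then (l₂ : ℂ) else 0) - 1) +
      X / 2 * (((if l₁ ∣ κ₁ then (l₁ : ℂ) else 0) - 1) * ((if l₂ ∣ κ₂ then (l₂ : ℂ) else 0) - 1)) +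
      W / 2 * ((∑ u ∈ Finset.range l₁, ((jacobiSym u l₁ : ℤ) : ℂ) * ω₁ ^ (u * κ₁)) *
        (∑ v ∈ Finset.range l₂, ((jacobiSym v l₂ : ℤ) : ℂ) * ω₂ ^ (v * κ₂))) := by
  rw [← R_eval l₁ hl₁.pos ω₁ hω₁ κ₁, ← R_eval l₂ hl₂.pos ω₂ hω₂ κ₂]
  set z : ℕ → ℂ := fun u => if u = 0 then 1 else 0 with hz
  set o : ℕ → ℂ := fun u => if u = 0 then 0 else 1 with ho
  have hzs : ∀ (l : ℕ) (hl : 0 < l) (ω : ℂ) (κ : ℕ), ∑ u ∈ Finset.range l, z u * ω ^ (u * κ) = 1 := by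
    intro l hl ω κ
    rw [Finset.sum_eq_single_of_mem 0 (Finset.mem_range.mpr hl)]
    · simp [hz]
    · intro u _ hu; simp [hz, hu]
  have h1 : ∀ u v, Ghat l₁ l₂ G1 G2 X W u v * ω₁ ^ (u * κ₁) * ω₂ ^ (v * κ₂) =
      -((z u * ω₁ ^ (u * κ₁)) * (z v * ω₂ ^ (v * κ₂))) +
      G1 * ((o u * ω₁ ^ (u * κ₁)) * (z v * ω₂ ^ (v * κ₂))) +
      G2 * ((z u * ω₁ ^ (u * κ₁)) * (o v * ω₂ ^ (v * κ₂))) +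
      X / 2 * ((o u * ω₁ ^ (u * κ₁)) * (o v * ω₂ ^ (v * κ₂))) +
      W / 2 * ((((jacobiSym u l₁ : ℤ) : ℂ) * ω₁ ^ (u * κ₁)) * (((jacobiSym v l₂ : ℤ) : ℂ) * ω₂ ^ (v * κ₂))) := by
    intro u v
    have hj1 : jacobiSym (0 : ℤ) l₁ = 0 := jacobiSym.zero_left hl₁.one_lt
    have hj2 : jacobiSym (0 : ℤ) l₂ = 0 := jacobiSym.zero_left hl₂.one_lt
    by_cases hu : u = 0 <;> by_cases hv : v = 0
    · subst hu; subst hv; simp [Ghat, hz, ho, hj1]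
    · subst hu; simp [Ghat, hz, ho, hj1, hv]
    · subst hv; simp [Ghat, hz, ho, hj2, hu]
    · simp [Ghat, hz, ho, hu, hv]; ring
  simp_rw [h1, Finset.sum_add_distrib, Finset.sum_neg_distrib]
  simp only [← Finset.mul_sum, ← Finset.sum_mul]
  rw [hzs l₁ hl₁.pos, hzs l₂ hl₂.pos]
  ring

theorem exists_char {F : Type*} [Field F] [Fintype F] (γ : Fˣ)
    (hγ : ∀ x : Fˣ, x ∈ Subgroup.zpowers γ) (z : ℂ) (hz : z ^ (Fintype.card F - 1) = 1) :
    ∃ θ : MulChar F ℂ, θ γ = z := by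
  classical
  have hpos : Fintype.card F - 1 ≠ 0 := by have := Fintype.one_lt_card (α := F); omega
  have hz' : IsUnit z := IsUnit.of_pow_eq_one hz hpos
  have hmem : hz'.unit ∈ rootsOfUnity (Fintype.card Fˣ) ℂ := by
    rw [mem_rootsOfUnity, Fintype.card_units]
    ext; simpa using hz
  exact ⟨MulChar.ofRootOfUnity hmem hγ, by rw [MulChar.ofRootOfUnity_spec]; rfl⟩

theorem ex_kappa (w L a : ℕ) (hL : 0 < L) (hw : w.Coprime L) :
    ∃ i₀ κ, i₀ < L ∧ a + w * i₀ = L * κ := by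
  have : NeZero L := ⟨hL.ne'⟩
  obtain ⟨i, hi⟩ : ∃ i : ZMod L, (a : ZMod L) + w * i = 0 := by
    refine ⟨-(w : ZMod L)⁻¹ * a, ?_⟩
    have := ZMod.coe_mul_inv_eq_one w hw
    linear_combination (-(a : ZMod L)) * this
  have h1 : ((a + w * i.val : ℕ) : ZMod L) = 0 := by
    push_cast; rw [ZMod.natCast_zmod_val]; exact hi
  rw [ZMod.natCast_eq_zero_iff] at h1
  obtain ⟨κ, hκ⟩ := h1
  exact ⟨i.val, κ, ZMod.val_lt i, hκ⟩

theorem mulchar_prime_field (p : ℕ) [Fact p.Prime] {F : Type*} [Field F] [Fintype F] [Algebra (ZMod p) F]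
    (γ : Fˣ) (hγ : ∀ x : Fˣ, x ∈ Subgroup.zpowers γ) (N : ℕ) (hNp : N.Coprime (p - 1))
    (θ : MulChar F ℂ) (hθ : θ ^ N = 1) (c : ZMod p) (hc : c ≠ 0) : θ (algebraMap (ZMod p) F c) = 1 := by
  have h0 : algebraMap (ZMod p) F c ≠ 0 := by
    rwa [ne_eq, map_eq_zero]
  obtain ⟨u, hu⟩ : ∃ u : Fˣ, (u : F) = algebraMap (ZMod p) F c := ⟨Units.mk0 _ h0, rfl⟩
  have h1 : (θ u) ^ N = 1 := by rw [← MulChar.pow_apply_coe, hθ, MulChar.one_apply_coe]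
  have h2 : (θ u) ^ (p - 1) = 1 := by
    rw [← map_pow, hu, ← map_pow, ZMod.pow_card_sub_one_eq_one hc, map_one, map_one]
  rw [← hu, ← pow_one (θ u), ← hNp.gcd_eq_one]
  exact pow_gcd_eq_one.mpr ⟨h1, h2⟩

theorem jac_nat_mod (t l : ℕ) : jacobiSym ((t % l : ℕ) : ℤ) l = jacobiSym t l := by
  push_cast; rw [← jacobiSym.mod_left]

theorem jac_add_mul (x y l : ℕ) : jacobiSym ((x + l * y : ℕ) : ℤ) l = jacobiSym x l := by
  rw [← jac_nat_mod, Nat.add_mul_mod_self_left, jac_nat_mod]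

open scoped Classical in
theorem period_formula (p : ℕ) [Fact p.Prime] {F : Type*} [Field F] [Fintype F] [Algebra (ZMod p) F]
    (γ : Fˣ) (hγ : ∀ x : Fˣ, x ∈ Subgroup.zpowers γ)
    (p₁ p₂ m n : ℕ) (hp₁ : p₁.Prime) (hp₂ : p₂.Prime)
    (hp₁mod : p₁ % 4 = 1) (hp₂mod : p₂ % 4 = 3) (hm : 1 ≤ m) (hn : 1 ≤ n)
    (N : ℕ) (hN : N = p₁ ^ m * p₂ ^ n)
    (hord₁ : orderOf ((p : ZMod (p₁ ^ m))) = Nat.totient (p₁ ^ m))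
    (hord₂ : orderOf ((p : ZMod (p₂ ^ n))) = Nat.totient (p₂ ^ n))
    (f : ℕ) (hf : f = orderOf ((p : ZMod N))) (hford : 2 * f = Nat.totient N)
    (hcard : Fintype.card F = p ^ f)
    (D : Set F)
    (hD : D = ⋃ i < p₁ ^ (m - 1), ⋃ j < p₂ ^ (n - 1),
      cycClass γ N (p₂ ^ n * i + p₁ ^ m * j))
    (S : ℤ) (hS : (Fintype.card F : ℤ) = S ^ 2) (hS1 : (p₁ : ℤ) ∣ S + 1) (hS2 : (p₂ : ℤ) ∣ -S + 1) :
    ∃ (θ : MulChar F ℂ) (ω₁ ω₂ W : ℂ), orderOf (θ γ) = N ∧ θ (-1) = 1 ∧ IsPrimitiveRoot ω₁ p₁ ∧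
      IsPrimitiveRoot ω₂ p₂ ∧
      W ^ 2 = (gaussSum θ (psiF p F) - gaussSum θ⁻¹ (psiF p F)) ^ 2 ∧
      (∀ a i₀ κ₁ j₀ κ₂ : ℕ, i₀ < p₁ ^ (m - 1) → a + p₂ ^ n * i₀ = p₁ ^ (m - 1) * κ₁ →
        j₀ < p₂ ^ (n - 1) → a + p₁ ^ m * j₀ = p₂ ^ (n - 1) * κ₂ →
        ((p₁ : ℂ) * p₂) * ∑ x ∈ Finset.univ.filter (· ∈ D), psiF p F (((γ ^ a : Fˣ) : F) * x) =
        -1 + (S : ℂ) * ((if p₁ ∣ κ₁ then (p₁ : ℂ) else 0) - 1) +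
          (-S : ℂ) * ((if p₂ ∣ κ₂ then (p₂ : ℂ) else 0) - 1) +
          (gaussSum θ (psiF p F) + gaussSum θ⁻¹ (psiF p F)) / 2 *
            (((if p₁ ∣ κ₁ then (p₁ : ℂ) else 0) - 1) * ((if p₂ ∣ κ₂ then (p₂ : ℂ) else 0) - 1)) +
          W / 2 * ((∑ u ∈ Finset.range p₁, ((jacobiSym u p₁ : ℤ) : ℂ) * ω₁ ^ (u * κ₁)) *
            (∑ v ∈ Finset.range p₂, ((jacobiSym v p₂ : ℤ) : ℂ) * ω₂ ^ (v * κ₂)))) ∧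
      p₁ * p₂ * (Finset.univ.filter (· ∈ D)).card = p ^ f - 1 ∧
      (∀ c : ZMod p, c ≠ 0 → ∀ x ∈ D, algebraMap (ZMod p) F c * x ∈ D) ∧ (0 : F) ∉ D ∧
      (∀ t, θ ^ t = 1 ↔ N ∣ t) ∧
      (∀ t₁, ¬ p₁ ∣ t₁ → gaussSum (θ ^ (p₂ ^ n * t₁)) (psiF p F) = S) ∧
      (∀ t₂, ¬ p₂ ∣ t₂ → gaussSum (θ ^ (p₁ ^ m * t₂)) (psiF p F) = ((-S : ℤ) : ℂ)) := by
  have hp : p.Prime := Fact.out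
  have hne : p₁ ≠ p₂ := by rintro rfl; omega
  have hp₁2 : p₁ ≠ 2 := by rintro rfl; omega
  have hp₂2 : p₂ ≠ 2 := by rintro rfl; omega
  have hM₁0 : 0 < p₁ ^ m := pow_pos hp₁.pos _
  have hM₂0 : 0 < p₂ ^ n := pow_pos hp₂.pos _
  have hL₁0 : 0 < p₁ ^ (m - 1) := pow_pos hp₁.pos _
  have hL₂0 : 0 < p₂ ^ (n - 1) := pow_pos hp₂.pos _
  have hN0 : 0 < N := by rw [hN]; positivity
  have hcop12 : p₁.Coprime p₂ := (Nat.coprime_primes hp₁ hp₂).mpr hne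
  have hcop : (p₁ ^ m).Coprime (p₂ ^ n) := hcop12.pow m n
  have hML₁ : p₁ ^ m = p₁ * p₁ ^ (m - 1) := by rw [← pow_succ']; congr 1; omega
  have hML₂ : p₂ ^ n = p₂ * p₂ ^ (n - 1) := by rw [← pow_succ']; congr 1; omega
  have hpM₁ := coprime_of_orderOf _ p hM₁0 hord₁
  have hpM₂ := coprime_of_orderOf _ p hM₂0 hord₂
  have hpN : p.Coprime N := by rw [hN]; exact hpM₁.mul_right hpM₂
  have hJ₁ := jac_primroot p p₁ m hp₁ hp₁2 hm hord₁
  have hJ₂ := jac_primroot p p₂ n hp₂ hp₂2 hn hord₂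
  have : NeZero p₁ := ⟨hp₁.ne_zero⟩
  have : NeZero p₂ := ⟨hp₂.ne_zero⟩
  have hJp : jacobiSym p (p₁ * p₂) = 1 := by rw [jacobiSym.mul_right, hJ₁, hJ₂]; norm_num
  have hd4 : (p₁ * p₂) % 4 = 3 := by rw [Nat.mul_mod, hp₁mod, hp₂mod]
  have hdN : p₁ * p₂ ∣ N := by
    rw [hN]; exact mul_dvd_mul (dvd_pow_self _ (by omega)) (dvd_pow_self _ (by omega))
  -- N divides q - 1
  have hNq : N ∣ p ^ f - 1 := by
    have h1 := pow_orderOf_eq_one (p : ZMod N)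
    rw [← hf] at h1
    rw [← ZMod.natCast_eq_zero_iff, Nat.cast_sub (Nat.one_le_pow _ _ hp.pos)]
    push_cast; rw [h1, sub_self]
  have hnd : ∀ l : ℕ, l.Prime → jacobiSym p l = -1 → l.Coprime (p - 1) := by
    intro l hl hj
    rw [Nat.Prime.coprime_iff_not_dvd hl]
    intro h
    have : p % l = 1 % l := ((Nat.modEq_iff_dvd' hp.one_lt.le).mpr h).symm
    rw [← jac_nat_mod, this, jac_nat_mod] at hj
    simp at hj
  have hNp : N.Coprime (p - 1) := by
    rw [hN]
    exact Nat.Coprime.mul_left ((hnd p₁ hp₁ hJ₁).pow_left m) ((hnd p₂ hp₂ hJ₂).pow_left n)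
  -- the character
  have hζ := Complex.isPrimitiveRoot_exp N hN0.ne'
  set ζ := Complex.exp (2 * Real.pi * Complex.I / N) with hζdef
  obtain ⟨θ, hθ⟩ := exists_char γ hγ ζ⁻¹ (by
    rw [hcard, inv_pow, (hζ.pow_eq_one_iff_dvd _).mpr hNq, inv_one])
  have hθpow : ∀ t, θ ^ t = 1 ↔ N ∣ t := by
    intro t
    rw [MulChar.eq_iff hγ, MulChar.pow_apply_coe, MulChar.one_apply_coe, hθ, inv_pow, inv_eq_one,
      hζ.pow_eq_one_iff_dvd]
  have hθN : θ ^ N = 1 := (hθpow N).mpr dvd_rfl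
  have hθp := mulchar_prime_field p γ hγ N hNp θ hθN
  have hθneg : θ (-1) = 1 := by
    have := hθp (-1) (by simp)
    simpa using this
  have hθneg' : ∀ t, (θ ^ t) (-1) = 1 := by
    intro t
    have : (-1 : F) = ((-1 : Fˣ) : F) := by simp
    rw [this, MulChar.pow_apply_coe, ← this, hθneg, one_pow]
  set ψ := psiF p F with hψ
  set G : ℕ → ℂ := fun t => gaussSum (θ ^ t) ψ with hGdef
  have hG : ∀ t, G (t % N) = G t := by
    intro t
    simp only [hGdef]
    congr 1
    conv_rhs => rw [← Nat.mod_add_div t N, pow_add, pow_mul, hθN, one_pow, mul_one]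
  -- sign
  set σ : ℤ := jacobiSym ((p₂ ^ n : ℕ) : ℤ) p₁ * jacobiSym ((p₁ ^ m : ℕ) : ℤ) p₂ with hσ
  have hσ2 : σ ^ 2 = 1 := by
    rw [hσ, mul_pow, jacobiSym.sq_one, jacobiSym.sq_one, one_mul]
    · rw [Int.gcd_natCast_natCast]; exact hcop12.pow_left m
    · rw [Int.gcd_natCast_natCast]; exact hcop12.symm.pow_left n
  set A := gaussSum θ ψ with hA
  set B := gaussSum θ⁻¹ ψ with hB
  set W : ℂ := σ * (A - B) with hW
  have hpure1 : ∀ t₁, ¬ p₁ ∣ t₁ → G (p₂ ^ n * t₁) = S := by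
    intro t₁ ht₁
    obtain ⟨i, hi⟩ := primroot_cover (p₁ ^ m) p hM₁0 hpM₁ hord₁ (p₁ ^ m - 1)
      ((Nat.coprime_self_sub_left hM₁0).mpr (Nat.coprime_one_left _))
    refine gauss_pure p p₁ m hp₁ hp₁2 (θ ^ (p₂ ^ n * t₁)) ?_ ?_ (hθneg' _) i ?_ S hS hS1
    · rw [← pow_mul, hθpow, hN]; exact ⟨t₁, by ring⟩
    · rw [ne_eq, hθpow, hN, mul_comm (p₁ ^ m), Nat.mul_dvd_mul_iff_left hM₂0]
      intro h; exact ht₁ ((dvd_pow_self p₁ (by omega)).trans h)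
    · have h1 := hi.add_right 1
      rw [Nat.sub_add_cancel hM₁0] at h1
      exact (Nat.modEq_zero_iff_dvd.mp (h1.symm.trans (by simp [Nat.ModEq])))
  have hpure2 : ∀ t₂, ¬ p₂ ∣ t₂ → G (p₁ ^ m * t₂) = ((-S : ℤ) : ℂ) := by
    intro t₂ ht₂
    obtain ⟨i, hi⟩ := primroot_cover (p₂ ^ n) p hM₂0 hpM₂ hord₂ (p₂ ^ n - 1)
      ((Nat.coprime_self_sub_left hM₂0).mpr (Nat.coprime_one_left _))
    refine gauss_pure p p₂ n hp₂ hp₂2 (θ ^ (p₁ ^ m * t₂)) ?_ ?_ (hθneg' _) i ?_ (-S) (by rw [hS]; ring) hS2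
    · rw [← pow_mul, hθpow, hN]; exact ⟨t₂, by ring⟩
    · rw [ne_eq, hθpow, hN, Nat.mul_dvd_mul_iff_left hM₁0]
      intro h; exact ht₂ ((dvd_pow_self p₂ (by omega)).trans h)
    · have h1 := hi.add_right 1
      rw [Nat.sub_add_cancel hM₂0] at h1
      exact (Nat.modEq_zero_iff_dvd.mp (h1.symm.trans (by simp [Nat.ModEq])))
  have hunit : ∀ t, t.Coprime N → G t = ((A + B) + (jacobiSym t (p₁ * p₂) : ℤ) * (A - B)) / 2 := by
    intro t ht
    rcases coset_cover N (p₁ * p₂) f p hN0 hdN hd4 hJp hpN hf hford t ht with ⟨hj, i, hi⟩ | ⟨hj, i, hi⟩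
    · rw [hj]
      have : G t = A := by
        rw [← hG t, show t % N = p ^ i % N from hi, hG]
        exact gauss_frob_pow p θ i
      rw [this]; push_cast; ring
    · rw [hj]
      have : G t = B := by
        have h1 : θ ^ t = θ⁻¹ ^ (p ^ i) := by
          rw [inv_pow]
          apply eq_inv_of_mul_eq_one_left
          rw [← pow_add, hθpow]; exact hi
        simp only [hGdef]
        rw [h1]
        exact gauss_frob_pow p θ⁻¹ i
      rw [this]; push_cast; ring
  have hGh : ∀ t₁ t₂, (t₁ = 0 ∨ ¬ p₁ ∣ t₁) → (t₂ = 0 ∨ ¬ p₂ ∣ t₂) →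
      G (p₂ ^ n * t₁ + p₁ ^ m * t₂) = Ghat p₁ p₂ S (-S) (A + B) W (t₁ % p₁) (t₂ % p₂) := by
    intro t₁ t₂ h1 h2
    rcases h1 with h1 | h1
    · subst h1
      rcases h2 with h2 | h2
      · subst h2
        simp only [hGdef, Ghat, mul_zero, add_zero, pow_zero, Nat.zero_mod, if_true]
        exact gaussSum_one_left (psiF_ne_one p F)
      · have h2' : ¬ t₂ % p₂ = 0 := fun h => h2 (Nat.dvd_of_mod_eq_zero h)
        rw [mul_zero, zero_add, hpure2 t₂ h2]
        simp [Ghat, h2']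
    · have h1' : ¬ t₁ % p₁ = 0 := fun h => h1 (Nat.dvd_of_mod_eq_zero h)
      rcases h2 with h2 | h2
      · subst h2
        rw [mul_zero, add_zero, hpure1 t₁ h1]
        simp [Ghat, h1']
      · have h2' : ¬ t₂ % p₂ = 0 := fun h => h2 (Nat.dvd_of_mod_eq_zero h)
        have e1 : (p₂ ^ n * t₁ + p₁ ^ m * t₂).Coprime (p₁ ^ m) := by
          rw [Nat.coprime_add_mul_left_left]
          exact Nat.Coprime.mul_left hcop.symm
            ((((Nat.Prime.coprime_iff_not_dvd hp₁).mpr h1).symm).pow_right m)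
        have e2 : (p₂ ^ n * t₁ + p₁ ^ m * t₂).Coprime (p₂ ^ n) := by
          rw [add_comm, Nat.coprime_add_mul_left_left]
          exact Nat.Coprime.mul_left hcop
            ((((Nat.Prime.coprime_iff_not_dvd hp₂).mpr h2).symm).pow_right n)
        have e3 : (p₂ ^ n * t₁ + p₁ ^ m * t₂).Coprime N := by
          rw [hN]; exact e1.mul_right e2
        rw [hunit _ e3, jacobiSym.mul_right]
        have j1 : jacobiSym ((p₂ ^ n * t₁ + p₁ ^ m * t₂ : ℕ) : ℤ) p₁ =
            jacobiSym ((p₂ ^ n : ℕ) : ℤ) p₁ * jacobiSym t₁ p₁ := by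
          rw [hML₁, mul_assoc, jac_add_mul, Nat.cast_mul, jacobiSym.mul_left]
        have j2 : jacobiSym ((p₂ ^ n * t₁ + p₁ ^ m * t₂ : ℕ) : ℤ) p₂ =
            jacobiSym ((p₁ ^ m : ℕ) : ℤ) p₂ * jacobiSym t₂ p₂ := by
          rw [add_comm, hML₂, mul_assoc, jac_add_mul, Nat.cast_mul, jacobiSym.mul_left]
        rw [j1, j2]
        simp only [Ghat, h1', h2', if_false]
        rw [jac_nat_mod, jac_nat_mod, hW, hσ]
        push_cast; ring
  have hω₁ : IsPrimitiveRoot (ζ ^ (p₂ ^ n * p₁ ^ (m - 1))) p₁ :=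
    hζ.pow hN0 (by rw [hN, hML₁]; ring)
  have hω₂ : IsPrimitiveRoot (ζ ^ (p₁ ^ m * p₂ ^ (n - 1))) p₂ :=
    hζ.pow hN0 (by rw [hN, hML₂]; ring)
  have hNd : N = p₁ * p₂ * (p₁ ^ (m - 1) * p₂ ^ (n - 1)) := by rw [hN, hML₁, hML₂]; ring
  have hLL0 : ((p₁ ^ (m - 1) * p₂ ^ (n - 1) : ℕ) : ℂ) ≠ 0 := by
    exact_mod_cast (Nat.mul_pos hL₁0 hL₂0).ne'
  refine ⟨θ, ζ ^ (p₂ ^ n * p₁ ^ (m - 1)), ζ ^ (p₁ ^ m * p₂ ^ (n - 1)), W, ?_, hθneg, hω₁, hω₂, ?_, ?_, ?_, ?_, ?_, hθpow, hpure1, hpure2⟩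
  · rw [hθ]; exact hζ.inv.eq_orderOf.symm
  · rw [hW, mul_pow]
    have : (σ : ℂ) ^ 2 = 1 := by exact_mod_cast hσ2
    rw [this, one_mul]
  · intro a i₀ κ₁ j₀ κ₂ hi₀ hκ₁ hj₀ hκ₂
    have e1 := period_D γ hγ N ζ hζ θ hθ (p₁ ^ m) (p₂ ^ n) (p₁ ^ (m - 1)) (p₂ ^ (n - 1)) hN hM₁0 hM₂0 hcop
      (Nat.pow_le_pow_right hp₁.pos (by omega)) (Nat.pow_le_pow_right hp₂.pos (by omega)) D hD ψ a
    have e2 := fold2 p₁ (p₁ ^ (m - 1)) p₂ (p₂ ^ (n - 1)) a hp₁.pos hL₁0 hp₂.pos hL₂0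
      (by rw [← hML₁, ← hML₂]; exact hcop) ζ N (by rw [← hML₁, ← hML₂]; exact hN) hζ G hG
      (Ghat p₁ p₂ S (-S) (A + B) W) (by rw [← hML₁, ← hML₂]; exact hGh) i₀ κ₁ j₀ κ₂ hi₀
      (by rw [← hML₂]; exact hκ₁) hj₀ (by rw [← hML₁]; exact hκ₂)
    rw [← hML₁, ← hML₂] at e2
    rw [← Ghat_sum p₁ p₂ hp₁ hp₂ _ _ hω₁ hω₂]
    rw [e2, hNd] at e1
    apply mul_left_cancel₀ hLL0
    push_cast at e1 ⊢
    rw [← e1]; ring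
  · have e1 := card_D γ hγ N ζ hζ θ hθ (p₁ ^ m) (p₂ ^ n) (p₁ ^ (m - 1)) (p₂ ^ (n - 1)) hN hM₁0 hM₂0 hcop
      (Nat.pow_le_pow_right hp₁.pos (by omega)) (Nat.pow_le_pow_right hp₂.pos (by omega)) D hD
    rw [hcard] at e1
    apply Nat.eq_of_mul_eq_mul_left (Nat.mul_pos hL₁0 hL₂0)
    rw [← e1, hNd]; ring
  · intro c hc x hx
    rw [hD] at hx ⊢
    simp only [Set.mem_iUnion] at hx ⊢
    obtain ⟨i, hi, j, hj, hij⟩ := hx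
    refine ⟨i, hi, j, hj, ?_⟩
    have hx0 : x ≠ 0 := by
      obtain ⟨k, hk⟩ := hij
      rw [hk]; exact Units.ne_zero _
    have hc0 : algebraMap (ZMod p) F c ≠ 0 := by rwa [ne_eq, map_eq_zero]
    have k1 := (mem_cycClass γ hγ N ζ hζ θ hθ hN0 (p₂ ^ n * i + p₁ ^ m * j) (Units.mk0 x hx0)).mp hij
    have k2 := (mem_cycClass γ hγ N ζ hζ θ hθ hN0 (p₂ ^ n * i + p₁ ^ m * j)
      (Units.mk0 (algebraMap (ZMod p) F c * x) (mul_ne_zero hc0 hx0))).mpr (by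
        rw [Units.val_mk0, map_mul, hθp c hc, one_mul]; exact k1)
    exact k2
  · rw [hD]
    simp only [Set.mem_iUnion]
    rintro ⟨i, hi, j, hj, k, hk⟩
    exact Units.ne_zero _ hk.symm

theorem gauss_mod_l (p : ℕ) [Fact p.Prime] {F : Type*} [Field F] [Fintype F] [Algebra (ZMod p) F]
    (l k l' k' : ℕ) (hl : l.Prime) (hl' : l'.Prime) (hne : l ≠ l') (hk' : 1 ≤ k')
    (V : ValuationSubring ℂ) (hlV : (l : ℂ) ∈ V.nonunits)
    (hV : ∀ z : ℂ, IsIntegral ℤ z → z ∈ V)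
    (θ : MulChar F ℂ) (hθ : θ ^ (l ^ k * l' ^ k') = 1) (S : ℤ)
    (hpure : ∀ t, ¬ l' ∣ t → gaussSum (θ ^ (l ^ k * t)) (psiF p F) = S)
    (u : ℕ) (hu : ¬ l' ∣ u) :
    V.valuation (gaussSum (θ ^ u) (psiF p F) - S) < 1 := by
  have hcop : (l ^ k).Coprime (l' ^ k') := ((Nat.coprime_primes hl hl').mpr hne).pow k k'
  obtain ⟨y, -, hy⟩ := Nat.exists_mul_mod_eq_of_coprime u hcop (pow_pos hl'.pos k').ne'
  have hy' : l ^ k * y ≡ u [MOD l' ^ k'] := hy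
  have hly : ¬ l' ∣ y := by
    intro h
    apply hu
    have h2 : l ^ k * y ≡ u [MOD l'] := hy'.of_dvd (dvd_pow_self _ (by omega))
    exact (h2.dvd_iff dvd_rfl).mp (h.mul_left _)
  have key : ∀ a b : ℕ, a ≡ b [MOD l ^ k * l' ^ k'] → θ ^ a = θ ^ b := by
    intro a b hab
    exact pow_eq_pow_iff_modEq.mpr (hab.of_dvd (orderOf_dvd_of_pow_eq_one hθ))
  have hφ : (θ ^ u * (θ ^ (l ^ k * y))⁻¹) ^ (l ^ k) = 1 := by
    rw [mul_pow, inv_pow, mul_inv_eq_one, ← pow_mul, ← pow_mul]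
    apply key
    rw [mul_comm u, mul_comm _ (l ^ k)]
    exact (hy'.symm.mul_left' _)
  have h1 := gauss_cong l hl V hlV hV k (psiF p F) (θ ^ (l ^ k * y)) _ hφ
  rw [mul_comm (θ ^ u), mul_inv_cancel_left, hpure y hly] at h1
  exact h1

theorem X_mod_l (p : ℕ) [Fact p.Prime] {F : Type*} [Field F] [Fintype F] [Algebra (ZMod p) F]
    (l k l' k' : ℕ) (hl : l.Prime) (hl' : l'.Prime) (hne : l ≠ l') (hk' : 1 ≤ k')
    (θ : MulChar F ℂ) (hθ : θ ^ (l ^ k * l' ^ k') = 1) (S : ℤ)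
    (hpure : ∀ t, ¬ l' ∣ t → gaussSum (θ ^ (l ^ k * t)) (psiF p F) = S)
    (X : ℤ) (hX : (X : ℂ) = gaussSum θ (psiF p F) + gaussSum θ⁻¹ (psiF p F)) :
    (l : ℤ) ∣ X - 2 * S := by
  obtain ⟨V, hlV, hV⟩ := exists_val l hl
  have h1 := gauss_mod_l p l k l' k' hl hl' hne hk' V hlV hV θ hθ S hpure 1
    (by rw [Nat.dvd_one]; exact hl'.ne_one)
  have hN0 : 0 < l ^ k * l' ^ k' := Nat.mul_pos (pow_pos hl.pos _) (pow_pos hl'.pos _)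
  have h2 := gauss_mod_l p l k l' k' hl hl' hne hk' V hlV hV θ hθ S hpure (l ^ k * l' ^ k' - 1) (by
    intro h
    have h3 : l' ∣ l ^ k * l' ^ k' := (dvd_pow_self _ (by omega)).mul_left _
    have h4 := (Nat.dvd_sub h3 h)
    rw [Nat.sub_sub_self hN0, Nat.dvd_one] at h4
    exact hl'.ne_one h4)
  have h3 : θ ^ (l ^ k * l' ^ k' - 1) = θ⁻¹ := by
    apply eq_inv_of_mul_eq_one_left
    rw [← pow_succ, Nat.sub_add_cancel hN0, hθ]
  rw [h3] at h2
  rw [pow_one] at h1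
  apply dvd_of_val_lt l hl V hlV
  have : ((X - 2 * S : ℤ) : ℂ) = (gaussSum θ (psiF p F) - S) + (gaussSum θ⁻¹ (psiF p F) - S) := by
    push_cast; rw [hX]; ring
  rw [this]
  exact Valuation.map_add_lt _ h1 h2

theorem eta_rat (p : ℕ) [Fact p.Prime] {F : Type*} [Field F] [Fintype F] [Algebra (ZMod p) F]
    (D : Finset F) (hD : ∀ c : ZMod p, c ≠ 0 → ∀ x ∈ D, algebraMap (ZMod p) F c * x ∈ D) (y : F) :
    ∃ z : ℤ, ((p - 1 : ℕ) : ℂ) * ∑ x ∈ D, psiF p F (y * x) = z := by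
  classical
  have h1 : ∀ c : ZMod p, c ≠ 0 → ∑ x ∈ D, psiF p F (y * x) =
      ∑ x ∈ D, psiF p F (algebraMap (ZMod p) F c * (y * x)) := by
    intro c hc
    have hc0 : algebraMap (ZMod p) F c ≠ 0 := by rwa [ne_eq, map_eq_zero]
    symm
    refine Finset.sum_bij (fun x _ => algebraMap (ZMod p) F c * x) (fun x hx => hD c hc x hx)
      (fun x _ x' _ h => mul_left_cancel₀ hc0 h) (fun x hx => ?_) (fun x hx => ?_)
    · refine ⟨algebraMap (ZMod p) F c⁻¹ * x, hD _ (inv_ne_zero hc) x hx, ?_⟩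
      rw [← mul_assoc, ← map_mul, mul_inv_cancel₀ hc, map_one, one_mul]
    · congr 1; ring
  have h2 : ∀ w : F, ∃ z : ℤ, ∑ c ∈ Finset.univ.erase (0 : ZMod p),
      psiF p F (algebraMap (ZMod p) F c * w) = z := by
    intro w
    let χ : AddChar (ZMod p) ℂ := (psiF p F).compAddMonoidHom
      ((AddMonoidHom.mulRight w).comp (algebraMap (ZMod p) F).toAddMonoidHom)
    have e1 := AddChar.sum_eq_ite χ
    rw [← Finset.add_sum_erase _ _ (Finset.mem_univ (0 : ZMod p))] at e1
    have e2 : χ 0 = 1 := AddChar.map_zero_eq_one χ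
    have e3 : ∑ c ∈ Finset.univ.erase (0 : ZMod p),
      psiF p F (algebraMap (ZMod p) F c * w) = (∑ c ∈ Finset.univ.erase (0 : ZMod p), χ c) := rfl
    rw [e3]
    refine ⟨(if χ = 0 then (Fintype.card (ZMod p) : ℤ) else 0) - 1, ?_⟩
    rw [e2] at e1
    push_cast
    rw [← e1]; ring
  choose z hz using h2
  refine ⟨∑ x ∈ D, z (y * x), ?_⟩
  push_cast
  simp_rw [← hz]
  rw [Finset.sum_comm, ← Finset.sum_congr rfl (fun c hc => h1 c (Finset.ne_of_mem_erase hc)), Finset.sum_const,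
    Finset.card_erase_of_mem (Finset.mem_univ _), Finset.card_univ, ZMod.card, nsmul_eq_mul]

theorem eta_int (p : ℕ) [Fact p.Prime] {F : Type*} [Field F] [Fintype F] [Algebra (ZMod p) F]
    (D : Finset F) (y : F) : IsIntegral ℤ (∑ x ∈ D, psiF p F (y * x)) := by
  apply IsIntegral.sum
  intro x _
  apply IsIntegral.of_pow (n := p) (Nat.Prime.pos Fact.out)
  rw [psiF_apply, ← AddChar.map_nsmul_eq_pow]
  simp [isIntegral_one]

theorem int_of_rat (z : ℂ) (hz : IsIntegral ℤ z) (m k : ℤ) (hm : m ≠ 0) (h : (m : ℂ) * z = k) :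
    ∃ j : ℤ, z = j := by
  have hm' : (m : ℂ) ≠ 0 := by exact_mod_cast hm
  have h1 : z = algebraMap ℚ ℂ ((k : ℚ) / m) := by
    simp only [eq_ratCast]; push_cast
    rw [eq_div_iff hm', mul_comm, h]
  rw [h1] at hz
  have h2 := (isIntegral_algebraMap_iff (algebraMap ℚ ℂ).injective).mp hz
  obtain ⟨j, hj⟩ := IsIntegrallyClosed.isIntegral_iff.mp h2
  refine ⟨j, ?_⟩
  rw [h1, ← hj]; simp

theorem dvd_pow_of_val (p : ℕ) (hp : p.Prime) (V : ValuationSubring ℂ) (hpV : (p : ℂ) ∈ V.nonunits)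
    (e : ℕ) (z : ℤ) (hz : V.valuation (z : ℂ) ≤ V.valuation (p : ℂ) ^ e) : (p : ℤ) ^ e ∣ z := by
  by_cases h0 : z = 0
  · rw [h0]; exact dvd_zero _
  have hpI : Prime (p : ℤ) := Nat.prime_iff_prime_int.mp hp
  obtain ⟨u, hzu, hu⟩ := FiniteMultiplicity.exists_eq_pow_mul_and_not_dvd
    (Int.finiteMultiplicity_iff.mpr ⟨by simpa using hp.ne_one, h0⟩ : FiniteMultiplicity (p : ℤ) z)
  set j := multiplicity (p : ℤ) z with hj
  have hv1 : V.valuation (p : ℂ) < 1 := by rw [ValuationSubring.mem_nonunits_iff] at hpV; exact hpV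
  have hv0 : V.valuation (p : ℂ) ≠ 0 := by
    rw [ne_eq, Valuation.zero_iff]; exact_mod_cast hp.ne_zero
  have hu1 : V.valuation (u : ℂ) = 1 := by
    apply le_antisymm
    · rw [ValuationSubring.valuation_le_one_iff]
      exact intCast_mem V u
    · by_contra h
      push Not at h
      exact hu (dvd_of_val_lt p hp V hpV u h)
  have hz2 : V.valuation (z : ℂ) = V.valuation (p : ℂ) ^ j := by
    rw [hzu]; push_cast; rw [map_mul, map_pow, hu1, mul_one]
  rw [hz2] at hz
  have : e ≤ j := (pow_le_pow_iff_right_of_lt_one₀ (zero_lt_iff.mpr hv0) hv1).mp hz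
  rw [hzu]
  exact (pow_dvd_pow _ this).mul_right _

theorem solve_X (P Q X y b p₁ p₂ : ℤ) (hb : b = 1 ∨ b = -1) (h1 : p₁ = 2 * P + b) (h2 : p₂ = 2 * P - b)
    (hp1 : 3 ≤ p₁) (hp2 : 3 ≤ p₂) (hp14 : p₁ % 4 = 1) (hp24 : p₂ % 4 = 3) (hQ0 : Q ≠ 0)
    (hcop : IsCoprime Q (p₁ * p₂)) (heq : 4 * (P * Q) ^ 2 = X ^ 2 + p₁ * p₂ * y ^ 2) (hQX : Q ∣ X)
    (hX1 : p₁ ∣ X - 2) (hX2 : p₂ ∣ X - 2) (hQ1 : p₁ ∣ b * Q - 2) (hS1 : p₁ ∣ P * Q + 1)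
    (hS2 : p₂ ∣ -(P * Q) + 1) : X = b * Q ∧ y ^ 2 = Q ^ 2 := by
  have hbb : b ^ 2 = 1 := by rcases hb with rfl | rfl <;> norm_num
  have hd : p₁ * p₂ = 4 * P ^ 2 - 1 := by rw [h1, h2]; linear_combination -hbb
  have hn1 : ¬ p₁ ∣ 4 := by
    intro h
    have := Int.le_of_dvd (by norm_num) h
    have : p₁ = 3 ∨ p₁ = 4 := by omega
    omega
  have hn2 : ¬ p₂ ∣ 4 := by
    intro h
    have := Int.le_of_dvd (by norm_num) h
    have : p₂ = 3 ∨ p₂ = 4 := by omega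
    rcases this with h | h
    · subst h; omega
    · omega
  obtain ⟨x, hx⟩ := hQX
  have hQy : Q ∣ y := by
    have h3 : Q ^ 2 ∣ y ^ 2 := by
      apply (hcop.pow_left (m := 2)).dvd_of_dvd_mul_left
      refine ⟨4 * P ^ 2 - x ^ 2, ?_⟩
      have : p₁ * p₂ * y ^ 2 = 4 * (P * Q) ^ 2 - X ^ 2 := by rw [heq]; ring
      rw [this, hx]; ring
    exact (Int.pow_dvd_pow_iff (by norm_num)).mp h3
  obtain ⟨z, hz⟩ := hQy
  have h4 : 4 * P ^ 2 = x ^ 2 + p₁ * p₂ * z ^ 2 := by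
    have hQ2 : Q ^ 2 ≠ 0 := pow_ne_zero _ hQ0
    apply mul_left_cancel₀ hQ2
    rw [hx, hz] at heq
    linear_combination heq
  have hdd : 9 ≤ p₁ * p₂ := by nlinarith
  have h5 : x ^ 2 + p₁ * p₂ * z ^ 2 = p₁ * p₂ + 1 := by rw [← h4, hd]; ring
  have hz2 : z ^ 2 < 2 := by nlinarith [sq_nonneg x]
  by_cases hz0 : z = 0
  · exfalso
    rw [hz0] at h4
    have h6 : x ^ 2 = (2 * P) ^ 2 := by linear_combination -h4
    rcases sq_eq_sq_iff_eq_or_eq_neg.mp h6 with h | h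
    · apply hn1
      have := dvd_sub (hS1.mul_left 2) hX1
      rwa [hx, h, show 2 * (P * Q + 1) - (Q * (2 * P) - 2) = 4 by ring] at this
    · apply hn2
      have := dvd_sub (hS2.mul_left 2) hX2
      rwa [hx, h, show 2 * (-(P * Q) + 1) - (Q * (-(2 * P)) - 2) = 4 by ring] at this
  · have hz1 : z ^ 2 = 1 := by
      have : 0 < z ^ 2 := by positivity
      omega
    have hx1 : x ^ 2 = 1 := by rw [hz1] at h5; linarith
    refine ⟨?_, by rw [hz, mul_pow, hz1, mul_one]⟩
    have h7 : x ^ 2 = b ^ 2 := by rw [hx1, hbb]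
    rcases sq_eq_sq_iff_eq_or_eq_neg.mp h7 with h | h
    · rw [hx, h, mul_comm]
    · exfalso
      apply hn1
      have := (dvd_add hX1 hQ1)
      rw [hx, h, show Q * -b - 2 + (b * Q - 2) = -4 by ring, dvd_neg] at this
      exact this

open scoped Classical in
theorem core_srg (p₁ p₂ m n : ℕ) (hp₁ : p₁.Prime) (hp₂ : p₂.Prime)
    (hp₁mod : p₁ % 4 = 1) (hp₂mod : p₂ % 4 = 3) (hm : 1 ≤ m) (hn : 1 ≤ n)
    (N : ℕ) (hN : N = p₁ ^ m * p₂ ^ n)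
    (p : ℕ) [Fact p.Prime]
    (hord₁ : orderOf ((p : ZMod (p₁ ^ m))) = Nat.totient (p₁ ^ m))
    (hord₂ : orderOf ((p : ZMod (p₂ ^ n))) = Nat.totient (p₂ ^ n))
    (f : ℕ) (hf : f = orderOf ((p : ZMod N))) (hford : 2 * f = Nat.totient N)
    {F : Type*} [Field F] [Fintype F] [Algebra (ZMod p) F] (hcard : Fintype.card F = p ^ f)
    (γ : Fˣ) (hγ : ∀ x : Fˣ, x ∈ Subgroup.zpowers γ)
    (D : Set F)
    (hD : D = ⋃ i < p₁ ^ (m - 1), ⋃ j < p₂ ^ (n - 1),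
      cycClass γ N (p₂ ^ n * i + p₁ ^ m * j))
    (h : ℕ) (hB : |∑ j ∈ Finset.range (p₁ * p₂), jacobiSym j (p₁ * p₂) * (j : ℤ)| ≤
      ((p₁ * p₂ : ℕ) : ℤ) * h)
    (b : ℤ) (hb1 : b = 1 ∨ b = -1)
    (e : ℕ) (heven : h = 2 * e)
    (e' : ℕ) (hfe : f = h + 2 * e')
    (hmod : b * (p : ℤ) ^ e' ≡ 2 [ZMOD ((p₁ : ℤ) * p₂)])
    (hp₁eq : (p₁ : ℤ) = 2 * (p : ℤ) ^ e + b)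
    (hp₂eq : (p₂ : ℤ) = 2 * (p : ℤ) ^ e - b) :
    ∃ k lam mu : ℕ, ∃ r s : ℤ,
      (p₁ : ℤ) * p₂ * r = 2 * b * (p : ℤ) ^ (h + e') - 1 ∧
      (p₁ : ℤ) * p₂ * s = b * (p : ℤ) ^ e' - 2 * b * (p : ℤ) ^ (h + e') - 1 ∧
      p₁ * p₂ * k = p ^ f - 1 ∧
      (lam : ℤ) = r + s + r * s + k ∧
      (mu : ℤ) = k + r * s ∧
      (cayley D).IsSRGWith (p ^ f) k lam mu ∧
      (∀ μ' : ℝ,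
        (∃ x : F → ℝ, x ≠ 0 ∧ (∑ i, x i) = 0 ∧
          ((cayley D).adjMatrix ℝ).mulVec x = μ' • x) ↔ (μ' = (r : ℝ) ∨ μ' = (s : ℝ))) := by
  have hp : p.Prime := Fact.out
  have hne : p₁ ≠ p₂ := by rintro rfl; omega
  have hp₁2 : p₁ ≠ 2 := by rintro rfl; omega
  have hp₂2 : p₂ ≠ 2 := by rintro rfl; omega
  have hp₁3 : 3 ≤ p₁ := by have := hp₁.two_le; omega
  have hp₂3 : 3 ≤ p₂ := by have := hp₂.two_le; omega
  have hM₁0 : 0 < p₁ ^ m := pow_pos hp₁.pos _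
  have hM₂0 : 0 < p₂ ^ n := pow_pos hp₂.pos _
  have hL₁0 : 0 < p₁ ^ (m - 1) := pow_pos hp₁.pos _
  have hL₂0 : 0 < p₂ ^ (n - 1) := pow_pos hp₂.pos _
  have hN0 : 0 < N := by rw [hN]; positivity
  have hcop12 : p₁.Coprime p₂ := (Nat.coprime_primes hp₁ hp₂).mpr hne
  have hML₁ : p₁ ^ m = p₁ * p₁ ^ (m - 1) := by rw [← pow_succ']; congr 1; omega
  have hML₂ : p₂ ^ n = p₂ * p₂ ^ (n - 1) := by rw [← pow_succ']; congr 1; omega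
  have hpM₁ := coprime_of_orderOf _ p hM₁0 hord₁
  have hpM₂ := coprime_of_orderOf _ p hM₂0 hord₂
  have hpp₁ : p.Coprime p₁ := (Nat.coprime_pow_right_iff (by omega) _ _).mp hpM₁
  have hpp₂ : p.Coprime p₂ := (Nat.coprime_pow_right_iff (by omega) _ _).mp hpM₂
  have hpN : p.Coprime N := by rw [hN]; exact hpM₁.mul_right hpM₂
  have hJ₁ := jac_primroot p p₁ m hp₁ hp₁2 hm hord₁
  have hJ₂ := jac_primroot p p₂ n hp₂ hp₂2 hn hord₂
  have : NeZero p₁ := ⟨hp₁.ne_zero⟩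
  have : NeZero p₂ := ⟨hp₂.ne_zero⟩
  have hJp : jacobiSym p (p₁ * p₂) = 1 := by rw [jacobiSym.mul_right, hJ₁, hJ₂]; norm_num
  have hd4 : (p₁ * p₂) % 4 = 3 := by rw [Nat.mul_mod, hp₁mod, hp₂mod]
  have hf0 : f ≠ 0 := by
    rintro rfl
    have := Nat.totient_pos.mpr hN0
    omega
  have hN1 : 1 < N := by
    have : p₁ ∣ N := by rw [hN]; exact (dvd_pow_self _ (by omega)).mul_right _
    have := Nat.le_of_dvd hN0 this
    omega
  -- the integers P and Q
  obtain ⟨P, hP⟩ : ∃ P : ℤ, P = (p : ℤ) ^ e := ⟨_, rfl⟩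
  obtain ⟨Q, hQ⟩ : ∃ Q : ℤ, Q = (p : ℤ) ^ e' := ⟨_, rfl⟩
  have hQ0 : Q ≠ 0 := by rw [hQ]; exact pow_ne_zero _ (by exact_mod_cast hp.ne_zero)
  have hPh : (p : ℤ) ^ (h + e') = Q * P ^ 2 := by rw [hQ, hP, heven]; ring
  rw [← hP] at hp₁eq hp₂eq
  rw [← hQ] at hmod ⊢
  rw [hPh]
  have hmodd : (p₁ : ℤ) * p₂ ∣ b * Q - 2 := hmod.symm.dvd
  have hQ1 : (p₁ : ℤ) ∣ b * Q - 2 := (dvd_mul_right _ _).trans hmodd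
  have hQ2 : (p₂ : ℤ) ∣ b * Q - 2 := (dvd_mul_left _ _).trans hmodd
  have hS : (Fintype.card F : ℤ) = (P * Q) ^ 2 := by
    rw [hcard, hfe, heven, hP, hQ]; push_cast; ring
  have hcancel2 : ∀ l : ℕ, l.Prime → l ≠ 2 → ∀ z : ℤ, (l : ℤ) ∣ 2 * z → (l : ℤ) ∣ z := by
    intro l hl hl2 z hz
    rcases (Nat.prime_iff_prime_int.mp hl).dvd_or_dvd hz with h1 | h1
    · exfalso
      have h2 : l ∣ 2 := by exact_mod_cast h1
      exact hl2 ((Nat.prime_dvd_prime_iff_eq hl Nat.prime_two).mp h2)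
    · exact h1
  have hS1 : (p₁ : ℤ) ∣ P * Q + 1 := by
    apply hcancel2 p₁ hp₁ hp₁2
    have h1 : (p₁ : ℤ) ∣ p₁ * Q - (b * Q - 2) := dvd_sub (dvd_mul_right _ _) hQ1
    rwa [show (p₁ : ℤ) * Q - (b * Q - 2) = 2 * (P * Q + 1) by rw [hp₁eq]; ring] at h1
  have hS2 : (p₂ : ℤ) ∣ -(P * Q) + 1 := by
    apply hcancel2 p₂ hp₂ hp₂2
    have h1 : (p₂ : ℤ) ∣ -(p₂ * Q) - (b * Q - 2) := dvd_sub (dvd_neg.mpr (dvd_mul_right _ _)) hQ2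
    rwa [show -((p₂ : ℤ) * Q) - (b * Q - 2) = 2 * (-(P * Q) + 1) by rw [hp₂eq]; ring] at h1
  obtain ⟨θ, ω₁, ω₂, W, hθord, hθneg, hω₁, hω₂, hW, hper, hcardD, hinv, h0D, hθpow, hpure1, hpure2⟩ :=
    period_formula p γ hγ p₁ p₂ m n hp₁ hp₂ hp₁mod hp₂mod hm hn N hN hord₁ hord₂ f hf hford hcard D hD
      (P * Q) hS hS1 hS2
  obtain ⟨T₁, hT₁⟩ : ∃ T : ℕ → ℂ, ∀ κ, T κ = ∑ u ∈ Finset.range p₁, ((jacobiSym u p₁ : ℤ) : ℂ) * ω₁ ^ (u * κ) :=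
    ⟨_, fun _ => rfl⟩
  obtain ⟨T₂, hT₂⟩ : ∃ T : ℕ → ℂ, ∀ κ, T κ = ∑ u ∈ Finset.range p₂, ((jacobiSym u p₂ : ℤ) : ℂ) * ω₂ ^ (u * κ) :=
    ⟨_, fun _ => rfl⟩
  have hT₁0 : ∀ κ, p₁ ∣ κ → T₁ κ = 0 := fun κ hκ => by rw [hT₁]; exact T_zero p₁ hp₁ hp₁2 ω₁ hω₁ κ hκ
  have hT₂0 : ∀ κ, p₂ ∣ κ → T₂ κ = 0 := fun κ hκ => by rw [hT₂]; exact T_zero p₂ hp₂ hp₂2 ω₂ hω₂ κ hκ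
  have hjac₁ : jacobiSym (-1) p₁ = 1 := by
    rw [jacobiSym.at_neg_one (by rw [Nat.odd_iff]; omega), ZMod.χ₄_nat_one_mod_four hp₁mod]
  have hjac₂ : jacobiSym (-1) p₂ = -1 := by
    rw [jacobiSym.at_neg_one (by rw [Nat.odd_iff]; omega), ZMod.χ₄_nat_three_mod_four hp₂mod]
  have hT₁s : ∀ κ, ¬ p₁ ∣ κ → T₁ κ ^ 2 = p₁ := fun κ hκ => by
    rw [hT₁, T_sq p₁ hp₁ hp₁2 ω₁ hω₁ κ hκ, hjac₁]; push_cast; ring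
  have hT₂s : ∀ κ, ¬ p₂ ∣ κ → T₂ κ ^ 2 = -p₂ := fun κ hκ => by
    rw [hT₂, T_sq p₂ hp₂ hp₂2 ω₂ hω₂ κ hκ, hjac₂]; push_cast; ring
  simp only [← hT₁, ← hT₂] at hper
  obtain ⟨A, hA⟩ : ∃ A, A = gaussSum θ (psiF p F) := ⟨_, rfl⟩
  obtain ⟨B, hB'⟩ : ∃ B, B = gaussSum θ⁻¹ (psiF p F) := ⟨_, rfl⟩
  rw [← hA, ← hB'] at hW
  simp only [← hA, ← hB'] at hper
  have hAint : IsIntegral ℤ A := by rw [hA]; exact gauss_isIntegral _ _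
  have hBint : IsIntegral ℤ B := by rw [hB']; exact gauss_isIntegral _ _
  have hAB : A * B = ((P : ℂ) * Q) ^ 2 := by
    rw [hA, hB', gauss_mul_inv p θ ?_ hθneg]
    · exact_mod_cast hS
    · intro h1
      have := (hθpow 1).mp (by rw [pow_one]; exact h1)
      rw [Nat.dvd_one] at this; omega
  have hWint : IsIntegral ℤ W := by
    apply IsIntegral.of_pow (n := 2) (by norm_num)
    rw [hW]; exact (hAint.sub hBint).pow 2
  obtain ⟨η, hη⟩ : ∃ η : F → ℂ, ∀ y, η y = ∑ x ∈ Finset.univ.filter (· ∈ D), psiF p F (y * x) := ⟨_, fun _ => rfl⟩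
  have hηint : ∀ y, ∃ z : ℤ, η y = z := by
    intro y
    obtain ⟨z, hz⟩ := eta_rat p (Finset.univ.filter (· ∈ D)) (by
      intro c hc x hx
      simp only [Finset.mem_filter, Finset.mem_univ, true_and] at hx ⊢
      exact hinv c hc x hx) y
    rw [← hη] at hz
    refine int_of_rat (η y) ?_ (p - 1 : ℕ) z ?_ (by rw [← hz]; push_cast; rfl)
    · rw [hη]; exact eta_int p _ y
    · have := hp.two_le
      have : p - 1 ≠ 0 := by omega
      exact_mod_cast this
  simp only [← hη] at hper
  have hd0 : ((p₁ : ℂ) * p₂) ≠ 0 := mul_ne_zero (by exact_mod_cast hp₁.ne_zero) (by exact_mod_cast hp₂.ne_zero)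
  -- X is an integer
  obtain ⟨X, hX⟩ : ∃ X : ℤ, A + B = X := by
    have h1 := hper 0 0 0 0 0 hL₁0 (by simp) hL₂0 (by simp)
    obtain ⟨z, hz⟩ := hηint ((γ ^ 0 : Fˣ) : F)
    rw [hz, hT₁0 0 (dvd_zero _)] at h1
    simp only [dvd_zero, if_true] at h1
    refine int_of_rat (A + B) (hAint.add hBint) (((p₁ : ℤ) - 1) * ((p₂ : ℤ) - 1))
      (2 * ((p₁ : ℤ) * p₂ * z + 1 - P * Q * (p₁ - 1) + P * Q * (p₂ - 1))) ?_ ?_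
    · apply mul_ne_zero <;> omega
    · push_cast at h1 ⊢
      linear_combination -2 * h1
  have hWsq : W ^ 2 = (X : ℂ) ^ 2 - 4 * ((P : ℂ) * Q) ^ 2 := by
    rw [hW, ← hX, ← hAB]; ring
  have hWT : ∀ κ₁ κ₂, ¬ p₁ ∣ κ₁ → ¬ p₂ ∣ κ₂ → (W * (T₁ κ₁ * T₂ κ₂)) ^ 2 =
      ((p₁ : ℂ) * p₂) * (4 * ((P : ℂ) * Q) ^ 2 - X ^ 2) := by
    intro κ₁ κ₂ h1 h2
    rw [mul_pow, mul_pow, hWsq, hT₁s _ h1, hT₂s _ h2]; ring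
  -- the integer w
  have hκ1 : ¬ p₁ ∣ p₁ * p₂ ^ (n - 1) + p₂ ^ n := by
    rw [Nat.dvd_add_right (dvd_mul_right _ _)]
    intro h1
    exact hne ((Nat.prime_dvd_prime_iff_eq hp₁ hp₂).mp (hp₁.dvd_of_dvd_pow h1))
  have hκ2 : ¬ p₂ ∣ p₁ ^ m + p₂ * p₁ ^ (m - 1) := by
    rw [Nat.dvd_add_left (dvd_mul_right _ _)]
    intro h1
    exact hne ((Nat.prime_dvd_prime_iff_eq hp₂ hp₁).mp (hp₂.dvd_of_dvd_pow h1)).symm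
  obtain ⟨w, hw⟩ : ∃ w : ℤ, W * (T₁ (p₁ * p₂ ^ (n - 1) + p₂ ^ n) * T₂ (p₁ ^ m + p₂ * p₁ ^ (m - 1))) = w := by
    have h1 := hper (p₁ ^ m * p₂ ^ (n - 1) + p₂ ^ n * p₁ ^ (m - 1)) 0 (p₁ * p₂ ^ (n - 1) + p₂ ^ n) 0
      (p₁ ^ m + p₂ * p₁ ^ (m - 1)) hL₁0 (by rw [hML₁]; ring) hL₂0 (by rw [hML₂]; ring)
    obtain ⟨z, hz⟩ := hηint ((γ ^ (p₁ ^ m * p₂ ^ (n - 1) + p₂ ^ n * p₁ ^ (m - 1)) : Fˣ) : F)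
    rw [hz, if_neg hκ1, if_neg hκ2, hX] at h1
    refine int_of_rat _ ?_ 1 (2 * ((p₁ : ℤ) * p₂ * z + 1) - X) one_ne_zero ?_
    · refine hWint.mul (IsIntegral.mul ?_ ?_)
      · apply IsIntegral.of_pow (n := 2) (by norm_num)
        rw [hT₁s _ hκ1]; simpa using isIntegral_algebraMap (R := ℤ) (A := ℂ) (x := (p₁ : ℤ))
      · apply IsIntegral.of_pow (n := 2) (by norm_num)
        rw [hT₂s _ hκ2]; apply IsIntegral.neg; simpa using isIntegral_algebraMap (R := ℤ) (A := ℂ) (x := (p₂ : ℤ))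
    · push_cast at h1 ⊢
      linear_combination -2 * h1
  have hw2 : w ^ 2 = (p₁ : ℤ) * p₂ * (4 * (P * Q) ^ 2 - X ^ 2) := by
    have h1 := hWT _ _ hκ1 hκ2
    rw [hw] at h1
    exact_mod_cast h1
  have hp₁I : Prime (p₁ : ℤ) := Nat.prime_iff_prime_int.mp hp₁
  have hp₂I : Prime (p₂ : ℤ) := Nat.prime_iff_prime_int.mp hp₂
  have hdw : (p₁ : ℤ) * p₂ ∣ w := by
    apply IsCoprime.mul_dvd (by exact_mod_cast hcop12.isCoprime)
    · apply hp₁I.dvd_of_dvd_pow (n := 2); rw [hw2, mul_assoc]; exact dvd_mul_right _ _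
    · apply hp₂I.dvd_of_dvd_pow (n := 2); rw [hw2, mul_comm (p₁ : ℤ), mul_assoc]; exact dvd_mul_right _ _
  obtain ⟨y, hy⟩ := hdw
  have hdI : (p₁ : ℤ) * p₂ ≠ 0 := mul_ne_zero hp₁I.ne_zero hp₂I.ne_zero
  have heq : 4 * (P * Q) ^ 2 = X ^ 2 + p₁ * p₂ * y ^ 2 := by
    rw [hy] at hw2
    apply mul_left_cancel₀ hdI
    linear_combination -hw2
  -- congruences for X
  have hXeq : (X : ℂ) = gaussSum θ (psiF p F) + gaussSum θ⁻¹ (psiF p F) := by rw [← hX, hA, hB']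
  have hX1 : (p₁ : ℤ) ∣ X - 2 := by
    have h1 := X_mod_l p p₁ m p₂ n hp₁ hp₂ hne hn θ ((hθpow _).mpr (by rw [hN])) (-(P * Q)) hpure2 X hXeq
    have h2 := dvd_sub h1 (hS1.mul_left 2)
    rwa [show X - 2 * -(P * Q) - 2 * (P * Q + 1) = X - 2 by ring] at h2
  have hX2 : (p₂ : ℤ) ∣ X - 2 := by
    have h1 := X_mod_l p p₂ n p₁ m hp₂ hp₁ hne.symm hm θ ((hθpow _).mpr (by rw [hN, mul_comm])) (P * Q) hpure1 X hXeq
    have h2 := dvd_sub h1 (hS2.mul_left 2)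
    rwa [show X - 2 * (P * Q) - 2 * (-(P * Q) + 1) = X - 2 by ring] at h2
  -- k
  obtain ⟨k, hk⟩ : ∃ k, (Finset.univ.filter (· ∈ D)).card = k := ⟨_, rfl⟩
  rw [hk] at hcardD
  have hpf1 : 1 < p ^ f := Nat.one_lt_pow hf0 hp.one_lt
  have hk0 : 0 < k := by
    rcases Nat.eq_zero_or_pos k with h1 | h1
    · rw [h1, mul_zero] at hcardD; omega
    · exact h1
  have hd9 : 9 ≤ p₁ * p₂ := Nat.mul_le_mul hp₁3 hp₂3
  have hkd : 9 * k ≤ p ^ f - 1 := by rw [← hcardD]; exact Nat.mul_le_mul_right _ hd9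
  -- divisibility of X
  have hQX : Q ∣ X := by
    have hbound : ∀ t : ℕ, t.Coprime N → N * e' ≤ ∑ i ∈ Finset.range f, (p ^ i * t) % N := by
      intro t ht
      refine coset_sum N (p₁ * p₂) (p₁ ^ (m - 1) * p₂ ^ (n - 1)) f h e' p ?_ hN0 ?_ hd4 hJp hpN hf hford hfe hB t ht
      · rw [hN, hML₁, hML₂]; ring
      · intro x
        rw [hN, Nat.coprime_mul_iff_right, Nat.coprime_mul_iff_right,
          Nat.coprime_pow_right_iff (by omega), Nat.coprime_pow_right_iff (by omega)]
    obtain ⟨V, hpV, hV⟩ := exists_val p hp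
    have h1 := stick_main p V hpV hV f hf0 hcard (by omega) γ hγ N e' hN1 hbound θ hθord
    have h2 := stick_main p V hpV hV f hf0 hcard (by omega) γ hγ N e' hN1 hbound θ⁻¹ (by
      rw [MulChar.inv_apply_eq_inv', ← hθord]
      apply orderOf_eq_orderOf_iff.mpr
      intro j
      rw [inv_pow, inv_eq_one])
    rw [hQ]
    apply dvd_pow_of_val p hp V hpV
    rw [hXeq]
    exact (Valuation.map_add_le _ h1 h2)
  have hcopQ : IsCoprime Q ((p₁ : ℤ) * p₂) := by
    rw [hQ]
    exact IsCoprime.pow_left (by exact_mod_cast (hpp₁.mul_right hpp₂).isCoprime)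
  obtain ⟨hXb, hyQ⟩ := solve_X P Q X y b p₁ p₂ hb1 hp₁eq hp₂eq (by exact_mod_cast hp₁3) (by exact_mod_cast hp₂3)
    (by exact_mod_cast hp₁mod) (by exact_mod_cast hp₂mod) hQ0 hcopQ heq hQX hX1 hX2 hQ1 hS1 hS2
  have hWT' : ∀ κ₁ κ₂, ¬ p₁ ∣ κ₁ → ¬ p₂ ∣ κ₂ → W * (T₁ κ₁ * T₂ κ₂) = ((p₁ : ℂ) * p₂) * Q ∨
      W * (T₁ κ₁ * T₂ κ₂) = -(((p₁ : ℂ) * p₂) * Q) := by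
    intro κ₁ κ₂ h1 h2
    rw [← sq_eq_sq_iff_eq_or_eq_neg, hWT κ₁ κ₂ h1 h2]
    have h3 : 4 * (P * Q) ^ 2 - X ^ 2 = (p₁ : ℤ) * p₂ * Q ^ 2 := by rw [heq, hyQ]; ring
    have h4 : 4 * ((P : ℂ) * Q) ^ 2 - (X : ℂ) ^ 2 = (p₁ : ℂ) * p₂ * Q ^ 2 := by exact_mod_cast h3
    rw [h4]; ring
  have hp₁c : (p₁ : ℂ) = 2 * P + b := by exact_mod_cast hp₁eq
  have hp₂c : (p₂ : ℂ) = 2 * P - b := by exact_mod_cast hp₂eq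
  have hXc : A + B = b * Q := by rw [hX, hXb]; push_cast; ring
  simp only [hXc] at hper
  obtain ⟨R, hR⟩ : ∃ R : ℂ, R = 2 * b * (Q * P ^ 2) - 1 := ⟨_, rfl⟩
  obtain ⟨R', hR'⟩ : ∃ R : ℂ, R = b * Q - 2 * b * (Q * P ^ 2) - 1 := ⟨_, rfl⟩
  have hval : ∀ a : ℕ, ((p₁ : ℂ) * p₂) * η ((γ ^ a : Fˣ) : F) = R ∨ ((p₁ : ℂ) * p₂) * η ((γ ^ a : Fˣ) : F) = R' := by
    intro a
    obtain ⟨i₀, κ₁, hi₀, hκ₁⟩ := ex_kappa (p₂ ^ n) (p₁ ^ (m - 1)) a hL₁0 (hcop12.symm.pow _ _)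
    obtain ⟨j₀, κ₂, hj₀, hκ₂⟩ := ex_kappa (p₁ ^ m) (p₂ ^ (n - 1)) a hL₂0 (hcop12.pow _ _)
    rw [hper a i₀ κ₁ j₀ κ₂ hi₀ hκ₁ hj₀ hκ₂, hR, hR']
    by_cases h1 : p₁ ∣ κ₁
    · rw [if_pos h1, hT₁0 κ₁ h1]
      by_cases h2 : p₂ ∣ κ₂
      · rw [if_pos h2, hp₁c, hp₂c]
        left
        rcases hb1 with rfl | rfl <;> (push_cast; ring)
      · rw [if_neg h2, hp₁c]
        rcases hb1 with rfl | rfl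
        · left; push_cast; ring
        · right; push_cast; ring
    · rw [if_neg h1]
      by_cases h2 : p₂ ∣ κ₂
      · rw [if_pos h2, hT₂0 κ₂ h2, hp₂c]
        rcases hb1 with rfl | rfl
        · right; push_cast; ring
        · left; push_cast; ring
      · rw [if_neg h2, div_mul_eq_mul_div W]
        rcases hWT' κ₁ κ₂ h1 h2 with h3 | h3
        · rw [h3, hp₁c, hp₂c]
          rcases hb1 with rfl | rfl
          · left; push_cast; ring
          · right; push_cast; ring
        · rw [h3, hp₁c, hp₂c]
          rcases hb1 with rfl | rfl
          · right; push_cast; ring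
          · left; push_cast; ring
  have hrat : ((p₁ : ℂ) * p₂) * η ((γ ^ 0 : Fˣ) : F) = R := by
    rw [hper 0 0 0 0 0 hL₁0 (by simp) hL₂0 (by simp), hR, if_pos (dvd_zero _), if_pos (dvd_zero _),
      hT₁0 0 (dvd_zero _), hp₁c, hp₂c]
    rcases hb1 with rfl | rfl <;> (push_cast; ring)
  have hsat : ∃ a : ℕ, ((p₁ : ℂ) * p₂) * η ((γ ^ a : Fˣ) : F) = R' := by
    have hnd1 : ¬ p₁ ∣ p₂ ^ n := fun h1 =>
      hne ((Nat.prime_dvd_prime_iff_eq hp₁ hp₂).mp (hp₁.dvd_of_dvd_pow h1))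
    have hnd2 : ¬ p₂ ∣ p₁ ^ m := fun h1 =>
      hne ((Nat.prime_dvd_prime_iff_eq hp₂ hp₁).mp (hp₂.dvd_of_dvd_pow h1)).symm
    rcases hb1 with rfl | rfl
    · refine ⟨p₂ ^ n * p₁ ^ (m - 1), ?_⟩
      rw [hper _ 0 (p₂ ^ n) 0 (p₂ * p₁ ^ (m - 1)) hL₁0 (by ring) hL₂0 (by rw [hML₂]; ring), hR', if_neg hnd1,
        if_pos (dvd_mul_right _ _), hT₂0 _ (dvd_mul_right _ _), hp₂c]
      push_cast; ring
    · refine ⟨p₁ ^ m * p₂ ^ (n - 1), ?_⟩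
      rw [hper _ 0 (p₁ * p₂ ^ (n - 1)) 0 (p₁ ^ m) hL₁0 (by rw [hML₁]; ring) hL₂0 (by ring), hR', if_neg hnd2,
        if_pos (dvd_mul_right _ _), hT₁0 _ (dvd_mul_right _ _), hp₁c]
      push_cast; ring
  obtain ⟨a', ha'⟩ := hsat
  obtain ⟨r, hr⟩ := hηint ((γ ^ 0 : Fˣ) : F)
  obtain ⟨s, hs⟩ := hηint ((γ ^ a' : Fˣ) : F)
  have hdr := hrat
  rw [hr, hR] at hdr
  have hds := ha'
  rw [hs, hR'] at hds
  have hk1 : k + 1 < Fintype.card F := by rw [hcard]; omega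
  obtain ⟨lam, mu, hlam, hmu, hsrg, heig⟩ := srg_of_periods (psiF p F) (psiF_prim p F) D h0D (by
      intro x hx
      have := hinv (-1) (by simp) x hx
      simpa using this) k hk hk0 hk1 r s (by
      intro y hy0
      rw [← hη]
      obtain ⟨a, ha⟩ := mem_powers_iff_mem_zpowers.mpr (hγ (Units.mk0 y hy0))
      have hya : ((γ ^ a : Fˣ) : F) = y := by
        have h1 : γ ^ a = Units.mk0 y hy0 := ha
        rw [h1]; rfl
      rw [← hya]
      rcases hval a with h1 | h1
      · left; apply mul_left_cancel₀ hd0; rw [h1, ← hr, hrat]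
      · right; apply mul_left_cancel₀ hd0; rw [h1, ← hs, ha']) ⟨_, Units.ne_zero _, by rw [← hη]; exact hr⟩
      ⟨_, Units.ne_zero _, by rw [← hη]; exact hs⟩
  rw [hcard] at hsrg
  exact ⟨k, lam, mu, r, s, by exact_mod_cast hdr, by exact_mod_cast hds, hcardD, hlam, hmu, hsrg, heig⟩

/-- Corollary 3.3 of the paper, with the explicit parameters: valency
`k = (p^f - 1)/(p₁p₂)`, restricted eigenvalues `r = (2b·p^{(f+h)/2} - 1)/(p₁p₂)` and
`s = (b·p^{(f-h)/2} - 2b·p^{(f+h)/2} - 1)/(p₁p₂)`, and parameters `λ = r + s + rs + k`,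
`μ = k + rs`.  (Here `f = h + 2e'`, so `(f+h)/2 = h + e'` and `(f-h)/2 = e'`.) -/
theorem statement_14 (p₁ p₂ m n : ℕ) (hp₁ : p₁.Prime) (hp₂ : p₂.Prime)
    (hp₁mod : p₁ % 4 = 1) (hp₂mod : p₂ % 4 = 3) (hm : 1 ≤ m) (hn : 1 ≤ n)
    (N : ℕ) (hN : N = p₁ ^ m * p₂ ^ n)
    (p : ℕ) (hp : p.Prime)
    (hord₁ : orderOf ((p : ZMod (p₁ ^ m))) = Nat.totient (p₁ ^ m))
    (hord₂ : orderOf ((p : ZMod (p₂ ^ n))) = Nat.totient (p₂ ^ n))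
    (f : ℕ) (hf : f = orderOf ((p : ZMod N))) (hford : 2 * f = Nat.totient N)
    (F : Type*) [Field F] [Fintype F] (hcard : Fintype.card F = p ^ f)
    (γ : Fˣ) (hγ : ∀ x : Fˣ, x ∈ Subgroup.zpowers γ)
    (D : Set F)
    (hD : D = ⋃ i < p₁ ^ (m - 1), ⋃ j < p₂ ^ (n - 1),
      cycClass γ N (p₂ ^ n * i + p₁ ^ m * j))
    -- `h` is the class number of `ℚ(√-p₁p₂)`
    (K : Type*) [Field K] [NumberField K] (α : K)
    (hα : α ^ 2 = -((p₁ : K) * p₂)) (hKα : Algebra.adjoin ℚ {α} = ⊤)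
    (h : ℕ) (hh : h = NumberField.classNumber K)
    -- `h` is even and `b, c ∈ {1, -1}` satisfy the stated conditions
    (b c : ℤ) (hb1 : b = 1 ∨ b = -1) (hc1 : c = 1 ∨ c = -1)
    (e : ℕ) (heven : h = 2 * e)
    (hbc : 4 * (p : ℤ) ^ h = b ^ 2 + (p₁ : ℤ) * p₂ * c ^ 2)
    (e' : ℕ) (hfe : f = h + 2 * e')
    (hmod : b * (p : ℤ) ^ e' ≡ 2 [ZMOD ((p₁ : ℤ) * p₂)])
    (hp₁eq : (p₁ : ℤ) = 2 * (p : ℤ) ^ e + b)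
    (hp₂eq : (p₂ : ℤ) = 2 * (p : ℤ) ^ e - b) :
    ∃ k lam mu : ℕ, ∃ r s : ℤ,
      (p₁ : ℤ) * p₂ * r = 2 * b * (p : ℤ) ^ (h + e') - 1 ∧
      (p₁ : ℤ) * p₂ * s = b * (p : ℤ) ^ e' - 2 * b * (p : ℤ) ^ (h + e') - 1 ∧
      p₁ * p₂ * k = p ^ f - 1 ∧
      (lam : ℤ) = r + s + r * s + k ∧
      (mu : ℤ) = k + r * s ∧
      (cayley D).IsSRGWith (p ^ f) k lam mu ∧
      (∀ μ' : ℝ,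
        (∃ x : F → ℝ, x ≠ 0 ∧ (∑ i, x i) = 0 ∧
          ((cayley D).adjMatrix ℝ).mulVec x = μ' • x) ↔ (μ' = (r : ℝ) ∨ μ' = (s : ℝ))) := by
  have : Fact p.Prime := ⟨hp⟩
  have : CharP F p := charP_of_card_eq_prime_pow hcard
  let _ : Algebra (ZMod p) F := ZMod.algebra F p
  have hB := class_bound α p₁ p₂ hp₁ hp₂ hp₁mod hp₂mod hα hKα
  rw [← hh] at hB
  exact core_srg p₁ p₂ m n hp₁ hp₂ hp₁mod hp₂mod hm hn N hN p hord₁ hord₂ f hf hford hcard γ hγ D hD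
    h (by push_cast; exact hB) b hb1 e heven e' hfe hmod hp₁eq hp₂eq
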